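/- The set of quadruples (n, a, x, y) of integers with a ≠ 0, max{|x|, |y|} ≥ 2 and |F_{n,a}(x, y)| = 1 is finite; equivalently, there is an absolute constant C such that every such quadruple satisfies max{|n|, |a|, |x|, |y|} ≤ C. -/

import Mathlib

noncomputable section

/-- The polynomial `f_n(X) = X³ − (n−1)X² − (n+2)X − 1`. -/
def fn (n : ℤ) (X : ℝ) : ℝ := X ^ 3 - ((n : ℝ) - 1) * X ^ 2 - ((n : ℝ) + 2) * X - 1

/-- `l0, l1, l2` are the three distinct real roots of `f_n`. -/
def IsRoots (n : ℤ) (l0 l1 l2 : ℝ) : Prop :=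
  fn n l0 = 0 ∧ fn n l1 = 0 ∧ fn n l2 = 0 ∧ l0 ≠ l1 ∧ l0 ≠ l2 ∧ l1 ≠ l2

/-- The form `F_{n,a}(x,y) = ∏ (x − λᵃ y)` over the three roots `λ` of `f_n`. -/
def Fna (a : ℤ) (l0 l1 l2 x y : ℝ) : ℝ :=
  (x - l0 ^ a * y) * (x - l1 ^ a * y) * (x - l2 ^ a * y)

/-! ### Entire functions with small derivatives at many integer points -/

theorem differentiable_dslope {F : ℂ → ℂ} (hF : Differentiable ℂ F) (c : ℂ) :
    Differentiable ℂ (dslope F c) := by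
  rw [← differentiableOn_univ]
  exact (Complex.differentiableOn_dslope Filter.univ_mem).2 hF.differentiableOn

theorem eq_add_mul_dslope (F : ℂ → ℂ) (c z : ℂ) : F z = F c + (z - c) * dslope F c z := by
  have h := sub_smul_dslope F c z
  rw [smul_eq_mul] at h
  rw [h]; ring

theorem differentiable_iteratedDeriv {F : ℂ → ℂ} (hF : Differentiable ℂ F) (k : ℕ) :
    Differentiable ℂ (iteratedDeriv k F) :=
  hF.contDiff.differentiable_iteratedDeriv (n := (k + 1 : ℕ)) k
    (by exact_mod_cast Nat.lt_succ_self k)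

theorem iteratedDeriv_succ_eq_dslope {F : ℂ → ℂ} (hF : Differentiable ℂ F) (c : ℂ) (k : ℕ) :
    iteratedDeriv (k + 1) F = fun z => (z - c) * iteratedDeriv (k + 1) (dslope F c) z +
      (k + 1) * iteratedDeriv k (dslope F c) z := by
  have hG := differentiable_dslope hF c
  induction k with
  | zero =>
    funext z
    have h1 : F = fun z => F c + (z - c) * dslope F c z := by
      funext z; exact eq_add_mul_dslope F c z
    have h2 : HasDerivAt (fun z => F c + (z - c) * dslope F c z)
        (1 * dslope F c z + (z - c) * deriv (dslope F c) z) z := by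
      have := (((hasDerivAt_id z).sub_const c).mul (hG z).hasDerivAt).const_add (F c)
      simpa using this
    rw [← h1] at h2
    simp only [zero_add, iteratedDeriv_one, iteratedDeriv_zero]
    rw [h2.deriv]; push_cast; ring
  | succ k ih =>
    funext z
    rw [iteratedDeriv_succ, ih]
    have hk1 := ((differentiable_iteratedDeriv hG (k + 1)) z).hasDerivAt
    have hk := ((differentiable_iteratedDeriv hG k) z).hasDerivAt
    have h2 := (((hasDerivAt_id z).sub_const c).mul hk1).add (hk.const_mul ((k : ℂ) + 1))
    have h3 := h2.deriv
    rw [← iteratedDeriv_succ, ← iteratedDeriv_succ] at h3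
    refine Eq.trans ?_ (h3.trans ?_)
    · congr 1
    · simp only [id]; push_cast; ring

/-- Passing from `F` to its slope at a node keeps the derivatives at the other nodes small. -/
theorem norm_iteratedDeriv_dslope_le {F : ℂ → ℂ} (hF : Differentiable ℂ F) {c z : ℂ} {δ : ℝ}
    {M m : ℕ} (hcz : 1 ≤ ‖z - c‖) (hc : ‖F c‖ ≤ δ) (hm : m ≤ M)
    (hz : ∀ k < m, ‖iteratedDeriv k F z‖ ≤ δ) (k : ℕ) (hk : k < m) :
    ‖iteratedDeriv k (dslope F c) z‖ ≤ 2 * δ * ((M : ℝ) + 1) ^ k := by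
  have hδ : 0 ≤ δ := (norm_nonneg _).trans hc
  induction k with
  | zero =>
    have h := sub_smul_dslope F c z
    rw [smul_eq_mul] at h
    have h1 : ‖z - c‖ * ‖dslope F c z‖ ≤ 2 * δ := by
      rw [← norm_mul, h]
      have := hz 0 hk
      rw [iteratedDeriv_zero] at this
      linarith [norm_sub_le (F z) (F c)]
    simp only [iteratedDeriv_zero, pow_zero, mul_one]
    nlinarith [norm_nonneg (dslope F c z)]
  | succ k ih =>
    have ih := ih (by omega)
    have h := congrFun (iteratedDeriv_succ_eq_dslope hF c k) z
    have h1 : (z - c) * iteratedDeriv (k + 1) (dslope F c) z =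
        iteratedDeriv (k + 1) F z - (k + 1) * iteratedDeriv k (dslope F c) z := by
      rw [h]; ring
    have h2 : ‖z - c‖ * ‖iteratedDeriv (k + 1) (dslope F c) z‖ ≤
        δ + (k + 1) * ‖iteratedDeriv k (dslope F c) z‖ := by
      rw [← norm_mul, h1]
      refine (norm_sub_le _ _).trans (add_le_add (hz _ hk) ?_)
      rw [norm_mul]
      gcongr
      exact_mod_cast (Complex.norm_natCast (k + 1)).le
    have h3 : ((k : ℝ) + 1) ≤ M := by
      have : k + 1 ≤ M := by omega
      exact_mod_cast this
    have h4 : (1 : ℝ) ≤ ((M : ℝ) + 1) ^ k := one_le_pow₀ (by linarith [Nat.cast_nonneg (α := ℝ) M])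
    have h5 : ((k : ℝ) + 1) * ‖iteratedDeriv k (dslope F c) z‖ ≤
        M * (2 * δ * ((M : ℝ) + 1) ^ k) := by gcongr
    have h6 := mul_le_mul_of_nonneg_left h4 hδ
    rw [pow_succ]
    nlinarith [norm_nonneg (iteratedDeriv (k + 1) (dslope F c) z)]

/-- Schwarz lemma with approximate zeros: an entire function whose first derivatives are small
at the integers `0, …, X - 1` is small on a disc. -/
theorem norm_le_of_small_iteratedDeriv {X M : ℕ} {Y : ℝ} (hY : 1 ≤ Y) (hXY : (X : ℝ) ≤ Y) (D : ℕ)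
    (μ : ℕ → ℕ) (hμD : ∑ l ∈ Finset.range X, μ l = D) (hμM : ∀ l, μ l ≤ M) {F : ℂ → ℂ}
    (hF : Differentiable ℂ F) {S δ : ℝ} (hδ : 0 ≤ δ) (hS : ∀ z, ‖z‖ ≤ 7 * Y → ‖F z‖ ≤ S)
    (hsmall : ∀ l < X, ∀ k < μ l, ‖iteratedDeriv k F (l : ℂ)‖ ≤ δ) {z : ℂ} (hz : ‖z‖ ≤ Y) :
    ‖F z‖ ≤ S * (1 / 3) ^ D + δ * (2 + 4 * Y * ((M : ℝ) + 1) ^ M) ^ D := by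
  induction D generalizing μ F S δ with
  | zero =>
    have := hS z (by linarith)
    simp only [pow_zero, mul_one]
    linarith
  | succ D ih =>
    have hS0 : 0 ≤ S := (norm_nonneg _).trans (hS 0 (by simp; linarith))
    obtain ⟨l₀, hl₀, hpos⟩ : ∃ l₀ ∈ Finset.range X, 0 < μ l₀ := by
      by_contra! hcon
      have : ∑ l ∈ Finset.range X, μ l = 0 :=
        Finset.sum_eq_zero fun l hl => Nat.le_zero.1 (hcon l hl)
      omega
    have hl₀X : l₀ < X := Finset.mem_range.1 hl₀
    set c : ℂ := (l₀ : ℂ) with hc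
    have hFc : ‖F c‖ ≤ δ := by simpa using hsmall l₀ hl₀X 0 hpos
    set G := dslope F c with hG
    have hGd := differentiable_dslope hF c
    have hcY : ‖c‖ ≤ Y := by
      rw [hc, Complex.norm_natCast]
      have : (l₀ : ℝ) ≤ X := by exact_mod_cast hl₀X.le
      linarith
    set μ' : ℕ → ℕ := Function.update μ l₀ (μ l₀ - 1) with hμ'
    have hμ'le : ∀ l, μ' l ≤ μ l := by
      intro l
      by_cases h : l = l₀
      · subst h; simp [hμ']
      · simp [hμ', h]
    have hsum : ∑ l ∈ Finset.range X, μ' l = D := by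
      rw [hμ', Finset.sum_update_of_mem hl₀]
      rw [← Finset.add_sum_erase _ _ hl₀, Finset.erase_eq] at hμD
      omega
    set K : ℝ := 2 * ((M : ℝ) + 1) ^ M with hK
    have hM1 : (1 : ℝ) ≤ (M : ℝ) + 1 := by linarith [Nat.cast_nonneg (α := ℝ) M]
    have hK1 : (1 : ℝ) ≤ ((M : ℝ) + 1) ^ M := one_le_pow₀ hM1
    have hsmall' : ∀ l < X, ∀ k < μ' l, ‖iteratedDeriv k G (l : ℂ)‖ ≤ K * δ := by
      intro l hl k hk
      by_cases h : l = l₀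
      · have hk' : k + 1 < μ l₀ := by
          subst h; simp [hμ'] at hk; omega
        have h1 := congrFun (iteratedDeriv_succ_eq_dslope hF c k) c
        simp only [sub_self, zero_mul, zero_add] at h1
        have h2 := hsmall l₀ hl₀X (k + 1) hk'
        rw [← hc, h1, norm_mul] at h2
        have h3 : (1 : ℝ) ≤ ‖(k : ℂ) + 1‖ := by
          have h4 : ‖(k : ℂ) + 1‖ = (k : ℝ) + 1 := by
            exact_mod_cast Complex.norm_natCast (k + 1)
          rw [h4]; linarith [Nat.cast_nonneg (α := ℝ) k]
        rw [h, ← hc]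
        have h5 : ‖iteratedDeriv k G c‖ ≤ δ := by
          nlinarith [norm_nonneg (iteratedDeriv k G c)]
        nlinarith
      · have hcz : 1 ≤ ‖(l : ℂ) - c‖ := by
          have h1 : (l : ℂ) - c = (((l : ℤ) - (l₀ : ℤ) : ℤ) : ℂ) := by simp [hc]
          rw [h1, Complex.norm_intCast]
          have h2 : (1 : ℤ) ≤ |(l : ℤ) - l₀| := Int.one_le_abs (by omega)
          exact_mod_cast h2
        have hkl : k < μ l := lt_of_lt_of_le hk (hμ'le l)
        have h1 := norm_iteratedDeriv_dslope_le hF hcz hFc (hμM l) (hsmall l hl) k hkl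
        refine h1.trans ?_
        have h2 : ((M : ℝ) + 1) ^ k ≤ ((M : ℝ) + 1) ^ M :=
          pow_le_pow_right₀ hM1 (by have := hμM l; omega)
        rw [hK]
        nlinarith
    have hSG : ∀ w, ‖w‖ ≤ 7 * Y → ‖G w‖ ≤ (S + δ) / (6 * Y) := by
      intro w hw
      have hcl : w ∈ closure (Metric.ball (0 : ℂ) (7 * Y)) := by
        rw [closure_ball _ (by linarith)]; simpa using hw
      refine Complex.norm_le_of_forall_mem_frontier_norm_le Metric.isBounded_ball
        hGd.diffContOnCl ?_ hcl
      intro u hu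
      rw [frontier_ball _ (by linarith)] at hu
      have hu' : ‖u‖ = 7 * Y := by simpa using hu
      have h1 := sub_smul_dslope F c u
      rw [smul_eq_mul] at h1
      have h2 : ‖u - c‖ * ‖G u‖ ≤ S + δ := by
        rw [hG, ← norm_mul, h1]
        have := hS u hu'.le
        linarith [norm_sub_le (F u) (F c)]
      have h3 : 6 * Y ≤ ‖u - c‖ := by
        have := norm_sub_norm_le u c
        linarith
      rw [le_div_iff₀ (by linarith)]
      nlinarith [norm_nonneg (G u)]
    have hrec := ih μ' hsum (fun l => (hμ'le l).trans (hμM l)) hGd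
      (δ := K * δ) (by positivity) hSG hsmall'
    have hFz := eq_add_mul_dslope F c z
    have hzc : ‖z - c‖ ≤ 2 * Y := by linarith [norm_sub_le z c]
    set W : ℝ := 2 + 4 * Y * ((M : ℝ) + 1) ^ M with hW
    have hW1 : (1 : ℝ) ≤ W := by rw [hW]; nlinarith
    have hWD : (1 : ℝ) ≤ W ^ D := one_le_pow₀ hW1
    have h1 : ‖F z‖ ≤ δ + 2 * Y * ((S + δ) / (6 * Y) * (1 / 3) ^ D + K * δ * W ^ D) := by
      rw [hFz]
      refine (norm_add_le _ _).trans (add_le_add hFc ?_)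
      rw [norm_mul]
      gcongr
    have h2 : 2 * Y * ((S + δ) / (6 * Y) * (1 / 3) ^ D + K * δ * W ^ D) =
        S * (1 / 3) ^ (D + 1) + δ * (1 / 3) ^ (D + 1) + δ * (2 * Y * K * W ^ D) := by
      field_simp
      ring
    have h3 : ((1 : ℝ) / 3) ^ (D + 1) ≤ 1 := pow_le_one₀ (by norm_num) (by norm_num)
    have h4 : W ^ (D + 1) = 2 * W ^ D + 2 * Y * K * W ^ D := by
      rw [pow_succ, hK, hW]; ring
    rw [h4]
    nlinarith

theorem abs_exp_sub_exp_le {a b B : ℝ} (ha : a ≤ B) (hb : b ≤ B) :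
    |Real.exp a - Real.exp b| ≤ |a - b| * Real.exp B := by
  wlog hab : b ≤ a generalizing a b
  · rw [abs_sub_comm, abs_sub_comm a b]
    exact this hb ha (le_of_not_ge hab)
  have h1 := Real.add_one_le_exp (b - a)
  have h2 : Real.exp b = Real.exp a * Real.exp (b - a) := by rw [← Real.exp_add]; ring_nf
  rw [abs_of_nonneg (by linarith [Real.exp_le_exp.2 hab]), abs_of_nonneg (by linarith)]
  have h3 := Real.exp_le_exp.2 ha
  have h4 := Real.exp_pos a
  calc Real.exp a - Real.exp b = Real.exp a * (1 - Real.exp (b - a)) := by rw [h2]; ring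
    _ ≤ Real.exp a * (a - b) := mul_le_mul_of_nonneg_left (by linarith) h4.le
    _ ≤ (a - b) * Real.exp B := by
        rw [mul_comm]; exact mul_le_mul_of_nonneg_left h3 (by linarith)

theorem abs_sum_mul_le {κ : Type*} [Fintype κ] {c v : κ → ℝ} {U V : ℝ} (hU : ∑ i, |c i| ≤ U)
    (hV : 0 ≤ V) (hv : ∀ i, |v i| ≤ V) : |∑ i, c i * v i| ≤ U * V := by
  calc |∑ i, c i * v i| ≤ ∑ i, |c i * v i| := Finset.abs_sum_le_sum_abs _ _
    _ ≤ ∑ i, |c i| * V := by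
        refine Finset.sum_le_sum fun i _ => ?_
        rw [abs_mul]; gcongr; exact hv i
    _ = (∑ i, |c i|) * V := by rw [Finset.sum_mul]
    _ ≤ U * V := by gcongr

theorem iteratedDeriv_expSum {κ : Type*} [Fintype κ] (c ω : κ → ℝ) (k : ℕ) (z : ℂ) :
    iteratedDeriv k (fun z : ℂ => ∑ i, (c i : ℂ) * Complex.exp (ω i * z)) z =
      ∑ i, (c i : ℂ) * ((ω i : ℂ) ^ k * Complex.exp (ω i * z)) := by
  have h1 : (fun z : ℂ => ∑ i, (c i : ℂ) * Complex.exp (ω i * z)) =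
      ∑ i, fun z : ℂ => (c i : ℂ) * Complex.exp (ω i * z) := by
    funext z; simp
  rw [h1, iteratedDeriv_sum]
  · refine Finset.sum_congr rfl fun i _ => ?_
    rw [iteratedDeriv_const_mul_field, iteratedDeriv_cexp_const_mul]
  · intro i _
    have : Differentiable ℂ (fun z : ℂ => (c i : ℂ) * Complex.exp (ω i * z)) := by fun_prop
    exact this.contDiff.contDiffAt

/-- Extrapolation for real exponential sums whose coefficients satisfy slightly perturbed
vanishing conditions: `ω` are the frequencies in the conditions, `ω'` the true ones. -/
theorem abs_expSum_le {κ : Type*} [Fintype κ] {c ω ω' : κ → ℝ} {Ω τ U Y : ℝ} {X M : ℕ}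
    (hΩ : 1 ≤ Ω) (hY : 1 ≤ Y) (hXY : (X : ℝ) ≤ Y) (hω : ∀ i, |ω i| ≤ Ω) (hω' : ∀ i, |ω' i| ≤ Ω)
    (hτ : ∀ i, |ω i - ω' i| ≤ τ) (hτ0 : 0 ≤ τ) (hU : ∑ i, |c i| ≤ U)
    (hvan : ∀ l < X, ∀ k < M, ∑ i, c i * (ω i ^ k * Real.exp (l * ω' i)) = 0)
    {y : ℝ} (hy0 : 0 ≤ y) (hyY : y ≤ Y) :
    |∑ i, c i * Real.exp (y * ω' i)| ≤ U * Real.exp (7 * Y * Ω) * (1 / 3) ^ (X * M) +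
      U * τ * Y * Real.exp (Y * Ω) *
        (Ω ^ M * (2 + 4 * Y * ((M : ℝ) + 1) ^ M) ^ (X * M) + 1) := by
  have hU0 : 0 ≤ U := (Finset.sum_nonneg fun i _ => abs_nonneg _).trans hU
  have hclose : ∀ x : ℝ, 0 ≤ x → x ≤ Y → ∀ i,
      |Real.exp (x * ω i) - Real.exp (x * ω' i)| ≤ τ * Y * Real.exp (Y * Ω) := by
    intro x hx0 hxY i
    have h1 : ∀ w : ℝ, |w| ≤ Ω → x * w ≤ Y * Ω := fun w hw =>
      (mul_le_mul_of_nonneg_left ((le_abs_self w).trans hw) hx0).trans (by gcongr)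
    refine (abs_exp_sub_exp_le (h1 _ (hω i)) (h1 _ (hω' i))).trans ?_
    rw [← mul_sub, abs_mul, abs_of_nonneg hx0]
    have := hτ i
    have h3 : x * |ω i - ω' i| ≤ Y * τ := by gcongr
    nlinarith [Real.exp_pos (Y * Ω)]
  set F : ℂ → ℂ := fun z => ∑ i, (c i : ℂ) * Complex.exp (ω i * z) with hFdef
  have hF : Differentiable ℂ F := by rw [hFdef]; fun_prop
  have hS : ∀ z, ‖z‖ ≤ 7 * Y → ‖F z‖ ≤ U * Real.exp (7 * Y * Ω) := by
    intro z hz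
    calc ‖F z‖ ≤ ∑ i, ‖(c i : ℂ) * Complex.exp (ω i * z)‖ := norm_sum_le _ _
      _ ≤ ∑ i, |c i| * Real.exp (7 * Y * Ω) := by
          refine Finset.sum_le_sum fun i _ => ?_
          rw [norm_mul, Complex.norm_real, Real.norm_eq_abs, Complex.norm_exp]
          gcongr
          refine (Complex.re_le_norm _).trans ?_
          rw [norm_mul, Complex.norm_real, Real.norm_eq_abs, mul_comm]
          have := hω i
          gcongr
      _ = (∑ i, |c i|) * Real.exp (7 * Y * Ω) := by rw [Finset.sum_mul]
      _ ≤ _ := by gcongr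
  have hcast : ∀ (k : ℕ) (x : ℝ), iteratedDeriv k F (x : ℂ) =
      ((∑ i, c i * (ω i ^ k * Real.exp (ω i * x)) : ℝ) : ℂ) := by
    intro k x
    rw [hFdef, iteratedDeriv_expSum]
    push_cast
    rfl
  have hδ : 0 ≤ U * (Ω ^ M * (τ * Y * Real.exp (Y * Ω))) := by positivity
  have hsmall : ∀ l < X, ∀ k < M, ‖iteratedDeriv k F ((l : ℕ) : ℂ)‖ ≤
      U * (Ω ^ M * (τ * Y * Real.exp (Y * Ω))) := by
    intro l hl k hk
    have h0 := hcast k (l : ℝ)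
    rw [Complex.ofReal_natCast] at h0
    rw [h0, Complex.norm_real, Real.norm_eq_abs]
    have h1 : ∑ i, c i * (ω i ^ k * Real.exp (ω i * l)) =
        ∑ i, c i * (ω i ^ k * (Real.exp (l * ω i) - Real.exp (l * ω' i))) := by
      have h2 : ∑ i, c i * (ω i ^ k * Real.exp (ω i * l)) =
        ∑ i, c i * (ω i ^ k * Real.exp (ω i * l)) -
          ∑ i, c i * (ω i ^ k * Real.exp (l * ω' i)) := by rw [hvan l hl k hk, sub_zero]
      rw [h2, ← Finset.sum_sub_distrib]
      refine Finset.sum_congr rfl fun i _ => ?_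
      rw [mul_comm (ω i) (l : ℝ)]; ring
    rw [h1]
    refine abs_sum_mul_le hU (by positivity) fun i => ?_
    rw [abs_mul, abs_pow]
    have h3 : |ω i| ^ k ≤ Ω ^ M :=
      (pow_le_pow_left₀ (abs_nonneg _) (hω i) k).trans (pow_le_pow_right₀ hΩ hk.le)
    have hlY : (l : ℝ) ≤ Y := by
      have : (l : ℝ) ≤ X := by exact_mod_cast hl.le
      linarith
    have h4 := hclose l (Nat.cast_nonneg l) hlY i
    gcongr
  have hmain := norm_le_of_small_iteratedDeriv hY hXY (X * M) (fun _ => M) (by simp)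
    (fun _ => le_rfl) hF hδ hS hsmall (z := (y : ℂ))
    (by rw [Complex.norm_real, Real.norm_eq_abs, abs_of_nonneg hy0]; exact hyY)
  have h0 := hcast 0 y
  rw [iteratedDeriv_zero] at h0
  rw [h0, Complex.norm_real, Real.norm_eq_abs] at hmain
  have h5 : |∑ i, c i * (Real.exp (y * ω i) - Real.exp (y * ω' i))| ≤
      U * (τ * Y * Real.exp (Y * Ω)) :=
    abs_sum_mul_le hU (by positivity) fun i => hclose y hy0 hyY i
  have h6 : ∑ i, c i * Real.exp (y * ω' i) = ∑ i, c i * (ω i ^ 0 * Real.exp (ω i * y)) -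
      ∑ i, c i * (Real.exp (y * ω i) - Real.exp (y * ω' i)) := by
    rw [← Finset.sum_sub_distrib]
    refine Finset.sum_congr rfl fun i _ => ?_
    rw [mul_comm (ω i) y]; ring
  rw [h6]
  refine (abs_sub _ _).trans ?_
  calc _ ≤ _ := add_le_add hmain h5
    _ = _ := by ring

/-! ### Rings with three real embeddings: pigeonhole and Vandermonde -/

/-- The product of the three values of an element not killed by `φ 0` is at least `1`. -/
def LiouvilleTriple {O : Type*} [CommRing O] (φ : Fin 3 → O →+* ℝ) : Prop :=
  ∀ x, φ 0 x ≠ 0 → 1 ≤ |φ 0 x| * |φ 1 x| * |φ 2 x|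

theorem abs_map_sum_intCast_mul_le {O κ : Type*} [CommRing O] [Fintype κ] (ψ : O →+* ℝ)
    {p : κ → ℤ} {c : κ → O} {P Q : ℝ} (hp : ∀ k, |(p k : ℝ)| ≤ P) (hc : ∀ k, |ψ (c k)| ≤ Q) :
    |ψ (∑ k, (p k : O) * c k)| ≤ Fintype.card κ * (P * Q) := by
  rw [map_sum]
  calc _ ≤ ∑ k, |ψ ((p k : O) * c k)| := Finset.abs_sum_le_sum_abs _ _
    _ ≤ ∑ _k : κ, P * Q := by
        refine Finset.sum_le_sum fun k _ => ?_
        rw [map_mul, map_intCast, abs_mul]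
        exact mul_le_mul (hp k) (hc k) (abs_nonneg _) ((abs_nonneg _).trans (hp k))
    _ = _ := by rw [Finset.sum_const, Finset.card_univ, nsmul_eq_mul]

/-- Siegel's lemma through the three real embeddings. -/
theorem LiouvilleTriple.exists_int_solution {O : Type*} [CommRing O] {φ : Fin 3 → O →+* ℝ}
    (hφ : LiouvilleTriple φ) {ι κ : Type*} [Fintype ι] [Fintype κ] (c : ι → κ → O) {Q : ℝ}
    (hc : ∀ e k i, |φ i (c e k)| ≤ Q) {P : ℕ} (hP : 1 ≤ P)
    (hQP : 4 * (Fintype.card κ : ℝ) * Q ≤ P) (hcard : 6 * Fintype.card ι < Fintype.card κ) :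
    ∃ p : κ → ℤ, p ≠ 0 ∧ (∀ k, |p k| ≤ P) ∧ ∀ e, φ 0 (∑ k, (p k : O) * c e k) = 0 := by
  classical
  let v : (κ → Fin (P + 1)) → ι × Fin 3 → ℝ := fun q x =>
    φ x.2 (∑ k, (((q k : ℕ) : ℤ) : O) * c x.1 k) + (P : ℝ) ^ 2 / 2
  have hP0 : (1 : ℝ) ≤ P := by exact_mod_cast hP
  have hv : ∀ (q : κ → Fin (P + 1)) (x : ι × Fin 3),
      |φ x.2 (∑ k, (((q k : ℕ) : ℤ) : O) * c x.1 k)| ≤ (P : ℝ) ^ 2 / 4 := by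
    intro q x
    have h1 := abs_map_sum_intCast_mul_le (φ x.2) (p := fun k => ((q k : ℕ) : ℤ)) (c := c x.1)
      (P := P) (Q := Q) (fun k => by
        have h2 : (q k : ℕ) ≤ P := Nat.lt_succ_iff.1 (q k).2
        have h3 : ((q k : ℕ) : ℝ) ≤ P := by exact_mod_cast h2
        simpa using h3) (fun k => hc x.1 k x.2)
    nlinarith
  have hv0 : ∀ q x, 0 ≤ v q x := fun q x => by
    have := abs_le.1 (hv q x)
    simp only [v]; nlinarith
  have hv1 : ∀ q x, ⌊v q x⌋₊ < (P + 1) ^ 2 := fun q x => by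
    rw [Nat.floor_lt (hv0 q x)]
    have := abs_le.1 (hv q x)
    rw [Nat.cast_pow, Nat.cast_succ]
    simp only [v]; nlinarith
  let f : (κ → Fin (P + 1)) → (ι × Fin 3 → Fin ((P + 1) ^ 2)) := fun q x => ⟨⌊v q x⌋₊, hv1 q x⟩
  have hlt : Fintype.card (ι × Fin 3 → Fin ((P + 1) ^ 2)) < Fintype.card (κ → Fin (P + 1)) := by
    rw [Fintype.card_fun, Fintype.card_fun, Fintype.card_prod, Fintype.card_fin, Fintype.card_fin,
      Fintype.card_fin, ← pow_mul]
    exact Nat.pow_lt_pow_right (by omega) (by omega)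
  obtain ⟨q, q', hne, hqq⟩ := Fintype.exists_ne_map_eq_of_card_lt f hlt
  refine ⟨fun k => ((q k : ℕ) : ℤ) - ((q' k : ℕ) : ℤ), ?_, ?_, ?_⟩
  · intro h0
    apply hne
    funext k
    have := congrFun h0 k
    simp only [Pi.zero_apply] at this
    exact Fin.ext (by omega)
  · intro k
    have h1 := (q k).2
    have h2 := (q' k).2
    simp only [abs_le]
    constructor <;> omega
  · intro e
    have hsmall : ∀ i, |φ i (∑ k, (((((q k : ℕ) : ℤ) - ((q' k : ℕ) : ℤ) : ℤ)) : O) * c e k)|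
        < 1 := by
      intro i
      have h1 := congrFun hqq (e, i)
      have h2 : ⌊v q (e, i)⌋₊ = ⌊v q' (e, i)⌋₊ := congrArg Fin.val h1
      have h3 : φ i (∑ k, (((((q k : ℕ) : ℤ) - ((q' k : ℕ) : ℤ) : ℤ)) : O) * c e k) =
          v q (e, i) - v q' (e, i) := by
        simp only [v, add_sub_add_right_eq_sub]
        rw [← map_sub, ← Finset.sum_sub_distrib]
        refine congrArg _ (Finset.sum_congr rfl fun k _ => ?_)
        push_cast; ring
      rw [h3, abs_lt]
      have ha := Nat.floor_le (hv0 q (e, i))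
      have hb := Nat.floor_le (hv0 q' (e, i))
      have hc := Nat.lt_floor_add_one (v q (e, i))
      have hd := Nat.lt_floor_add_one (v q' (e, i))
      rw [h2] at ha hc
      constructor <;> linarith
    by_contra hne0
    have h1 := hφ _ hne0
    have h2 : |φ 0 (∑ k, (((((q k : ℕ) : ℤ) - ((q' k : ℕ) : ℤ) : ℤ)) : O) * c e k)| *
        |φ 1 (∑ k, (((((q k : ℕ) : ℤ) - ((q' k : ℕ) : ℤ) : ℤ)) : O) * c e k)| < 1 :=
      mul_lt_one_of_nonneg_of_lt_one_left (abs_nonneg _) (hsmall 0) (hsmall 1).le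
    have h3 := mul_lt_one_of_nonneg_of_lt_one_left (by positivity) h2 (hsmall 2).le
    linarith

theorem eq_zero_of_forall_sum_mul_pow_eq_zero {κ : Type*} [Fintype κ] {x p : κ → ℝ}
    (hx : Function.Injective x) (h : ∀ l < Fintype.card κ, ∑ k, p k * x k ^ l = 0) : p = 0 := by
  set e := (Fintype.equivFin κ).symm
  have h1 : (fun i => p (e i)) = 0 := by
    refine Matrix.eq_zero_of_forall_pow_sum_mul_pow_eq_zero (f := fun i => x (e i))
      (hx.comp e.injective) fun i => ?_
    rw [← h i i.2]
    exact Equiv.sum_comp e fun k => p k * x k ^ (i : ℕ)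
  funext k
  have := congrFun h1 (e.symm k)
  simpa using this

/-! ### A lower bound for linear forms in three logarithms -/

section LinearForms

variable {O : Type*} [CommRing O] {L : ℕ}

/-- The homogenised monomial `∏ ν_j ^ (k_j l) δ_j ^ ((L - k_j) l)`. -/
def homMonomial (ν δ : Fin 3 → O) (l : ℕ) (k : Fin 3 → Fin L) : O :=
  ∏ j, ν j ^ ((k j : ℕ) * l) * δ j ^ ((L - k j) * l)

/-- The integer `b₂ k_r - k₂ b_r`. -/
def eliminated (b : Fin 3 → ℤ) (k : Fin 3 → Fin L) (r : Fin 3) : ℤ :=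
  b 2 * ((k r : ℕ) : ℤ) - ((k 2 : ℕ) : ℤ) * b r

/-- The auxiliary sums of Baker's method. -/
def auxSum (ν δ : Fin 3 → O) (b : Fin 3 → ℤ) (p : (Fin 3 → Fin L) → ℤ) (m m' l : ℕ) : O :=
  ∑ k, ((p k * (eliminated b k 0 ^ m * eliminated b k 1 ^ m') : ℤ) : O) * homMonomial ν δ l k

/-- The logarithm of the quotient `ψ ν_j / ψ δ_j`. -/
def logQuot (ψ : O →+* ℝ) (ν δ : Fin 3 → O) (j : Fin 3) : ℝ :=
  Real.log (ψ (ν j)) - Real.log (ψ (δ j))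

theorem abs_map_homMonomial_le (ψ : O →+* ℝ) {ν δ : Fin 3 → O} {h : ℝ}
    (hν : ∀ j, |ψ (ν j)| ≤ Real.exp h) (hδ : ∀ j, |ψ (δ j)| ≤ Real.exp h) (l : ℕ)
    (k : Fin 3 → Fin L) : |ψ (homMonomial ν δ l k)| ≤ Real.exp (3 * L * l * h) := by
  have h1 : ∀ j, |ψ (ν j ^ ((k j : ℕ) * l) * δ j ^ ((L - k j) * l))| ≤ Real.exp (L * l * h) := by
    intro j
    rw [map_mul, map_pow, map_pow, abs_mul, abs_pow, abs_pow]
    calc _ ≤ Real.exp h ^ ((k j : ℕ) * l) * Real.exp h ^ ((L - k j) * l) := by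
          gcongr
          · exact hν j
          · exact hδ j
      _ = Real.exp (L * l * h) := by
          rw [← pow_add, ← Real.exp_nat_mul, ← add_mul, Nat.add_sub_cancel' (k j).2.le]
          push_cast; ring_nf
  rw [homMonomial, map_prod, Finset.abs_prod]
  calc _ ≤ ∏ _j : Fin 3, Real.exp (L * l * h) :=
        Finset.prod_le_prod (fun _ _ => abs_nonneg _) fun j _ => h1 j
    _ = _ := by
        rw [Finset.prod_const, Finset.card_univ, Fintype.card_fin, ← Real.exp_nat_mul]
        push_cast; ring_nf

theorem map_homMonomial_eq (ψ : O →+* ℝ) {ν δ : Fin 3 → O} (hν : ∀ j, 0 < ψ (ν j))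
    (hδ : ∀ j, 0 < ψ (δ j)) (l : ℕ) (k : Fin 3 → Fin L) :
    ψ (homMonomial ν δ l k) = (∏ j, ψ (δ j)) ^ (L * l) *
      Real.exp (l * ∑ j, (k j : ℝ) * logQuot ψ ν δ j) := by
  rw [homMonomial, map_prod, ← Finset.prod_pow, Finset.mul_sum, Real.exp_sum,
    ← Finset.prod_mul_distrib]
  refine Finset.prod_congr rfl fun j _ => ?_
  have h1 : Real.exp (l * ((k j : ℝ) * logQuot ψ ν δ j)) =
      (ψ (ν j) / ψ (δ j)) ^ ((k j : ℕ) * l) := by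
    rw [← Real.exp_log (div_pos (hν j) (hδ j)), ← Real.exp_nat_mul,
      Real.log_div (hν j).ne' (hδ j).ne', logQuot]
    push_cast; ring_nf
  have h2 : L * l = (k j : ℕ) * l + (L - k j) * l := by
    rw [← add_mul, Nat.add_sub_cancel' (k j).2.le]
  rw [h1, map_mul, map_pow, map_pow, h2, pow_add, div_pow]
  have := (pow_pos (hδ j) ((k j : ℕ) * l)).ne'
  field_simp

theorem abs_log_le_of_liouville {φ : Fin 3 → O →+* ℝ} (hφ : LiouvilleTriple φ) {x : O} {h : ℝ}
    (hx0 : 0 < φ 0 x) (hx : ∀ i, |φ i x| ≤ Real.exp h) :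
    -(2 * h) ≤ Real.log (φ 0 x) ∧ Real.log (φ 0 x) ≤ h := by
  have h1 := hφ x hx0.ne'
  have h2 : |φ 0 x| * |φ 1 x| * |φ 2 x| ≤ φ 0 x * Real.exp h * Real.exp h := by
    rw [abs_of_pos hx0]
    gcongr
    · exact hx 1
    · exact hx 2
  constructor
  · rw [Real.le_log_iff_exp_le hx0]
    have h3 : Real.exp (-(2 * h)) * (Real.exp h * Real.exp h) = 1 := by
      rw [← Real.exp_add, ← Real.exp_add, ← Real.exp_zero]; ring_nf
    have h4 : 0 < Real.exp h * Real.exp h := by positivity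
    by_contra! hcon
    nlinarith
  · rw [Real.log_le_iff_le_exp hx0]
    exact (le_abs_self _).trans (hx 0)

theorem abs_logQuot_le {φ : Fin 3 → O →+* ℝ} (hφ : LiouvilleTriple φ) {ν δ : Fin 3 → O} {h : ℝ}
    (hν0 : ∀ j, 0 < φ 0 (ν j)) (hδ0 : ∀ j, 0 < φ 0 (δ j))
    (hν : ∀ i j, |φ i (ν j)| ≤ Real.exp h) (hδ : ∀ i j, |φ i (δ j)| ≤ Real.exp h) (j : Fin 3) :
    |logQuot (φ 0) ν δ j| ≤ 3 * h := by
  have h1 := abs_log_le_of_liouville hφ (hν0 j) fun i => hν i j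
  have h2 := abs_log_le_of_liouville hφ (hδ0 j) fun i => hδ i j
  rw [logQuot, abs_le]
  constructor <;> linarith

/-- The frequencies with the last logarithm eliminated by means of the linear form. -/
def freq (b : Fin 3 → ℤ) (lg : Fin 3 → ℝ) (k : Fin 3 → Fin L) : ℝ :=
  ((eliminated b k 0 : ℝ) * lg 0 + (eliminated b k 1 : ℝ) * lg 1) / (b 2 : ℝ)

theorem freq_sub {b : Fin 3 → ℤ} (hb : b 2 ≠ 0) (lg : Fin 3 → ℝ) (k : Fin 3 → Fin L) :
    freq b lg k - ∑ j, (k j : ℝ) * lg j = -((k 2 : ℝ) * (∑ j, (b j : ℝ) * lg j) / b 2) := by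
  have : (b 2 : ℝ) ≠ 0 := by exact_mod_cast hb
  rw [freq, Fin.sum_univ_three, Fin.sum_univ_three]
  simp only [eliminated]
  push_cast
  field_simp
  ring

theorem sum_mul_freq_pow_eq_zero {b : Fin 3 → ℤ} {lg : Fin 3 → ℝ} {E : (Fin 3 → Fin L) → ℝ}
    {p : (Fin 3 → Fin L) → ℤ} {m m' n : ℕ}
    (hvan : ∀ a a', a ≤ n → a' ≤ n → ∑ k, ((p k * (eliminated b k 0 ^ (m + a) *
      eliminated b k 1 ^ (m' + a')) : ℤ) : ℝ) * E k = 0) :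
    ∑ k, ((p k * (eliminated b k 0 ^ m * eliminated b k 1 ^ m') : ℤ) : ℝ) *
      (freq b lg k ^ n * E k) = 0 := by
  have h1 : ∀ k, ((p k * (eliminated b k 0 ^ m * eliminated b k 1 ^ m') : ℤ) : ℝ) *
      (freq b lg k ^ n * E k) = ∑ a ∈ Finset.range (n + 1),
        (lg 0 ^ a * lg 1 ^ (n - a) * (n.choose a) / (b 2 : ℝ) ^ n) *
        (((p k * (eliminated b k 0 ^ (m + a) * eliminated b k 1 ^ (m' + (n - a))) : ℤ) : ℝ) *
          E k) := by
    intro k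
    rw [freq, div_pow, add_pow, Finset.sum_div, Finset.sum_mul, Finset.mul_sum]
    refine Finset.sum_congr rfl fun a _ => ?_
    push_cast
    ring
  simp_rw [h1]
  rw [Finset.sum_comm]
  refine Finset.sum_eq_zero fun a ha => ?_
  rw [← Finset.mul_sum, hvan a (n - a) (by have := Finset.mem_range.1 ha; omega) (by omega),
    mul_zero]

theorem map_auxSum_eq (ψ : O →+* ℝ) {ν δ : Fin 3 → O} (hν : ∀ j, 0 < ψ (ν j))
    (hδ : ∀ j, 0 < ψ (δ j)) (b : Fin 3 → ℤ) (p : (Fin 3 → Fin L) → ℤ) (m m' l : ℕ) :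
    ψ (auxSum ν δ b p m m' l) = (∏ j, ψ (δ j)) ^ (L * l) *
      ∑ k, ((p k * (eliminated b k 0 ^ m * eliminated b k 1 ^ m') : ℤ) : ℝ) *
        Real.exp (l * ∑ j, (k j : ℝ) * logQuot ψ ν δ j) := by
  rw [auxSum, map_sum, Finset.mul_sum]
  refine Finset.sum_congr rfl fun k _ => ?_
  rw [map_mul, map_intCast, map_homMonomial_eq ψ hν hδ]
  ring

theorem abs_map_auxSum_le (ψ : O →+* ℝ) {ν δ : Fin 3 → O} {h U : ℝ}
    (hν : ∀ j, |ψ (ν j)| ≤ Real.exp h) (hδ : ∀ j, |ψ (δ j)| ≤ Real.exp h) {b : Fin 3 → ℤ}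
    {p : (Fin 3 → Fin L) → ℤ} {m m' : ℕ}
    (hU : ∑ k, |((p k * (eliminated b k 0 ^ m * eliminated b k 1 ^ m') : ℤ) : ℝ)| ≤ U) (l : ℕ) :
    |ψ (auxSum ν δ b p m m' l)| ≤ U * Real.exp (3 * L * l * h) := by
  rw [auxSum, map_sum]
  simp_rw [map_mul, map_intCast]
  exact abs_sum_mul_le hU (Real.exp_pos _).le fun k => abs_map_homMonomial_le ψ hν hδ l k

/-- One extrapolation step of Baker's method. -/
theorem auxSum_eq_zero_step {φ : Fin 3 → O →+* ℝ} (hφ : LiouvilleTriple φ) {ν δ : Fin 3 → O}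
    {h U : ℝ} (hL : 1 ≤ L) (hh : 1 ≤ h) (hν0 : ∀ j, 0 < φ 0 (ν j)) (hδ0 : ∀ j, 0 < φ 0 (δ j))
    (hν : ∀ i j, |φ i (ν j)| ≤ Real.exp h) (hδ : ∀ i j, |φ i (δ j)| ≤ Real.exp h)
    {b : Fin 3 → ℤ} (hb : b 2 ≠ 0) {p : (Fin 3 → Fin L) → ℤ} {X X' M M' : ℕ} (hX' : 1 ≤ X')
    (hXX' : X ≤ X') {Λ : ℝ} (hΛ : |∑ j, (b j : ℝ) * logQuot (φ 0) ν δ j| ≤ Λ) (hΛ1 : Λ ≤ 1)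
    (hU : ∀ m < M, ∀ m' < M,
      ∑ k, |((p k * (eliminated b k 0 ^ m * eliminated b k 1 ^ m') : ℤ) : ℝ)| ≤ U)
    (hnum : U ^ 3 * Real.exp (9 * L * X' * h) *
      (Real.exp (7 * X' * (10 * L * h)) * (1 / 3) ^ (X * M') +
        L * Λ * X' * Real.exp (X' * (10 * L * h)) *
        ((10 * L * h) ^ M' * (2 + 4 * X' * ((M' : ℝ) + 1) ^ M') ^ (X * M') + 1)) < 1)
    (hvan : ∀ m < M + M', ∀ m' < M + M', ∀ l < X, φ 0 (auxSum ν δ b p m m' l) = 0) :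
    ∀ m < M, ∀ m' < M, ∀ l < X', φ 0 (auxSum ν δ b p m m' l) = 0 := by
  intro m hm m' hm' l hl
  by_contra hne
  have hL1 : (1 : ℝ) ≤ L := by exact_mod_cast hL
  have hX1 : (1 : ℝ) ≤ X' := by exact_mod_cast hX'
  have hΛ0 : 0 ≤ Λ := (abs_nonneg _).trans hΛ
  have hlX : (l : ℝ) ≤ X' := by exact_mod_cast hl.le
  have hU1 := hU m hm m' hm'
  have hU0 : 0 ≤ U := (Finset.sum_nonneg fun i _ => abs_nonneg _).trans hU1
  set lg := logQuot (φ 0) ν δ with hlg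
  have hlgb : ∀ j, |lg j| ≤ 3 * h := abs_logQuot_le hφ hν0 hδ0 hν hδ
  have hkL : ∀ (k : Fin 3 → Fin L) j, (k j : ℝ) ≤ L := fun k j => by exact_mod_cast (k j).2.le
  have hω' : ∀ k : Fin 3 → Fin L, |∑ j, (k j : ℝ) * lg j| ≤ 9 * L * h := by
    intro k
    calc _ ≤ ∑ j, |(k j : ℝ) * lg j| := Finset.abs_sum_le_sum_abs _ _
      _ ≤ ∑ _j : Fin 3, (L : ℝ) * (3 * h) := by
          refine Finset.sum_le_sum fun j _ => ?_
          rw [abs_mul, Nat.abs_cast]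
          exact mul_le_mul (hkL k j) (hlgb j) (abs_nonneg _) (by positivity)
      _ = 9 * L * h := by
          rw [Finset.sum_const, Finset.card_univ, Fintype.card_fin, nsmul_eq_mul]
          push_cast; ring
  have hτ : ∀ k : Fin 3 → Fin L, |freq b lg k - ∑ j, (k j : ℝ) * lg j| ≤ L * Λ := by
    intro k
    rw [freq_sub hb, abs_neg, abs_div, abs_mul, Nat.abs_cast]
    have hb1 : (1 : ℝ) ≤ |(b 2 : ℝ)| := by exact_mod_cast Int.one_le_abs hb
    rw [div_le_iff₀ (by linarith)]
    calc _ ≤ (L : ℝ) * Λ := by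
          have := hkL k 2
          gcongr
      _ ≤ L * Λ * |(b 2 : ℝ)| := le_mul_of_one_le_right (by positivity) hb1
  have hΩ : 9 * L * h + L * Λ ≤ 10 * L * h := by nlinarith
  have hω : ∀ k : Fin 3 → Fin L, |freq b lg k| ≤ 10 * L * h := by
    intro k
    have h1 := abs_sub_abs_le_abs_sub (freq b lg k) (∑ j, (k j : ℝ) * lg j)
    linarith [hω' k, hτ k]
  have hdpos : 0 < ∏ j, φ 0 (δ j) := Finset.prod_pos fun j _ => hδ0 j
  have hsum : ∀ n n' x, n < M + M' → n' < M + M' → x < X →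
      ∑ k, ((p k * (eliminated b k 0 ^ n * eliminated b k 1 ^ n') : ℤ) : ℝ) *
        Real.exp (x * ∑ j, (k j : ℝ) * lg j) = 0 := by
    intro n n' x hn hn' hx
    have h1 := hvan n hn n' hn' x hx
    rw [map_auxSum_eq (φ 0) hν0 hδ0] at h1
    exact (mul_eq_zero.1 h1).resolve_left (pow_pos hdpos _).ne'
  have hmain := abs_expSum_le (Ω := 10 * L * h) (τ := L * Λ) (Y := X') (X := X) (M := M')
    (c := fun k => ((p k * (eliminated b k 0 ^ m * eliminated b k 1 ^ m') : ℤ) : ℝ))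
    (ω := freq b lg) (ω' := fun k => ∑ j, (k j : ℝ) * lg j)
    (by nlinarith) hX1 (by exact_mod_cast hXX') hω
    (fun k => (hω' k).trans (by nlinarith)) hτ (by positivity) hU1
    (fun x hx n hn => sum_mul_freq_pow_eq_zero fun a a' ha ha' =>
      hsum _ _ x (by omega) (by omega) hx) (Nat.cast_nonneg l) hlX
  set V : ℝ := Real.exp (7 * X' * (10 * L * h)) * (1 / 3) ^ (X * M') +
        L * Λ * X' * Real.exp (X' * (10 * L * h)) *
        ((10 * L * h) ^ M' * (2 + 4 * X' * ((M' : ℝ) + 1) ^ M') ^ (X * M') + 1) with hV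
  have hV0 : 0 ≤ V := by rw [hV]; positivity
  have hlow := hφ _ hne
  have he : Real.exp (3 * L * l * h) ≤ Real.exp (3 * L * X' * h) := by
    apply Real.exp_le_exp.2
    gcongr
  have h1 := abs_map_auxSum_le (φ 1) (hν 1) (hδ 1) hU1 l
  have h2 := abs_map_auxSum_le (φ 2) (hν 2) (hδ 2) hU1 l
  have hd : (∏ j, φ 0 (δ j)) ^ (L * l) ≤ Real.exp (3 * L * X' * h) := by
    have h3 : ∏ j, φ 0 (δ j) ≤ Real.exp (3 * h) := by
      calc _ ≤ ∏ _j : Fin 3, Real.exp h :=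
            Finset.prod_le_prod (fun j _ => (hδ0 j).le)
              fun j _ => (le_abs_self _).trans (hδ 0 j)
        _ = _ := by
            rw [Finset.prod_const, Finset.card_univ, Fintype.card_fin, ← Real.exp_nat_mul]
            norm_num
    refine (pow_le_pow_left₀ hdpos.le h3 _).trans ?_
    rw [← Real.exp_nat_mul]
    refine le_trans (le_of_eq ?_) he
    push_cast; ring_nf
  have h0 : |φ 0 (auxSum ν δ b p m m' l)| ≤ Real.exp (3 * L * X' * h) * (U * V) := by
    rw [map_auxSum_eq (φ 0) hν0 hδ0, abs_mul, abs_of_pos (pow_pos hdpos _)]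
    refine mul_le_mul hd (hmain.trans (le_of_eq ?_)) (abs_nonneg _) (Real.exp_pos _).le
    rw [hV]; ring
  have h4 : |φ 0 (auxSum ν δ b p m m' l)| * |φ 1 (auxSum ν δ b p m m' l)| *
      |φ 2 (auxSum ν δ b p m m' l)| ≤ Real.exp (3 * L * X' * h) * (U * V) *
        (U * Real.exp (3 * L * X' * h)) * (U * Real.exp (3 * L * X' * h)) := by
    gcongr
    · exact h1.trans (by gcongr)
    · exact h2.trans (by gcongr)
  have h5 : Real.exp (9 * L * X' * h) = Real.exp (3 * L * X' * h) * Real.exp (3 * L * X' * h) *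
      Real.exp (3 * L * X' * h) := by
    rw [← Real.exp_add, ← Real.exp_add]; ring_nf
  rw [h5] at hnum
  nlinarith

end LinearForms

theorem pow_le_exp_of_le {T : ℝ} (hT : 3000 ≤ T) {n : ℕ} (hn : n ≤ 60) : T ^ n ≤ Real.exp T := by
  have h1 : T ≤ Real.exp (T / 60) := by
    have h2 := Real.pow_div_factorial_le_exp (T / 60) (by linarith) 3
    have h3 : T ≤ (T / 60) ^ 3 / (Nat.factorial 3 : ℝ) := by
      norm_num [Nat.factorial]
      nlinarith [mul_nonneg (by linarith : (0:ℝ) ≤ T) (by nlinarith : (0:ℝ) ≤ T ^ 2 - 9000000)]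
    exact h3.trans h2
  calc T ^ n ≤ T ^ 60 := pow_le_pow_right₀ (by linarith) hn
    _ ≤ Real.exp (T / 60) ^ 60 := pow_le_pow_left₀ (by linarith) h1 _
    _ = Real.exp T := by rw [← Real.exp_nat_mul]; push_cast; ring_nf

/-- The numerical inequality behind every extrapolation step. -/
theorem extrapolation_numeric {T h Λ : ℝ} {D : ℕ} {k : ℕ} (hT : 3000 ≤ T) (hk : k ≤ 20)
    (hh : 1 ≤ h) (hhT : 1000 * h ≤ T) {N : ℕ} (hN : (N : ℝ) = T ^ 10)
    (hD : (D : ℝ) = T ^ (3 + k) * T ^ 10) (hΛ0 : 0 ≤ Λ) (hΛ : Λ ≤ Real.exp (-T ^ 50)) :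
    Real.exp (T ^ 12) ^ 3 * Real.exp (9 * T ^ 8 * T ^ (4 + k) * h) *
      (Real.exp (7 * T ^ (4 + k) * (10 * T ^ 8 * h)) * (1 / 3) ^ D +
        T ^ 8 * Λ * T ^ (4 + k) * Real.exp (T ^ (4 + k) * (10 * T ^ 8 * h)) *
        ((10 * T ^ 8 * h) ^ N * (2 + 4 * T ^ (4 + k) * (T ^ 10 + 1) ^ N) ^ D + 1)) < 1 := by
  have hT0 : (0 : ℝ) < T := by linarith
  have hT1 : (1 : ℝ) ≤ T := by linarith
  set d : ℝ := T ^ (13 + k) with hd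
  have hDd : (D : ℝ) = d := by rw [hD, hd]; ring
  have hd0 : 0 < d := by positivity
  have hd12 : T ^ 12 ≤ d / 3000 := by
    have h1 : T ^ 13 ≤ d := pow_le_pow_right₀ hT1 (by omega)
    have h2 : 0 < T ^ 12 := by positivity
    nlinarith
  have hdh : T ^ (12 + k) * h ≤ d / 1000 := by
    have h2 : 0 < T ^ (12 + k) := by positivity
    have h3 : d = T ^ (12 + k) * T := by rw [hd]; ring
    rw [h3]; nlinarith
  have hd33 : d ≤ T ^ 33 := pow_le_pow_right₀ hT1 (by omega)
  have hd13 : T ≤ d := by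
    calc T = T ^ 1 := (pow_one T).symm
      _ ≤ d := pow_le_pow_right₀ hT1 (by omega)
  have e1 : 9 * T ^ 8 * T ^ (4 + k) * h = 9 * (T ^ (12 + k) * h) := by ring
  have e2 : 7 * T ^ (4 + k) * (10 * T ^ 8 * h) = 70 * (T ^ (12 + k) * h) := by ring
  have e3 : T ^ (4 + k) * (10 * T ^ 8 * h) = 10 * (T ^ (12 + k) * h) := by ring
  rw [e1, e2, e3]
  set s := T ^ (12 + k) * h with hs
  have hA : Real.exp (T ^ 12) ^ 3 * Real.exp (9 * s) ≤ Real.exp (d / 50) := by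
    rw [← Real.exp_nat_mul, ← Real.exp_add]
    apply Real.exp_le_exp.2
    push_cast; linarith
  have hB : Real.exp (70 * s) * (1 / 3) ^ D ≤ Real.exp (-(d / 2)) := by
    have h1 : (1 / 3 : ℝ) ^ D ≤ Real.exp (-d) := by
      rw [← hDd, ← mul_neg_one, Real.exp_nat_mul]
      refine pow_le_pow_left₀ (by norm_num) ?_ _
      rw [Real.exp_neg, one_div]
      exact inv_anti₀ (Real.exp_pos _) (Real.exp_one_lt_d9.le.trans (by norm_num))
    calc _ ≤ Real.exp (d / 10) * Real.exp (-d) := by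
          refine mul_le_mul (Real.exp_le_exp.2 (by linarith)) h1 (by positivity)
            (Real.exp_pos _).le
      _ ≤ _ := by
          rw [← Real.exp_add]
          exact Real.exp_le_exp.2 (by linarith)
  have hC1 : T ^ 8 * T ^ (4 + k) ≤ Real.exp T := by
    rw [← pow_add]; exact pow_le_exp_of_le hT (by omega)
  have hT2 : T ^ 2 ≤ Real.exp T := pow_le_exp_of_le hT (by omega)
  have hC2 : (10 * T ^ 8 * h) ^ N ≤ Real.exp (T ^ 11) := by
    have h1 : 10 * T ^ 8 * h ≤ Real.exp T := by
      have h2 : T ^ 9 ≤ Real.exp T := pow_le_exp_of_le hT (by omega)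
      have h3 : 0 < T ^ 8 := by positivity
      nlinarith
    calc _ ≤ Real.exp T ^ N := pow_le_pow_left₀ (by positivity) h1 _
      _ = _ := by rw [← Real.exp_nat_mul, hN]; ring_nf
  have hC3 : (2 + 4 * T ^ (4 + k) * (T ^ 10 + 1) ^ N) ^ D ≤ Real.exp (2 * T ^ 11 * d) := by
    have h1 : (T ^ 10 + 1) ^ N ≤ Real.exp (T ^ 11) := by
      have h3 : T ^ 10 + 1 ≤ Real.exp T := by
        have h4 : T ^ 11 ≤ Real.exp T := pow_le_exp_of_le hT (by omega)
        have h5 : 1 ≤ T ^ 10 := one_le_pow₀ hT1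
        nlinarith
      calc _ ≤ Real.exp T ^ N := pow_le_pow_left₀ (by positivity) h3 _
        _ = _ := by rw [← Real.exp_nat_mul, hN]; ring_nf
    have h2 : 2 + 4 * T ^ (4 + k) * (T ^ 10 + 1) ^ N ≤ Real.exp (2 * T ^ 11) := by
      have h3 : 6 * T ^ (4 + k) ≤ Real.exp T := by
        have h4 : T ^ (5 + k) ≤ Real.exp T := pow_le_exp_of_le hT (by omega)
        have h5 : T ^ (5 + k) = T ^ (4 + k) * T := by ring
        have h6 : 0 < T ^ (4 + k) := by positivity
        nlinarith
      have h4 : 1 ≤ T ^ (4 + k) := one_le_pow₀ hT1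
      have h5 : 1 ≤ (T ^ 10 + 1) ^ N := one_le_pow₀ (le_add_of_nonneg_left (by positivity))
      calc _ ≤ 6 * T ^ (4 + k) * (T ^ 10 + 1) ^ N := by nlinarith
        _ ≤ Real.exp T * Real.exp (T ^ 11) := by gcongr
        _ ≤ _ := by
          rw [← Real.exp_add]
          apply Real.exp_le_exp.2
          have : T ^ 1 ≤ T ^ 11 := pow_le_pow_right₀ hT1 (by omega)
          linarith
    calc _ ≤ Real.exp (2 * T ^ 11) ^ D := pow_le_pow_left₀ (by positivity) h2 _
      _ = _ := by rw [← Real.exp_nat_mul, hDd]; ring_nf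
  have h11 : T ^ 11 ≤ T ^ 44 := pow_le_pow_right₀ hT1 (by omega)
  have h44 : T ^ 11 * d ≤ T ^ 44 := by
    calc _ ≤ T ^ 11 * T ^ 33 := by gcongr
      _ = _ := by ring
  have hE : (10 * T ^ 8 * h) ^ N * (2 + 4 * T ^ (4 + k) * (T ^ 10 + 1) ^ N) ^ D + 1 ≤
      Real.exp (4 * T ^ 44) := by
    have h1 : (10 * T ^ 8 * h) ^ N * (2 + 4 * T ^ (4 + k) * (T ^ 10 + 1) ^ N) ^ D ≤
        Real.exp (3 * T ^ 44) := by
      calc _ ≤ Real.exp (T ^ 11) * Real.exp (2 * T ^ 11 * d) := by gcongr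
        _ ≤ _ := by
          rw [← Real.exp_add]
          exact Real.exp_le_exp.2 (by linarith)
    have h2 : 1 ≤ T ^ 44 := one_le_pow₀ hT1
    have h3 : Real.exp (4 * T ^ 44) = Real.exp (3 * T ^ 44) * Real.exp (T ^ 44) := by
      rw [← Real.exp_add]; ring_nf
    have h4 := Real.add_one_le_exp (T ^ 44)
    have h5 : 1 ≤ Real.exp (3 * T ^ 44) := Real.one_le_exp (by positivity)
    rw [h3]; nlinarith
  have hE0 : 0 ≤ (10 * T ^ 8 * h) ^ N * (2 + 4 * T ^ (4 + k) * (T ^ 10 + 1) ^ N) ^ D + 1 := by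
    positivity
  clear hC2 hC3
  generalize (10 * T ^ 8 * h) ^ N * (2 + 4 * T ^ (4 + k) * (T ^ 10 + 1) ^ N) ^ D + 1 = E at hE hE0 ⊢
  have hF : T ^ 8 * Λ * T ^ (4 + k) * Real.exp (10 * s) * E ≤
      Real.exp (-T) * Real.exp (-T ^ 33) := by
    have h49 : T ^ 50 = T ^ 6 * T ^ 44 := by ring
    have h6 : 10 ≤ T ^ 6 := by
      have := pow_le_pow_left₀ (by norm_num) hT 6
      norm_num at this; linarith
    have h33 : T ^ 33 ≤ T ^ 44 := pow_le_pow_right₀ hT1 (by omega)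
    have h1 : T ^ 1 ≤ T ^ 44 := pow_le_pow_right₀ hT1 (by omega)
    have h44p : 0 < T ^ 44 := by positivity
    have hlin : T + -T ^ 50 + d + 4 * T ^ 44 ≤ -T + -T ^ 33 := by
      have h50 : 10 * T ^ 44 ≤ T ^ 50 := h49 ▸ mul_le_mul_of_nonneg_right h6 h44p.le
      linarith
    calc _ = (T ^ 8 * T ^ (4 + k)) * Λ * Real.exp (10 * s) * E := by ring
      _ ≤ Real.exp T * Real.exp (-T ^ 50) * Real.exp d * Real.exp (4 * T ^ 44) := by
          have : 10 * s ≤ d := by linarith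
          exact mul_le_mul (mul_le_mul (mul_le_mul hC1 hΛ hΛ0 (Real.exp_pos _).le)
            (Real.exp_le_exp.2 this) (Real.exp_pos _).le (by positivity)) hE hE0 (by positivity)
      _ = Real.exp (T + -T ^ 50 + d + 4 * T ^ 44) := by simp only [Real.exp_add]
      _ ≤ Real.exp (-T + -T ^ 33) := Real.exp_le_exp.2 hlin
      _ = _ := Real.exp_add _ _
  have hfin : Real.exp (-(d / 2)) + Real.exp (-T) * Real.exp (-T ^ 33) ≤
      Real.exp (-(d / 2)) + Real.exp (-1) * Real.exp (-d) := by
    exact add_le_add_right (mul_le_mul (Real.exp_le_exp.2 (neg_le_neg hT1))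
      (Real.exp_le_exp.2 (neg_le_neg hd33)) (Real.exp_pos _).le (Real.exp_pos _).le) _
  have hfin2 : Real.exp (-(d / 2)) + Real.exp (-1) * Real.exp (-d) ≤ 2 * Real.exp (-(d / 2)) := by
    have h1 : Real.exp (-1) * Real.exp (-d) ≤ Real.exp (-(d / 2)) := by
      rw [← Real.exp_add]
      exact Real.exp_le_exp.2 (by linarith)
    linarith
  have h2 : (2 : ℝ) < Real.exp 1 := by have := Real.exp_one_gt_d9; linarith
  calc _ ≤ Real.exp (d / 50) * (2 * Real.exp (-(d / 2))) := by
        refine mul_le_mul hA ?_ (by positivity) (Real.exp_pos _).le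
        exact (add_le_add hB hF).trans (hfin.trans hfin2)
    _ < Real.exp (d / 50) * (Real.exp 1 * Real.exp (-(d / 2))) := by gcongr
    _ ≤ 1 := by
      rw [← Real.exp_add, ← Real.exp_add, Real.exp_le_one_iff]
      linarith

section LowerBound

variable {O : Type*} [CommRing O]

theorem abs_eliminated_le {L : ℕ} {b : Fin 3 → ℤ} {B : ℝ} (hB : ∀ j, |(b j : ℝ)| ≤ B)
    (k : Fin 3 → Fin L) (r : Fin 3) : |(eliminated b k r : ℝ)| ≤ 2 * L * B := by
  have hk : ∀ j, (k j : ℝ) ≤ L := fun j => by exact_mod_cast (k j).2.le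
  have h1 : |(b 2 : ℝ) * (k r : ℝ)| ≤ B * L := by
    rw [abs_mul, Nat.abs_cast]
    exact mul_le_mul (hB 2) (hk r) (Nat.cast_nonneg _) ((abs_nonneg _).trans (hB 2))
  have h2 : |(k 2 : ℝ) * (b r : ℝ)| ≤ L * B := by
    rw [abs_mul, Nat.abs_cast]
    exact mul_le_mul (hk 2) (hB r) (abs_nonneg _) (Nat.cast_nonneg _)
  have h3 := abs_sub ((b 2 : ℝ) * (k r : ℝ)) ((k 2 : ℝ) * (b r : ℝ))
  simp only [eliminated]
  push_cast
  linarith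

theorem abs_eliminated_pow_mul_pow_le {t : ℕ} {L : ℕ} {b : Fin 3 → ℤ} {B : ℝ}
    (hB : ∀ j, |(b j : ℝ)| ≤ B) (hBt : 2 * L * B ≤ Real.exp t) (k : Fin 3 → Fin L)
    {m m' : ℕ} (hm : m ≤ 22 * t ^ 10) (hm' : m' ≤ 22 * t ^ 10) :
    |((eliminated b k 0 ^ m * eliminated b k 1 ^ m' : ℤ) : ℝ)| ≤ Real.exp (44 * (t : ℝ) ^ 11) := by
  have h1 : ∀ r, |(eliminated b k r : ℝ)| ≤ Real.exp t := fun r =>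
    (abs_eliminated_le hB k r).trans hBt
  have h2 : ∀ r (n : ℕ), n ≤ 22 * t ^ 10 →
      |(eliminated b k r : ℝ)| ^ n ≤ Real.exp (22 * (t : ℝ) ^ 11) := by
    intro r n hn
    calc _ ≤ Real.exp t ^ n := pow_le_pow_left₀ (abs_nonneg _) (h1 r) _
      _ ≤ Real.exp t ^ (22 * t ^ 10) :=
          pow_le_pow_right₀ (Real.one_le_exp (Nat.cast_nonneg _)) hn
      _ = _ := by
          rw [← Real.exp_nat_mul]; push_cast; ring_nf
  push_cast
  rw [abs_mul, abs_pow, abs_pow]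
  calc _ ≤ Real.exp (22 * (t : ℝ) ^ 11) * Real.exp (22 * (t : ℝ) ^ 11) :=
        mul_le_mul (h2 0 m hm) (h2 1 m' hm') (by positivity) (Real.exp_pos _).le
    _ = _ := by rw [← Real.exp_add]; ring_nf

/-- The auxiliary coefficients provided by Siegel's lemma. -/
theorem exists_auxiliary_coeff {φ : Fin 3 → O →+* ℝ} (hφ : LiouvilleTriple φ) {ν δ : Fin 3 → O}
    {h B : ℝ} {t : ℕ} (ht : 3000 ≤ t) (hh : 1 ≤ h) (hht : 1000 * h ≤ t)
    (hν : ∀ i j, |φ i (ν j)| ≤ Real.exp h) (hδ : ∀ i j, |φ i (δ j)| ≤ Real.exp h)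
    {b : Fin 3 → ℤ} (hB : ∀ j, |(b j : ℝ)| ≤ B) (hBt : 2 * (t ^ 8 : ℕ) * B ≤ Real.exp t) :
    ∃ p : (Fin 3 → Fin (t ^ 8)) → ℤ, p ≠ 0 ∧
      (∀ m ≤ 22 * t ^ 10, ∀ m' ≤ 22 * t ^ 10,
        ∑ k, |((p k * (eliminated b k 0 ^ m * eliminated b k 1 ^ m') : ℤ) : ℝ)|
          ≤ Real.exp ((t : ℝ) ^ 12)) ∧
      ∀ m < 22 * t ^ 10, ∀ m' < 22 * t ^ 10, ∀ l < t ^ 3, φ 0 (auxSum ν δ b p m m' l) = 0 := by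
  have hT : (3000 : ℝ) ≤ t := by exact_mod_cast ht
  have hel := fun (k : Fin 3 → Fin (t ^ 8)) (m m' : ℕ) =>
    abs_eliminated_pow_mul_pow_le hB hBt k (m := m) (m' := m')
  obtain ⟨T, hTdef⟩ : ∃ T : ℝ, T = t := ⟨_, rfl⟩
  rw [← hTdef] at hT hht ⊢
  simp only [← hTdef] at hel
  have hcard : Fintype.card (Fin 3 → Fin (t ^ 8)) = t ^ 24 := by
    rw [Fintype.card_fun, Fintype.card_fin, Fintype.card_fin]; ring
  have h12 : T ^ 11 * 3000 ≤ T ^ 12 := by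
    rw [pow_succ T 11]; gcongr
  have h11 : T ≤ T ^ 11 := le_self_pow₀ (by linarith) (by norm_num)
  have h11p : 0 < T ^ 11 := by positivity
  set Q : ℝ := Real.exp (44 * T ^ 11 + T ^ 12 / 300) with hQ
  have hhT : 3 * T ^ 11 * h ≤ T ^ 12 / 300 := by
    rw [pow_succ T 11]; nlinarith
  have hQ1 : 1 ≤ Q := Real.one_le_exp (by positivity)
  have h24 : T ^ 24 * 10 ≤ Real.exp T := by
    have := pow_le_exp_of_le hT (n := 25) (by norm_num)
    have h0 : 0 < T ^ 24 := by positivity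
    have h3 : T ^ 25 = T ^ 24 * T := pow_succ T 24
    nlinarith
  have hP0 : 0 < 4 * T ^ 24 * Q := by positivity
  obtain ⟨p, hp0, hpP, hpv⟩ := hφ.exists_int_solution
    (ι := Fin (22 * t ^ 10) × Fin (22 * t ^ 10) × Fin (t ^ 3)) (κ := Fin 3 → Fin (t ^ 8))
    (fun e k => ((eliminated b k 0 ^ (e.1 : ℕ) * eliminated b k 1 ^ (e.2.1 : ℕ) : ℤ) : O) *
      homMonomial ν δ e.2.2 k) (Q := Q) (P := ⌈4 * T ^ 24 * Q⌉₊) (by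
      rintro ⟨m, m', l⟩ k i
      rw [map_mul, map_intCast, abs_mul]
      have h1 := hel k m m' m.2.le m'.2.le
      have h2 := abs_map_homMonomial_le (φ i) (hν i) (hδ i) l k
      refine (mul_le_mul h1 h2 (abs_nonneg _) (Real.exp_pos _).le).trans ?_
      rw [← Real.exp_add, hQ]
      apply Real.exp_le_exp.2
      have h3 : ((l : ℕ) : ℝ) ≤ T ^ 3 := by rw [hTdef]; exact_mod_cast l.2.le
      have h4 : 3 * ((t ^ 8 : ℕ) : ℝ) * ((l : ℕ) : ℝ) * h ≤ 3 * T ^ 8 * T ^ 3 * h := by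
        rw [Nat.cast_pow, ← hTdef]; gcongr
      have h5 : 3 * T ^ 8 * T ^ 3 * h = 3 * T ^ 11 * h := by ring
      linarith) (Nat.one_le_iff_ne_zero.2 (Nat.ceil_pos.2 hP0).ne') (by
      rw [hcard, Nat.cast_pow, ← hTdef]; exact Nat.le_ceil _) (by
      rw [hcard]
      simp only [Fintype.card_prod, Fintype.card_fin]
      have h1 : 0 < t ^ 23 := by positivity
      calc _ = 2904 * t ^ 23 := by ring
        _ < t * t ^ 23 := by gcongr; omega
        _ = t ^ 24 := by ring)
  have hPle : ((⌈4 * T ^ 24 * Q⌉₊ : ℕ) : ℝ) ≤ Real.exp (T + 44 * T ^ 11 + T ^ 12 / 300) := by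
    have h1 := (Nat.ceil_lt_add_one hP0.le).le
    have h2 : Real.exp (T + 44 * T ^ 11 + T ^ 12 / 300) = Real.exp T * Q := by
      rw [hQ, ← Real.exp_add, add_assoc]
    rw [h2]
    have h3 : 1 ≤ T ^ 24 := one_le_pow₀ (by linarith)
    have h4 : 5 * T ^ 24 ≤ Real.exp T := by linarith
    nlinarith
  refine ⟨p, hp0, ?_, ?_⟩
  · intro m hm m' hm'
    calc _ ≤ ∑ _k : Fin 3 → Fin (t ^ 8), Real.exp (T + 44 * T ^ 11 + T ^ 12 / 300) *
          Real.exp (44 * T ^ 11) := by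
          refine Finset.sum_le_sum fun k _ => ?_
          rw [Int.cast_mul, abs_mul]
          refine mul_le_mul (le_trans ?_ hPle) (hel k m m' hm hm')
            (abs_nonneg _) (Real.exp_pos _).le
          rw [← Int.cast_abs, ← Int.cast_natCast]
          exact Int.cast_le.2 (hpP k)
      _ = T ^ 24 * (Real.exp (T + 44 * T ^ 11 + T ^ 12 / 300) * Real.exp (44 * T ^ 11)) := by
          rw [Finset.sum_const, Finset.card_univ, hcard, nsmul_eq_mul, Nat.cast_pow, hTdef]
      _ ≤ Real.exp T * (Real.exp (T + 44 * T ^ 11 + T ^ 12 / 300) * Real.exp (44 * T ^ 11)) := by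
          have : T ^ 24 ≤ Real.exp T := pow_le_exp_of_le hT (by norm_num)
          gcongr
      _ ≤ _ := by
          rw [← Real.exp_add, ← Real.exp_add]
          apply Real.exp_le_exp.2
          linarith
  · intro m hm m' hm' l hl
    have h1 := hpv (⟨m, hm⟩, ⟨m', hm'⟩, ⟨l, hl⟩)
    rw [← h1, auxSum]
    congr 1
    refine Finset.sum_congr rfl fun k _ => ?_
    rw [Int.cast_mul, mul_assoc]

/-- A lower bound for linear forms in three logarithms of totally real cubic numbers without a
multiplicative relation with small exponents. -/
theorem exp_neg_pow_lt_abs_linearForm {φ : Fin 3 → O →+* ℝ} (hφ : LiouvilleTriple φ)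
    {ν δ : Fin 3 → O} {h B : ℝ} {t : ℕ} (ht : 3000 ≤ t) (hh : 1 ≤ h) (hht : 1000 * h ≤ t)
    (hν0 : ∀ j, 0 < φ 0 (ν j)) (hδ0 : ∀ j, 0 < φ 0 (δ j))
    (hν : ∀ i j, |φ i (ν j)| ≤ Real.exp h) (hδ : ∀ i j, |φ i (δ j)| ≤ Real.exp h)
    {b : Fin 3 → ℤ} (hb : b 2 ≠ 0) (hB : ∀ j, |(b j : ℝ)| ≤ B)
    (hBt : 2 * (t ^ 8 : ℕ) * B ≤ Real.exp t)
    (hind : Function.Injective fun k : Fin 3 → Fin (t ^ 8) =>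
      ∑ j, (k j : ℝ) * logQuot (φ 0) ν δ j) :
    Real.exp (-(t : ℝ) ^ 50) < |∑ j, (b j : ℝ) * logQuot (φ 0) ν δ j| := by
  by_contra! hΛ
  have hT : (3000 : ℝ) ≤ t := by exact_mod_cast ht
  obtain ⟨p, hp0, hpU, hpv⟩ := exists_auxiliary_coeff hφ ht hh hht hν hδ hB hBt
  have hind' : ∀ k ≤ 21, ∀ m < (22 - k) * t ^ 10, ∀ m' < (22 - k) * t ^ 10, ∀ l < t ^ (3 + k),
      φ 0 (auxSum ν δ b p m m' l) = 0 := by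
    intro k
    induction k with
    | zero => exact fun _ => hpv
    | succ k ih =>
      intro hk
      have hk' : (22 - (k + 1)) * t ^ 10 + t ^ 10 = (22 - k) * t ^ 10 := by
        rw [← Nat.succ_mul]; congr 1; omega
      have hle : (22 - (k + 1)) * t ^ 10 ≤ 22 * t ^ 10 := Nat.mul_le_mul_right _ (by omega)
      have hnum := extrapolation_numeric (D := t ^ (3 + k) * t ^ 10) (N := t ^ 10) hT
        (show k ≤ 20 by omega) hh hht (by push_cast; rfl) (by push_cast; rfl)
        (Real.exp_pos _).le le_rfl
      refine auxSum_eq_zero_step hφ (X := t ^ (3 + k)) (M' := t ^ 10) (h := h)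
        (U := Real.exp ((t : ℝ) ^ 12)) (Λ := Real.exp (-(t : ℝ) ^ 50))
        (Nat.one_le_pow _ _ (by omega)) hh hν0 hδ0 hν hδ hb
        (Nat.one_le_pow _ _ (by omega)) (Nat.pow_le_pow_right (by omega) (by omega)) hΛ
        (Real.exp_le_one_iff.2 (by simp [Nat.cast_nonneg])) ?_ ?_ ?_
      · exact fun m hm m' hm' => hpU m (hm.le.trans hle) m' (hm'.le.trans hle)
      · have he : 3 + (k + 1) = 4 + k := by omega
        rw [he]
        push_cast
        exact hnum
      · rw [hk']
        exact ih (by omega)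
  apply hp0
  have hcard : Fintype.card (Fin 3 → Fin (t ^ 8)) = t ^ 24 := by
    rw [Fintype.card_fun, Fintype.card_fin, Fintype.card_fin]; ring
  have h1 : (fun k => (p k : ℝ)) = 0 := by
    refine eq_zero_of_forall_sum_mul_pow_eq_zero
      (x := fun k : Fin 3 → Fin (t ^ 8) => Real.exp (∑ j, (k j : ℝ) * logQuot (φ 0) ν δ j))
      (Real.exp_injective.comp hind) fun l hl => ?_
    have hpos : 0 < t ^ 10 := by positivity
    have h2 := hind' 21 le_rfl 0 (by omega) 0 (by omega) l (by rwa [hcard] at hl)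
    rw [map_auxSum_eq (φ 0) hν0 hδ0] at h2
    have h3 := (mul_eq_zero.1 h2).resolve_left
      (pow_pos (Finset.prod_pos fun j _ => hδ0 j) _).ne'
    rw [← h3]
    refine Finset.sum_congr rfl fun k _ => ?_
    rw [← Real.exp_nat_mul]
    simp
  funext k
  have := congrFun h1 k
  simpa using this

end LowerBound

section TwoUnits

variable {O : Type*} [CommRing O]

/-- `log (φ x)`, `log (φ z)` and `log 2` are linearly independent over the integers. -/
def IndepWithTwo (φ : O →+* ℝ) (x z : O) : Prop :=
  ∀ i j k : ℤ, (i : ℝ) * Real.log (φ x) + j * Real.log (φ z) + k * Real.log 2 = 0 →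
    i = 0 ∧ j = 0 ∧ k = 0

theorem IndepWithTwo.symm {φ : O →+* ℝ} {x z : O} (hi : IndepWithTwo φ x z) :
    IndepWithTwo φ z x := by
  intro i j k h
  obtain ⟨h1, h2, h3⟩ := hi j i k (by linarith)
  exact ⟨h2, h1, h3⟩

theorem exp_neg_pow_lt_abs_linearForm_two {φ : Fin 3 → O →+* ℝ} (hφ : LiouvilleTriple φ)
    {x z : O} {h B : ℝ} {t : ℕ} (ht : 3000 ≤ t) (hh : 1 ≤ h) (hht : 1000 * h ≤ t)
    (hx0 : 0 < φ 0 x) (hz0 : 0 < φ 0 z) (hx : ∀ i, |φ i x| ≤ Real.exp h)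
    (hz : ∀ i, |φ i z| ≤ Real.exp h) (hi : IndepWithTwo (φ 0) x z) {i j : ℤ}
    (hiB : |(i : ℝ)| ≤ B) (hjB : |(j : ℝ)| ≤ B) (hj : j ≠ 0)
    (hBt : 2 * (t ^ 8 : ℕ) * B ≤ Real.exp t) :
    Real.exp (-(t : ℝ) ^ 50) < |(i : ℝ) * Real.log (φ 0 x) + j * Real.log (φ 0 z)| := by
  have h2 : (2 : ℝ) ≤ Real.exp h := by
    have := Real.add_one_le_exp h
    linarith
  have hm : ∀ s, φ s 2 = 2 := fun s => map_ofNat (φ s) 2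
  have hq0 : logQuot (φ 0) ![2, x, z] ![1, 1, 1] 0 = Real.log 2 := by simp [logQuot, hm]
  have hq1 : logQuot (φ 0) ![2, x, z] ![1, 1, 1] 1 = Real.log (φ 0 x) := by simp [logQuot]
  have hq2 : logQuot (φ 0) ![2, x, z] ![1, 1, 1] 2 = Real.log (φ 0 z) := by simp [logQuot]
  have key := exp_neg_pow_lt_abs_linearForm hφ (ν := ![2, x, z]) (δ := ![1, 1, 1])
    (b := ![0, i, j]) (B := B) ht hh hht ?_ ?_ ?_ ?_ ?_ ?_ hBt ?_
  · rw [Fin.sum_univ_three, hq0, hq1, hq2] at key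
    simpa using key
  · intro r; fin_cases r <;> simp [hx0, hz0, hm]
  · intro r; fin_cases r <;> simp
  · intro s r; fin_cases r
    · simpa [hm] using h2
    · exact hx s
    · exact hz s
  · intro s r; fin_cases r <;> simpa using (by linarith : (0 : ℝ) ≤ h)
  · simpa using hj
  · intro r; fin_cases r
    · simpa using (abs_nonneg _).trans hiB
    · exact hiB
    · exact hjB
  · intro k k' hkk
    simp only [Fin.sum_univ_three, hq0, hq1, hq2] at hkk
    obtain ⟨h3, h4, h5⟩ := hi ((k 1 : ℕ) - (k' 1 : ℕ) : ℤ) ((k 2 : ℕ) - (k' 2 : ℕ) : ℤ)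
      ((k 0 : ℕ) - (k' 0 : ℕ) : ℤ) (by push_cast; linarith)
    funext r
    fin_cases r <;> apply Fin.ext <;>
      simp only [Fin.zero_eta, Fin.mk_one, Fin.reduceFinMk] <;> omega

/-- A lower bound for `i log x + j log z + log (num / den)` with `x`, `z` and `2` multiplicatively
independent. -/
theorem eq_zero_or_exp_neg_pow_lt {φ : Fin 3 → O →+* ℝ} (hφ : LiouvilleTriple φ)
    {x z u v : O} {h B : ℝ} {t : ℕ} (ht : 3000 ≤ t) (hh : 1 ≤ h) (hht : 1000 * h ≤ t)
    (hx0 : 0 < φ 0 x) (hz0 : 0 < φ 0 z) (hu0 : 0 < φ 0 u) (hv0 : 0 < φ 0 v)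
    (hx : ∀ i, |φ i x| ≤ Real.exp h) (hz : ∀ i, |φ i z| ≤ Real.exp h)
    (hu : ∀ i, |φ i u| ≤ Real.exp h) (hv : ∀ i, |φ i v| ≤ Real.exp h)
    (hi : IndepWithTwo (φ 0) x z) {i j : ℤ} (hB : 1 ≤ B) (hiB : |(i : ℝ)| ≤ B)
    (hjB : |(j : ℝ)| ≤ B) (hBt : 4 * (t : ℝ) ^ 16 * B ≤ Real.exp t) {Λ : ℝ}
    (hΛ : Λ = (i : ℝ) * Real.log (φ 0 x) + j * Real.log (φ 0 z) +
      (Real.log (φ 0 u) - Real.log (φ 0 v))) :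
    Λ = 0 ∨ Real.exp (-(2 * (t : ℝ) ^ 50)) < |Λ| := by
  have hT : (3000 : ℝ) ≤ t := by exact_mod_cast ht
  have hT1 : (1 : ℝ) ≤ t := by linarith
  have h8 : (1 : ℝ) ≤ (t : ℝ) ^ 8 := one_le_pow₀ hT1
  have h50 : (t : ℝ) ≤ (t : ℝ) ^ 50 := le_self_pow₀ hT1 (by norm_num)
  have h16 : (t : ℝ) ^ 16 = (t : ℝ) ^ 8 * (t : ℝ) ^ 8 := by ring
  have hBt2 : 2 * (t ^ 8 : ℕ) * (2 * (t : ℝ) ^ 8 * B) ≤ Real.exp t := by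
    refine le_trans (le_of_eq ?_) hBt
    push_cast; ring
  have hBt1 : 2 * (t ^ 8 : ℕ) * B ≤ Real.exp t := by
    refine le_trans ?_ hBt2
    gcongr
    nlinarith
  have hq0 : logQuot (φ 0) ![x, z, u] ![1, 1, v] 0 = Real.log (φ 0 x) := by simp [logQuot]
  have hq1 : logQuot (φ 0) ![x, z, u] ![1, 1, v] 1 = Real.log (φ 0 z) := by simp [logQuot]
  have hq2 : logQuot (φ 0) ![x, z, u] ![1, 1, v] 2 =
    Real.log (φ 0 u) - Real.log (φ 0 v) := by simp [logQuot]
  by_cases hind : Function.Injective fun k : Fin 3 → Fin (t ^ 8) =>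
      ∑ j, (k j : ℝ) * logQuot (φ 0) ![x, z, u] ![1, 1, v] j
  · right
    have key := exp_neg_pow_lt_abs_linearForm hφ (ν := ![x, z, u]) (δ := ![1, 1, v])
      (b := ![i, j, 1]) (B := B) ht hh hht ?_ ?_ ?_ ?_ (by simp) ?_ hBt1 hind
    · rw [Fin.sum_univ_three, hq0, hq1, hq2] at key
      have h1 : Λ = ((![i, j, 1] : Fin 3 → ℤ) 0 : ℝ) * Real.log (φ 0 x) +
          ((![i, j, 1] : Fin 3 → ℤ) 1 : ℝ) * Real.log (φ 0 z) +
          ((![i, j, 1] : Fin 3 → ℤ) 2 : ℝ) * (Real.log (φ 0 u) - Real.log (φ 0 v)) := by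
        rw [hΛ]; simp
      rw [← h1] at key
      refine lt_of_le_of_lt (Real.exp_le_exp.2 ?_) key
      linarith
    · intro r; fin_cases r <;> simp [hx0, hz0, hu0]
    · intro r; fin_cases r <;> simp [hv0]
    · intro s r; fin_cases r
      · exact hx s
      · exact hz s
      · exact hu s
    · intro s r; fin_cases r
      · simpa using (by linarith : (0 : ℝ) ≤ h)
      · simpa using (by linarith : (0 : ℝ) ≤ h)
      · exact hv s
    · intro r; fin_cases r
      · exact hiB
      · exact hjB
      · simpa using hB
  · simp only [Function.Injective, not_forall] at hind
    obtain ⟨k, k', hkk, hne⟩ := hind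
    simp only [Fin.sum_univ_three, hq0, hq1, hq2] at hkk
    obtain ⟨d, hd⟩ : ∃ d : Fin 3 → ℤ, ∀ r, d r = ((k r : ℕ) : ℤ) - ((k' r : ℕ) : ℤ) :=
      ⟨_, fun _ => rfl⟩
    have hdR : ∀ r, (d r : ℝ) = (k r : ℝ) - (k' r : ℝ) := fun r => by rw [hd]; push_cast; rfl
    have hdb : ∀ r, |(d r : ℝ)| ≤ (t : ℝ) ^ 8 := by
      intro r
      have h1 : |d r| ≤ ((t ^ 8 : ℕ) : ℤ) := by
        have h2 := (k r).2
        have h3 := (k' r).2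
        rw [hd, abs_le]
        constructor <;> omega
      have h2 : ((|d r| : ℤ) : ℝ) ≤ (((t ^ 8 : ℕ) : ℤ) : ℝ) := Int.cast_le.2 h1
      simpa using h2
    have hrel : (d 0 : ℝ) * Real.log (φ 0 x) + d 1 * Real.log (φ 0 z) +
        d 2 * (Real.log (φ 0 u) - Real.log (φ 0 v)) = 0 := by
      rw [hdR, hdR, hdR]; linarith
    have hd2 : d 2 ≠ 0 := by
      intro h0
      rw [h0, Int.cast_zero, zero_mul, add_zero] at hrel
      obtain ⟨h1, h2, -⟩ := hi (d 0) (d 1) 0 (by simpa using hrel)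
      rw [hd] at h0 h1 h2
      apply hne
      funext r
      fin_cases r <;> apply Fin.ext <;>
      simp only [Fin.zero_eta, Fin.mk_one, Fin.reduceFinMk] <;> omega
    have hform : (d 2 : ℝ) * Λ = ((d 2 * i - d 0 : ℤ) : ℝ) * Real.log (φ 0 x) +
        ((d 2 * j - d 1 : ℤ) : ℝ) * Real.log (φ 0 z) := by
      rw [hΛ]; push_cast; linarith
    have hbd : ∀ (m : ℤ) r, |(m : ℝ)| ≤ B → |((d 2 * m - d r : ℤ) : ℝ)| ≤ 2 * (t : ℝ) ^ 8 * B := by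
      intro m r hm
      push_cast
      have h1 := abs_sub ((d 2 : ℝ) * m) (d r)
      rw [abs_mul] at h1
      have h2 := mul_le_mul (hdb 2) hm (abs_nonneg _) (by positivity)
      have h3 := hdb r
      nlinarith
    by_cases hz1 : d 2 * i - d 0 = 0 ∧ d 2 * j - d 1 = 0
    · left
      rw [hz1.1, hz1.2] at hform
      simp only [Int.cast_zero, zero_mul, add_zero, mul_eq_zero, Int.cast_eq_zero] at hform
      exact hform.resolve_left hd2
    · right
      have hlow : Real.exp (-(t : ℝ) ^ 50) < |(d 2 : ℝ) * Λ| := by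
        rw [hform]
        by_cases hj0 : d 2 * j - d 1 = 0
        · rw [add_comm]
          exact exp_neg_pow_lt_abs_linearForm_two hφ ht hh hht hz0 hx0 hz hx hi.symm
            (hbd _ _ hjB) (hbd _ _ hiB) (fun h0 => hz1 ⟨h0, hj0⟩) hBt2
        · exact exp_neg_pow_lt_abs_linearForm_two hφ ht hh hht hx0 hz0 hx hz hi
            (hbd _ _ hiB) (hbd _ _ hjB) hj0 hBt2
      rw [abs_mul] at hlow
      have h1 : |(d 2 : ℝ)| ≤ Real.exp ((t : ℝ) ^ 50) :=
        ((hdb 2).trans (pow_le_exp_of_le hT (by norm_num))).trans (Real.exp_le_exp.2 h50)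
      have h2 : Real.exp (-(t : ℝ) ^ 50) < Real.exp ((t : ℝ) ^ 50) * |Λ| :=
        hlow.trans_le (mul_le_mul_of_nonneg_right h1 (abs_nonneg _))
      have h3 : Real.exp (-(t : ℝ) ^ 50) =
          Real.exp ((t : ℝ) ^ 50) * Real.exp (-(2 * (t : ℝ) ^ 50)) := by
        rw [← Real.exp_add]; congr 1; ring
      rw [h3] at h2
      exact lt_of_mul_lt_mul_left h2 (Real.exp_pos _).le

end TwoUnits

/-! ### The real cubic order generated by a root of `f_n` -/

section CubicOrder

/-- The norm of `A + B λ + C λ²`. -/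
def normForm {R : Type*} [CommRing R] (n A B C : R) : R :=
  A ^ 3 + A ^ 2 * B * (n - 1) + A ^ 2 * C * ((n - 1) ^ 2 + 2 * (n + 2)) - A * B ^ 2 * (n + 2) -
    A * B * C * ((n - 1) * (n + 2) + 3) + A * C ^ 2 * ((n + 2) ^ 2 - 2 * (n - 1)) + B ^ 3 +
    B ^ 2 * C * (n - 1) - B * C ^ 2 * (n + 2) + C ^ 3

theorem normForm_zmod_two : ∀ n A B C : ZMod 2, normForm n A B C = 0 → A = 0 ∧ B = 0 ∧ C = 0 := by
  unfold normForm
  decide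

theorem eq_zero_of_normForm_eq_zero {n A B C : ℤ} (h : normForm n A B C = 0) :
    A = 0 ∧ B = 0 ∧ C = 0 := by
  induction hN : A.natAbs + B.natAbs + C.natAbs using Nat.strong_induction_on
    generalizing A B C with
  | _ N ih =>
    have h2 : normForm (n : ZMod 2) A B C = 0 := by
      have := congrArg (Int.cast : ℤ → ZMod 2) h
      simpa [normForm] using this
    obtain ⟨hA, hB, hC⟩ := normForm_zmod_two _ _ _ _ h2
    rw [ZMod.intCast_zmod_eq_zero_iff_dvd] at hA hB hC
    obtain ⟨A', rfl⟩ := hA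
    obtain ⟨B', rfl⟩ := hB
    obtain ⟨C', rfl⟩ := hC
    have h' : normForm n A' B' C' = 0 := by
      have h8 : normForm n (((2 : ℕ) : ℤ) * A') (((2 : ℕ) : ℤ) * B') (((2 : ℕ) : ℤ) * C') =
          8 * normForm n A' B' C' := by
        simp only [normForm]; push_cast; ring
      rw [h8] at h
      omega
    by_cases h0 : A' = 0 ∧ B' = 0 ∧ C' = 0
    · obtain ⟨rfl, rfl, rfl⟩ := h0
      simp
    · have := ih _ (by push_cast at hN; omega) h' rfl
      exact absurd this h0

/-- The three roots of `f_n` in cyclic order, expressed through the positive one. -/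
def cyclicRoots (ρ : ℝ) : Fin 3 → ℝ := ![ρ, -1 / (1 + ρ), -(1 + ρ) / ρ]

@[simp] theorem cyclicRoots_zero (ρ : ℝ) : cyclicRoots ρ 0 = ρ := rfl
@[simp] theorem cyclicRoots_one (ρ : ℝ) : cyclicRoots ρ 1 = -1 / (1 + ρ) := rfl
@[simp] theorem cyclicRoots_two (ρ : ℝ) : cyclicRoots ρ 2 = -(1 + ρ) / ρ := rfl

variable {n : ℤ} {ρ : ℝ}

theorem intCast_eq_of_fn_eq_zero (hρ : 0 < ρ) (h : fn n ρ = 0) :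
    (n : ℝ) = (ρ ^ 3 + ρ ^ 2 - 2 * ρ - 1) / (ρ ^ 2 + ρ) := by
  rw [eq_div_iff (by positivity)]
  rw [fn] at h
  linarith

theorem fn_cyclicRoots (hρ : 0 < ρ) (h : fn n ρ = 0) (i : Fin 3) : fn n (cyclicRoots ρ i) = 0 := by
  have hn := intCast_eq_of_fn_eq_zero hρ h
  fin_cases i
  · exact h
  all_goals
    simp only [fn, hn, cyclicRoots_one, cyclicRoots_two, Fin.mk_one, Fin.reduceFinMk]
    field_simp
    ring

theorem cyclicRoots_add_one (hρ : 0 < ρ) (h : fn n ρ = 0) (i : Fin 3) :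
    cyclicRoots ρ (i + 1) = cyclicRoots ρ i ^ 2 - n * cyclicRoots ρ i - 2 := by
  have hn := intCast_eq_of_fn_eq_zero hρ h
  fin_cases i
  · change -1 / (1 + ρ) = ρ ^ 2 - n * ρ - 2
    rw [hn]; field_simp; ring
  · change -(1 + ρ) / ρ = (-1 / (1 + ρ)) ^ 2 - n * (-1 / (1 + ρ)) - 2
    rw [hn]; field_simp; ring
  · change ρ = (-(1 + ρ) / ρ) ^ 2 - n * (-(1 + ρ) / ρ) - 2
    rw [hn]; field_simp; ring

theorem cyclicRoots_ne_zero (hρ : 0 < ρ) (i : Fin 3) : cyclicRoots ρ i ≠ 0 := by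
  have h1 : 1 + ρ ≠ 0 := by positivity
  fin_cases i
  · exact hρ.ne'
  · exact div_ne_zero (by norm_num) h1
  · exact div_ne_zero (neg_ne_zero.2 h1) hρ.ne'

theorem cyclicRoots_mul (hρ : 0 < ρ) (i : Fin 3) :
    cyclicRoots ρ i * (cyclicRoots ρ (i + 1) * cyclicRoots ρ (i + 1 + 1)) = 1 := by
  fin_cases i
  · change ρ * (-1 / (1 + ρ) * (-(1 + ρ) / ρ)) = 1
    field_simp
  · change -1 / (1 + ρ) * (-(1 + ρ) / ρ * ρ) = 1
    field_simp
  · change -(1 + ρ) / ρ * (ρ * (-1 / (1 + ρ))) = 1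
    field_simp

/-- The ring of conjugate triples `A + B λ_i + C λ_i²`. -/
def conjRing (hρ : 0 < ρ) (h : fn n ρ = 0) : Subring (Fin 3 → ℝ) where
  carrier := {v | ∃ A B C : ℤ, ∀ i, v i = A + B * cyclicRoots ρ i + C * cyclicRoots ρ i ^ 2}
  one_mem' := ⟨1, 0, 0, fun i => by simp⟩
  zero_mem' := ⟨0, 0, 0, fun i => by simp⟩
  add_mem' := by
    rintro v w ⟨A, B, C, hv⟩ ⟨A', B', C', hw⟩
    exact ⟨A + A', B + B', C + C', fun i => by rw [Pi.add_apply, hv, hw]; push_cast; ring⟩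
  neg_mem' := by
    rintro v ⟨A, B, C, hv⟩
    exact ⟨-A, -B, -C, fun i => by rw [Pi.neg_apply, hv]; push_cast; ring⟩
  mul_mem' := by
    rintro v w ⟨A, B, C, hv⟩ ⟨A', B', C', hw⟩
    refine ⟨A * A' + (B * C' + C * B') + (n - 1) * (C * C'),
      A * B' + B * A' + (n + 2) * (B * C' + C * B') + ((n - 1) * (n + 2) + 1) * (C * C'),
      A * C' + B * B' + C * A' + (n - 1) * (B * C' + C * B') +
        ((n - 1) ^ 2 + (n + 2)) * (C * C'), fun i => ?_⟩
    have hi := fn_cyclicRoots hρ h i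
    rw [fn] at hi
    rw [Pi.mul_apply, hv, hw]
    push_cast
    linear_combination ((B * C' + C * B' : ℝ) + C * C' * (cyclicRoots ρ i + (n - 1))) * hi

theorem mem_conjRing (hρ : 0 < ρ) (h : fn n ρ = 0) {v : Fin 3 → ℝ} :
    v ∈ conjRing hρ h ↔
      ∃ A B C : ℤ, ∀ i, v i = A + B * cyclicRoots ρ i + C * cyclicRoots ρ i ^ 2 := Iff.rfl

/-- The product of the conjugates is the integer `normForm`. -/
theorem prod_eq_normForm (hρ : 0 < ρ) (h : fn n ρ = 0) {v : Fin 3 → ℝ} {A B C : ℤ}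
    (hv : ∀ i, v i = A + B * cyclicRoots ρ i + C * cyclicRoots ρ i ^ 2) :
    v 0 * v 1 * v 2 = (normForm n A B C : ℤ) := by
  have hn := intCast_eq_of_fn_eq_zero hρ h
  have e1 : cyclicRoots ρ 0 + cyclicRoots ρ 1 + cyclicRoots ρ 2 = n - 1 := by
    rw [hn, cyclicRoots_zero, cyclicRoots_one, cyclicRoots_two]; field_simp; ring
  have e2 : cyclicRoots ρ 0 * cyclicRoots ρ 1 + cyclicRoots ρ 0 * cyclicRoots ρ 2 +
      cyclicRoots ρ 1 * cyclicRoots ρ 2 = -(n + 2) := by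
    rw [hn, cyclicRoots_zero, cyclicRoots_one, cyclicRoots_two]; field_simp; ring
  have e3 : cyclicRoots ρ 0 * cyclicRoots ρ 1 * cyclicRoots ρ 2 = 1 := by
    rw [cyclicRoots_zero, cyclicRoots_one, cyclicRoots_two]; field_simp
  rw [hv, hv, hv]
  generalize cyclicRoots ρ 0 = a at *
  generalize cyclicRoots ρ 1 = b at *
  generalize cyclicRoots ρ 2 = c at *
  have hn1 : (n : ℝ) = a + b + c + 1 := by linarith
  simp only [normForm]
  push_cast
  have e2' : (n : ℝ) + 2 = -(a * b + a * c + b * c) := by linarith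
  have e1' : (n : ℝ) - 1 = a + b + c := by linarith
  rw [e1', e2']
  linear_combination (-3 * A * B * C - 2 * A * C ^ 2 * (a + b + c) + B ^ 3 +
    B ^ 2 * C * (a + b + c) + B * C ^ 2 * (a * b + a * c + b * c) +
    C ^ 3 * (a * b * c + 1) : ℝ) * e3

theorem eq_zero_of_apply_eq_zero (hρ : 0 < ρ) (h : fn n ρ = 0) {v : Fin 3 → ℝ}
    (hv : v ∈ conjRing hρ h) {i : Fin 3} (hi : v i = 0) : v = 0 := by
  obtain ⟨A, B, C, hv⟩ := hv
  have h1 := prod_eq_normForm hρ h hv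
  have h2 : v 0 * v 1 * v 2 = 0 := by
    fin_cases i <;> simp at hi <;> simp [hi]
  rw [h2] at h1
  obtain ⟨rfl, rfl, rfl⟩ := eq_zero_of_normForm_eq_zero (by exact_mod_cast h1.symm)
  funext j
  simp [hv]

/-- The three embeddings of `conjRing`. -/
def conjEmb (hρ : 0 < ρ) (h : fn n ρ = 0) (i : Fin 3) : conjRing hρ h →+* ℝ :=
  (Pi.evalRingHom (fun _ : Fin 3 => ℝ) i).comp (conjRing hρ h).subtype

theorem liouvilleTriple_conjEmb (hρ : 0 < ρ) (h : fn n ρ = 0) :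
    LiouvilleTriple (conjEmb hρ h) := by
  rintro ⟨v, hv⟩ h0
  change 1 ≤ |v 0| * |v 1| * |v 2|
  change v 0 ≠ 0 at h0
  obtain ⟨A, B, C, hv'⟩ := id hv
  have h1 := prod_eq_normForm hρ h hv'
  rw [← abs_mul, ← abs_mul, h1, ← Int.cast_abs]
  have h2 : normForm n A B C ≠ 0 := by
    intro h3
    rw [h3, Int.cast_zero, mul_eq_zero, mul_eq_zero] at h1
    apply h0
    rcases h1 with (h1 | h1) | h1
    · exact h1
    all_goals rw [eq_zero_of_apply_eq_zero hρ h hv h1]; rfl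
  exact_mod_cast Int.one_le_abs h2

theorem rotate_mem_conjRing (hρ : 0 < ρ) (h : fn n ρ = 0) {v : Fin 3 → ℝ}
    (hv : v ∈ conjRing hρ h) : (fun i => v (i + 1)) ∈ conjRing hρ h := by
  obtain ⟨A, B, C, hv⟩ := hv
  have hl : (fun i => cyclicRoots ρ (i + 1)) ∈ conjRing hρ h :=
    ⟨-2, -n, 1, fun i => by
      simp only [cyclicRoots_add_one hρ h]; push_cast; ring⟩
  have : (fun i => v (i + 1)) = ((A : ℤ) : Fin 3 → ℝ) + ((B : ℤ) : Fin 3 → ℝ) *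
      (fun i => cyclicRoots ρ (i + 1)) + ((C : ℤ) : Fin 3 → ℝ) *
      (fun i => cyclicRoots ρ (i + 1)) ^ 2 := by
    funext i; simp [hv]
  rw [this]
  exact add_mem (add_mem (intCast_mem _ _) (mul_mem (intCast_mem _ _) hl))
    (mul_mem (intCast_mem _ _) (pow_mem hl 2))

theorem rotate_mem_conjRing' (hρ : 0 < ρ) (h : fn n ρ = 0) {v : Fin 3 → ℝ}
    (hv : v ∈ conjRing hρ h) (j : Fin 3) : (fun i => v (i + j)) ∈ conjRing hρ h := by
  have h1 := rotate_mem_conjRing hρ h hv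
  fin_cases j
  · simpa using hv
  · exact h1
  · have h2 := rotate_mem_conjRing hρ h h1
    have : (fun i : Fin 3 => v (i + 1 + 1)) = fun i => v (i + 2) := by
      funext i; rw [add_assoc]; rfl
    rwa [this] at h2

theorem cyclicRoots_mem (hρ : 0 < ρ) (h : fn n ρ = 0) : cyclicRoots ρ ∈ conjRing hρ h :=
  ⟨0, 1, 0, fun i => by simp⟩

theorem cyclicRoots_zpow_mem (hρ : 0 < ρ) (h : fn n ρ = 0) (m : ℤ) :
    (fun i => cyclicRoots ρ i ^ m) ∈ conjRing hρ h := by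
  have hl := cyclicRoots_mem hρ h
  have hinv : (fun i => (cyclicRoots ρ i)⁻¹) ∈ conjRing hρ h := by
    have h1 := rotate_mem_conjRing hρ h hl
    have h2 := rotate_mem_conjRing hρ h h1
    have : (fun i => (cyclicRoots ρ i)⁻¹) =
        (fun i => cyclicRoots ρ (i + 1)) * (fun i => cyclicRoots ρ (i + 1 + 1)) := by
      funext i
      exact inv_eq_of_mul_eq_one_right (cyclicRoots_mul hρ i)
    rw [this]
    exact mul_mem h1 h2
  obtain ⟨k, rfl | rfl⟩ := m.eq_nat_or_neg
  · have := pow_mem hl k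
    convert this using 1
    funext i; simp
  · have := pow_mem hinv k
    convert this using 1
    funext i; simp

end CubicOrder

section CyclicLogs

variable {n : ℤ} {ρ : ℝ}

theorem log_cyclicRoots_pos (hρ : 1 < ρ) :
    0 < Real.log (cyclicRoots ρ 0) ∧ 0 < Real.log (cyclicRoots ρ 2) := by
  refine ⟨Real.log_pos hρ, ?_⟩
  rw [cyclicRoots_two, neg_div, Real.log_neg_eq_log]
  exact Real.log_pos (by rw [lt_div_iff₀ (by linarith)]; linarith)

theorem log_cyclicRoots_one : Real.log (cyclicRoots ρ 1) =
    -Real.log (1 + ρ) := by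
  rw [cyclicRoots_one, neg_div, Real.log_neg_eq_log, one_div, Real.log_inv]

theorem log_cyclicRoots_zero_add_two (hρ : 1 < ρ) :
    Real.log (cyclicRoots ρ 0) + Real.log (cyclicRoots ρ 2) = Real.log (1 + ρ) := by
  rw [cyclicRoots_two, cyclicRoots_zero, neg_div, Real.log_neg_eq_log,
    Real.log_div (by linarith) (by linarith)]
  ring

theorem log_two_lt_log_one_add (hρ : 1 < ρ) : 2 / 3 < Real.log (1 + ρ) := by
  have h1 := Real.log_two_gt_d9
  have h2 := Real.log_lt_log two_pos (by linarith : 2 < 1 + ρ)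
  linarith

theorem abs_log_cyclicRoots_le (hρ : 1 < ρ) (i : Fin 3) :
    |Real.log (cyclicRoots ρ i)| ≤ Real.log (1 + ρ) := by
  have h1 := log_cyclicRoots_pos hρ
  have h2 := log_cyclicRoots_one (ρ := ρ)
  have h3 := log_cyclicRoots_zero_add_two hρ
  have h4 := log_two_lt_log_one_add hρ
  fin_cases i
  · change |Real.log (cyclicRoots ρ 0)| ≤ _
    rw [abs_of_pos h1.1]; linarith
  · change |Real.log (cyclicRoots ρ 1)| ≤ _
    rw [h2, abs_neg, abs_of_pos (by linarith)]
  · change |Real.log (cyclicRoots ρ 2)| ≤ _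
    rw [abs_of_pos h1.2]; linarith

theorem abs_cyclicRoots_le (hρ : 1 < ρ) (i : Fin 3) :
    |cyclicRoots ρ i| ≤ Real.exp (Real.log (1 + ρ)) := by
  rw [← Real.log_le_iff_le_exp (abs_pos.2 (cyclicRoots_ne_zero (by linarith) i)), Real.log_abs]
  exact (le_abs_self _).trans (abs_log_cyclicRoots_le hρ i)

theorem cyclicRoots_prod (hρ : 0 < ρ) :
    cyclicRoots ρ 0 * cyclicRoots ρ 1 * cyclicRoots ρ 2 = 1 := by
  rw [mul_assoc]
  exact cyclicRoots_mul hρ 0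

/-- An integer linear relation between `log λ₀`, `log |λ₂|` and `log 2` is trivial. -/
theorem indep_log_cyclicRoots (hρ : 1 < ρ) (h : fn n ρ = 0) {i j k : ℤ}
    (hrel : (i : ℝ) * (2 * Real.log (cyclicRoots ρ 0)) + j * (2 * Real.log (cyclicRoots ρ 2)) +
      k * Real.log 2 = 0) : i = 0 ∧ j = 0 ∧ k = 0 := by
  have hρ0 : 0 < ρ := by linarith
  have hne := cyclicRoots_ne_zero hρ0
  set w : Fin 3 → ℝ := fun m => cyclicRoots ρ m ^ (2 * i) * cyclicRoots ρ (m + 2) ^ (2 * j) with hw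
  have hwm : w ∈ conjRing hρ0 h := mul_mem (cyclicRoots_zpow_mem hρ0 h (2 * i))
    (rotate_mem_conjRing' hρ0 h (cyclicRoots_zpow_mem hρ0 h (2 * j)) 2)
  have hwpos : ∀ m, 0 < w m := fun m => by
    simp only [hw, zpow_mul, zpow_ofNat]
    have := hne m
    have := hne (m + 2)
    positivity
  have hwlog : ∀ m, Real.log (w m) = i * (2 * Real.log (cyclicRoots ρ m)) +
      j * (2 * Real.log (cyclicRoots ρ (m + 2))) := fun m => by
    simp only [hw]
    rw [Real.log_mul (zpow_ne_zero _ (hne _)) (zpow_ne_zero _ (hne _)), Real.log_zpow,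
      Real.log_zpow]
    push_cast; ring
  have hprod : w 0 * w 1 * w 2 = 1 := by
    have e : w 0 * w 1 * w 2 = (cyclicRoots ρ 0 * cyclicRoots ρ 1 * cyclicRoots ρ 2) ^ (2 * i) *
        (cyclicRoots ρ 0 * cyclicRoots ρ 1 * cyclicRoots ρ 2) ^ (2 * j) := by
      simp only [mul_zpow]
      change cyclicRoots ρ 0 ^ (2 * i) * cyclicRoots ρ 2 ^ (2 * j) *
        (cyclicRoots ρ 1 ^ (2 * i) * cyclicRoots ρ 0 ^ (2 * j)) *
        (cyclicRoots ρ 2 ^ (2 * i) * cyclicRoots ρ 1 ^ (2 * j)) = _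
      ring
    rw [e, cyclicRoots_prod hρ0, one_zpow, one_zpow, one_mul]
  have hlog0 : Real.log (w 0) = -(k * Real.log 2) := by
    rw [hwlog]
    change i * (2 * Real.log (cyclicRoots ρ 0)) + j * (2 * Real.log (cyclicRoots ρ 2)) = _
    linarith
  have hconst : ∀ m, w m = w 0 := by
    obtain ⟨r, hr | hr⟩ := k.eq_nat_or_neg
    · have h1 : ((2 ^ r : ℕ) : Fin 3 → ℝ) * w - 1 = 0 := by
        refine eq_zero_of_apply_eq_zero hρ0 h (sub_mem (mul_mem (natCast_mem _ _) hwm)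
          (one_mem _)) (i := 0) ?_
        have h2 : (2 : ℝ) ^ r * w 0 = 1 := by
          rw [← Real.exp_log (hwpos 0), hlog0, hr, Real.exp_neg, Int.cast_natCast,
            Real.exp_nat_mul, Real.exp_log two_pos]
          exact mul_inv_cancel₀ (by positivity)
        simp [h2]
      intro m
      have h2 := congrFun h1 m
      have h3 := congrFun h1 0
      have h4 : (2 : ℝ) ^ r ≠ 0 := by positivity
      simp only [Pi.sub_apply, Pi.mul_apply, Pi.pow_apply, Pi.ofNat_apply, Nat.cast_pow,
        Nat.cast_ofNat] at h2 h3
      exact mul_left_cancel₀ h4 (by linarith)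
    · have h1 : w - ((2 ^ r : ℕ) : Fin 3 → ℝ) = 0 := by
        refine eq_zero_of_apply_eq_zero hρ0 h (sub_mem hwm (natCast_mem _ _)) (i := 0) ?_
        have h2 : w 0 = (2 : ℝ) ^ r := by
          rw [← Real.exp_log (hwpos 0), hlog0, hr, Int.cast_neg, neg_mul, neg_neg,
            Int.cast_natCast, Real.exp_nat_mul, Real.exp_log two_pos]
        simp [h2]
      intro m
      have h2 := congrFun h1 m
      have h3 := congrFun h1 0
      simp only [Pi.sub_apply, Pi.natCast_apply, Pi.zero_apply] at h2 h3
      linarith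
  have hw0 : w 0 = 1 := by
    rw [hconst 1, hconst 2] at hprod
    have h1 : w 0 ^ 3 = 1 ^ 3 := by rw [one_pow]; linarith [hprod, pow_succ (w 0) 2, sq (w 0)]
    exact (pow_left_inj₀ (hwpos 0).le zero_le_one (by norm_num)).1 h1
  have hz : ∀ m, Real.log (w m) = 0 := fun m => by rw [hconst, hw0, Real.log_one]
  have h0 := hz 0
  have h1 := hz 1
  rw [hwlog] at h0 h1
  have hp := log_cyclicRoots_pos hρ
  have h3 := log_cyclicRoots_one (ρ := ρ)
  have h4 := log_cyclicRoots_zero_add_two hρ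
  change i * (2 * Real.log (cyclicRoots ρ 0)) + j * (2 * Real.log (cyclicRoots ρ 2)) = 0 at h0
  change i * (2 * Real.log (cyclicRoots ρ 1)) + j * (2 * Real.log (cyclicRoots ρ 0)) = 0 at h1
  rw [h3, ← h4] at h1
  generalize Real.log (cyclicRoots ρ 0) = s at *
  generalize Real.log (cyclicRoots ρ 2) = t at *
  obtain ⟨hs, ht⟩ := hp
  have hj : (j : ℝ) * (s ^ 2 + t * (s + t)) = 0 := by linear_combination (s * h1 + (s + t) * h0) / 2
  have hj0 : (j : ℝ) = 0 := (mul_eq_zero.1 hj).resolve_right (by positivity)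
  rw [hj0, zero_mul, add_zero] at h0
  have hi0 : (i : ℝ) = 0 := (mul_eq_zero.1 h0).resolve_right (by positivity)
  rw [hi0, hj0, zero_mul, zero_mul, zero_add, zero_add] at hrel
  have hk0 : (k : ℝ) = 0 := (mul_eq_zero.1 hrel).resolve_right (Real.log_pos one_lt_two).ne'
  exact ⟨by exact_mod_cast hi0, by exact_mod_cast hj0, by exact_mod_cast hk0⟩

/-- The lower bound for linear forms in logarithms used in the sequel. -/
theorem eq_zero_or_exp_neg_pow_lt_cyclic (hρ : 1 < ρ) (hρ0 : 0 < ρ) (h : fn n ρ = 0)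
    {U V : Fin 3 → ℝ} (hU : U ∈ conjRing hρ0 h) (hV : V ∈ conjRing hρ0 h) {g B : ℝ}
    (hg : Real.log (1 + ρ) ≤ g) (hUg : ∀ i, |U i| ≤ Real.exp g) (hVg : ∀ i, |V i| ≤ Real.exp g)
    (hU0 : U 0 ≠ 0) (hV0 : V 0 ≠ 0) {p q : ℤ} (hB : 1 ≤ B) (hp : |(p : ℝ)| ≤ B)
    (hq : |(q : ℝ)| ≤ B) {Λ : ℝ} (hΛ : Λ = p * Real.log (cyclicRoots ρ 0) +
      q * Real.log (cyclicRoots ρ 2) + (Real.log (U 0) - Real.log (V 0))) :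
    Λ = 0 ∨ Real.exp (-(21000 * (g + Real.log B)) ^ 50) < |Λ| := by
  have hH := log_two_lt_log_one_add hρ
  have hlB := Real.log_nonneg hB
  set s := g + Real.log B with hs
  set t : ℕ := ⌈3000 * (2 * g + Real.log B)⌉₊ with ht
  have ht1 : 3000 * (2 * g + Real.log B) ≤ t := Nat.le_ceil _
  have ht2 : (t : ℝ) < 3000 * (2 * g + Real.log B) + 1 := Nat.ceil_lt_add_one (by linarith)
  have ht3 : (3000 : ℝ) ≤ t := by linarith
  have ht4 : (t : ℝ) ≤ 7000 * s := by linarith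
  have hnn : ∀ i, cyclicRoots ρ i ≠ 0 := cyclicRoots_ne_zero hρ0
  have hsq : ∀ {r : ℝ}, |r| ≤ Real.exp g → |r ^ 2| ≤ Real.exp (2 * g) := by
    intro r hr
    rw [abs_pow, two_mul, Real.exp_add, sq]
    exact mul_le_mul hr hr (abs_nonneg _) (Real.exp_pos _).le
  have hl : ∀ i, |cyclicRoots ρ i| ≤ Real.exp g := fun i =>
    (abs_cyclicRoots_le hρ i).trans (Real.exp_le_exp.2 hg)
  have hl2 := rotate_mem_conjRing' hρ0 h (cyclicRoots_mem hρ0 h) 2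
  have hlogsq : ∀ r : ℝ, Real.log (r ^ 2) = 2 * Real.log r := fun r => by
    rw [Real.log_pow]; norm_num
  have hBt : 4 * (t : ℝ) ^ 16 * B ≤ Real.exp t := by
    have h1 : 4 * (t : ℝ) ^ 16 ≤ Real.exp (t / 2) := by
      have h2 : (t : ℝ) ^ 17 ≤ Real.exp (t / 2) := by
        refine le_of_sq_le_sq ?_ (Real.exp_pos _).le
        rw [← pow_mul, ← Real.exp_nat_mul]
        refine (pow_le_exp_of_le ht3 (by norm_num)).trans (le_of_eq ?_)
        congr 1; push_cast; ring
      have h3 : (t : ℝ) ^ 17 = (t : ℝ) ^ 16 * t := pow_succ _ _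
      have h4 : 0 < (t : ℝ) ^ 16 := by positivity
      nlinarith
    have h5 : B ≤ Real.exp (t / 2) := by
      rw [← Real.log_le_iff_le_exp (by linarith)]
      linarith
    calc _ ≤ Real.exp (t / 2) * Real.exp (t / 2) := by gcongr
      _ = _ := by rw [← Real.exp_add]; congr 1; ring
  have key := eq_zero_or_exp_neg_pow_lt (liouvilleTriple_conjEmb hρ0 h)
    (x := ⟨cyclicRoots ρ, cyclicRoots_mem hρ0 h⟩ ^ 2) (z := ⟨_, hl2⟩ ^ 2)
    (u := ⟨U, hU⟩ ^ 2) (v := ⟨V, hV⟩ ^ 2) (h := 2 * g) (t := t) (i := p) (j := q) (B := B)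
    (Λ := 2 * Λ) (by exact_mod_cast ht3) (by linarith) (by linarith)
    (sq_pos_of_ne_zero (hnn 0)) (sq_pos_of_ne_zero (hnn 2)) (sq_pos_of_ne_zero hU0)
    (sq_pos_of_ne_zero hV0) (fun i => hsq (hl i)) (fun i => hsq (hl (i + 2)))
    (fun i => hsq (hUg i)) (fun i => hsq (hVg i)) ?_ hB hp hq hBt ?_
  · rcases key with key | key
    · left; linarith
    · right
      rw [abs_mul, abs_two] at key
      have h1 : (t : ℝ) ^ 50 ≤ (7000 * s) ^ 50 := pow_le_pow_left₀ (Nat.cast_nonneg _) ht4 _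
      have h2 : (21000 * s) ^ 50 = 3 ^ 50 * (7000 * s) ^ 50 := by rw [← mul_pow]; ring_nf
      have h3 : 1 ≤ (t : ℝ) ^ 50 := one_le_pow₀ (by linarith)
      have h4 : Real.exp (-(21000 * s) ^ 50) ≤ Real.exp (-1) * Real.exp (-(2 * (t : ℝ) ^ 50)) := by
        rw [← Real.exp_add]
        apply Real.exp_le_exp.2
        rw [h2]
        have : (3 : ℝ) ≤ 3 ^ 50 := by norm_num
        nlinarith
      have h5 : Real.exp (-1) ≤ 1 / 2 := by
        have := Real.exp_neg_one_lt_d9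
        linarith
      have h6 := Real.exp_pos (-(2 * (t : ℝ) ^ 50))
      nlinarith
  · intro i j k hrel
    apply indep_log_cyclicRoots hρ h
    rw [← hlogsq, ← hlogsq]
    exact hrel
  · change 2 * Λ = p * Real.log (cyclicRoots ρ 0 ^ 2) + q * Real.log (cyclicRoots ρ 2 ^ 2) +
      (Real.log (U 0 ^ 2) - Real.log (V 0 ^ 2))
    rw [hlogsq, hlogsq, hlogsq, hlogsq, hΛ]
    ring

end CyclicLogs

section ReducedUnits

variable {n : ℤ} {ρ : ℝ}

/-- The logarithm of the absolute value of the `i`-th root. -/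
def logRoot (ρ : ℝ) (i : Fin 3) : ℝ := Real.log (cyclicRoots ρ i)

theorem logRoot_zero : logRoot ρ 0 = Real.log ρ := rfl

theorem logRoot_one : logRoot ρ 1 = -Real.log (1 + ρ) := log_cyclicRoots_one

theorem logRoot_zero_add_two (hρ : 1 < ρ) : logRoot ρ 0 + logRoot ρ 2 = Real.log (1 + ρ) :=
  log_cyclicRoots_zero_add_two hρ

theorem logRoot_one_eq (hρ : 1 < ρ) : logRoot ρ 1 = -(logRoot ρ 0 + logRoot ρ 2) := by
  rw [logRoot_one, logRoot_zero_add_two hρ]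

theorem logRoot_pos (hρ : 1 < ρ) : 0 < logRoot ρ 0 ∧ 0 < logRoot ρ 2 := log_cyclicRoots_pos hρ

theorem logRoot_add_two (hρ : 1 < ρ) (i : Fin 3) :
    logRoot ρ (i + 2) = -(logRoot ρ i + logRoot ρ (i + 1)) := by
  have h := logRoot_one_eq hρ
  fin_cases i
  · change logRoot ρ 2 = -(logRoot ρ 0 + logRoot ρ 1)
    linarith
  · change logRoot ρ 0 = -(logRoot ρ 1 + logRoot ρ 2)
    linarith
  · change logRoot ρ 1 = -(logRoot ρ 2 + logRoot ρ 0)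
    linarith

/-- Integer combinations of two consecutive `logRoot`s are integer combinations of
`logRoot ρ 0` and `logRoot ρ 2`. -/
theorem exists_logRoot_comb (hρ : 1 < ρ) (i : Fin 3) (p q : ℤ) {B : ℝ} (hp : |(p : ℝ)| ≤ B)
    (hq : |(q : ℝ)| ≤ B) : ∃ p' q' : ℤ, |(p' : ℝ)| ≤ 2 * B ∧ |(q' : ℝ)| ≤ 2 * B ∧
      p * logRoot ρ i + q * logRoot ρ (i + 1) = p' * logRoot ρ 0 + q' * logRoot ρ 2 := by
  have h := logRoot_one_eq hρ
  rw [abs_le] at hp hq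
  fin_cases i
  · refine ⟨p - q, -q, ?_, ?_, ?_⟩
    · rw [abs_le]; push_cast; constructor <;> linarith
    · rw [abs_le]; push_cast; constructor <;> linarith
    · change p * logRoot ρ 0 + q * logRoot ρ 1 = _
      rw [h]; push_cast; ring
  · refine ⟨-p, q - p, ?_, ?_, ?_⟩
    · rw [abs_le]; push_cast; constructor <;> linarith
    · rw [abs_le]; push_cast; constructor <;> linarith
    · change p * logRoot ρ 1 + q * logRoot ρ 2 = _
      rw [h]; push_cast; ring
  · refine ⟨q, p, ?_, ?_, ?_⟩
    · rw [abs_le]; constructor <;> linarith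
    · rw [abs_le]; constructor <;> linarith
    · change p * logRoot ρ 2 + q * logRoot ρ 0 = _
      ring

theorem eq_zero_or_exp_neg_pow_lt_rotate (hρ : 1 < ρ) (hρ0 : 0 < ρ) (h : fn n ρ = 0)
    {U V : Fin 3 → ℝ} (hU : U ∈ conjRing hρ0 h) (hV : V ∈ conjRing hρ0 h) {g B : ℝ}
    (hg : Real.log (1 + ρ) ≤ g) (hUg : ∀ i, |U i| ≤ Real.exp g) (hVg : ∀ i, |V i| ≤ Real.exp g)
    {i : Fin 3} (hUi : U i ≠ 0) (hVi : V i ≠ 0) {p q : ℤ} (hB : 1 ≤ B) (hp : |(p : ℝ)| ≤ B)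
    (hq : |(q : ℝ)| ≤ B) {Λ : ℝ} (hΛ : Λ = p * logRoot ρ i + q * logRoot ρ (i + 1) +
      (Real.log (U i) - Real.log (V i))) :
    Λ = 0 ∨ Real.exp (-(21000 * (g + Real.log (2 * B))) ^ 50) < |Λ| := by
  obtain ⟨p', q', hp', hq', hpq⟩ := exists_logRoot_comb hρ i p q hp hq
  refine eq_zero_or_exp_neg_pow_lt_cyclic hρ hρ0 h (rotate_mem_conjRing' hρ0 h hU i)
    (rotate_mem_conjRing' hρ0 h hV i) hg (fun m => hUg _) (fun m => hVg _) ?_ ?_ (by linarith)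
    hp' hq' ?_
  · simpa using hUi
  · simpa using hVi
  · simp only [zero_add]
    rw [hΛ, hpq]
    rfl

/-- Simultaneous rounding of two reals for which the differences are also small. -/
theorem exists_round_pair (s t : ℝ) : ∃ P Q : ℤ, |s - P| ≤ 2 / 3 ∧ |t - Q| ≤ 2 / 3 ∧
    |(s - P) - (t - Q)| ≤ 2 / 3 := by
  have h1 := Int.fract_nonneg s
  have h2 := Int.fract_nonneg t
  have h3 := Int.fract_lt_one s
  have h4 := Int.fract_lt_one t
  have h5 : s = ⌊s⌋ + Int.fract s := (Int.floor_add_fract s).symm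
  have h6 : t = ⌊t⌋ + Int.fract t := (Int.floor_add_fract t).symm
  generalize Int.fract s = x at *
  generalize Int.fract t = y at *
  have key : ∀ P Q : ℤ, (-(2 / 3) ≤ x - P ∧ x - P ≤ 2 / 3 ∧ -(2 / 3) ≤ y - Q ∧ y - Q ≤ 2 / 3 ∧
      -(2 / 3) ≤ x - P - (y - Q) ∧ x - P - (y - Q) ≤ 2 / 3) → ∃ P Q : ℤ, |s - P| ≤ 2 / 3 ∧
      |t - Q| ≤ 2 / 3 ∧ |(s - P) - (t - Q)| ≤ 2 / 3 := fun P Q hPQ => by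
    refine ⟨⌊s⌋ + P, ⌊t⌋ + Q, ?_⟩
    simp only [abs_le]
    push_cast
    obtain ⟨a1, a2, a3, a4, a5, a6⟩ := hPQ
    refine ⟨⟨?_, ?_⟩, ⟨?_, ?_⟩, ?_, ?_⟩ <;> linarith
  rcases le_total x (2 / 3) with hx | hx <;> rcases le_total y (2 / 3) with hy | hy
  · exact key 0 0 (by push_cast; refine ⟨?_, ?_, ?_, ?_, ?_, ?_⟩ <;> linarith)
  · rcases le_total x (1 / 3) with hx' | hx'
    · exact key 0 1 (by push_cast; refine ⟨?_, ?_, ?_, ?_, ?_, ?_⟩ <;> linarith)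
    · exact key 1 1 (by push_cast; refine ⟨?_, ?_, ?_, ?_, ?_, ?_⟩ <;> linarith)
  · rcases le_total y (1 / 3) with hy' | hy'
    · exact key 1 0 (by push_cast; refine ⟨?_, ?_, ?_, ?_, ?_, ?_⟩ <;> linarith)
    · exact key 1 1 (by push_cast; refine ⟨?_, ?_, ?_, ?_, ?_, ?_⟩ <;> linarith)
  · exact key 1 1 (by push_cast; refine ⟨?_, ?_, ?_, ?_, ?_, ?_⟩ <;> linarith)

/-- Every unit is, up to the group generated by two of the roots, a unit all of whose conjugates
are at most `(1 + ρ) ^ (2 / 3)`. -/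
theorem exists_reduced_unit (hρ : 1 < ρ) (hρ0 : 0 < ρ) (h : fn n ρ = 0) {ε : Fin 3 → ℝ}
    (hε : ε ∈ conjRing hρ0 h) (hne : ∀ i, ε i ≠ 0)
    (hsum : Real.log (ε 0) + Real.log (ε 1) + Real.log (ε 2) = 0) {W : ℝ}
    (hW : ∀ i, |Real.log (ε i)| ≤ W) :
    ∃ P Q : ℤ, ∃ η ∈ conjRing hρ0 h, |(P : ℝ)| ≤ 4 * W + 1 ∧ |(Q : ℝ)| ≤ 4 * W + 1 ∧
      (∀ i, η i ≠ 0) ∧ (∀ i, |Real.log (η i)| ≤ 2 / 3 * Real.log (1 + ρ)) ∧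
      ∀ i, Real.log (ε i) = P * logRoot ρ i + Q * logRoot ρ (i + 1) + Real.log (η i) := by
  have hH := log_two_lt_log_one_add hρ
  have hl1 := logRoot_one_eq hρ
  have hl02 := logRoot_zero_add_two hρ
  obtain ⟨hp0, hp2⟩ := logRoot_pos hρ
  have hW0 := hW 0
  have hW2 := hW 2
  obtain ⟨s, t, h0, h1, h2, hs, ht⟩ : ∃ s t : ℝ,
      Real.log (ε 0) = s * logRoot ρ 0 + t * logRoot ρ 1 ∧
      Real.log (ε 1) = s * logRoot ρ 1 + t * logRoot ρ 2 ∧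
      Real.log (ε 2) = s * logRoot ρ 2 + t * logRoot ρ 0 ∧ |s| ≤ 4 * W ∧ |t| ≤ 4 * W := by
    have e1 : Real.log (ε 1) = -(Real.log (ε 0) + Real.log (ε 2)) := by linarith
    rw [e1, hl1]
    rw [← hl02] at hH
    generalize Real.log (ε 0) = u at *
    generalize Real.log (ε 2) = v at *
    generalize logRoot ρ 0 = x at *
    generalize logRoot ρ 2 = z at *
    have hD : 0 < x ^ 2 + z * (x + z) := by positivity
    have hD' : (x + z) ^ 2 * 3 ≤ 4 * (x ^ 2 + z * (x + z)) := by nlinarith [sq_nonneg (x - z)]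
    have hWnn : 0 ≤ W := (abs_nonneg _).trans hW0
    rw [abs_le] at hW0 hW2
    have hb : 2 * W * (x + z) ≤ 4 * W * (x ^ 2 + z * (x + z)) := by
      have : 2 * (x + z) ≤ 3 * (x + z) ^ 2 := by nlinarith
      nlinarith
    have hc : ∀ r, |r| ≤ 2 * W * (x + z) → |r / (x ^ 2 + z * (x + z))| ≤ 4 * W := fun r hr => by
      rw [abs_div, abs_of_pos hD, div_le_iff₀ hD]
      exact hr.trans hb
    refine ⟨(u * x + v * (x + z)) / (x ^ 2 + z * (x + z)), (v * x - u * z) /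
      (x ^ 2 + z * (x + z)), ?_, ?_, ?_, hc _ ?_, hc _ ?_⟩
    · field_simp; ring
    · field_simp; ring
    · field_simp; ring
    · rw [abs_le]; constructor <;> nlinarith
    · rw [abs_le]; constructor <;> nlinarith
  obtain ⟨P, Q, hP, hQ, hPQ⟩ := exists_round_pair s t
  have hr := cyclicRoots_ne_zero hρ0
  have hlog : ∀ i, Real.log (ε i * (cyclicRoots ρ i ^ (-P) * cyclicRoots ρ (i + 1) ^ (-Q))) =
      Real.log (ε i) - (P * logRoot ρ i + Q * logRoot ρ (i + 1)) := fun i => by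
    rw [Real.log_mul (hne i) (mul_ne_zero (zpow_ne_zero _ (hr _)) (zpow_ne_zero _ (hr _))),
      Real.log_mul (zpow_ne_zero _ (hr _)) (zpow_ne_zero _ (hr _)), Real.log_zpow, Real.log_zpow]
    unfold logRoot
    push_cast; ring
  refine ⟨P, Q, fun i => ε i * (cyclicRoots ρ i ^ (-P) * cyclicRoots ρ (i + 1) ^ (-Q)),
    mul_mem hε (mul_mem (cyclicRoots_zpow_mem hρ0 h (-P))
      (rotate_mem_conjRing' hρ0 h (cyclicRoots_zpow_mem hρ0 h (-Q)) 1)), ?_, ?_,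
    fun i => mul_ne_zero (hne i) (mul_ne_zero (zpow_ne_zero _ (hr _)) (zpow_ne_zero _ (hr _))),
    fun i => ?_, fun i => ?_⟩
  · rw [abs_le] at *; constructor <;> linarith
  · rw [abs_le] at *; constructor <;> linarith
  · rw [hlog, ← hl02]
    rw [abs_le] at hP hQ hPQ
    fin_cases i
    · change |Real.log (ε 0) - (P * logRoot ρ 0 + Q * logRoot ρ 1)| ≤ _
      rw [h0, hl1, abs_le]; constructor <;> nlinarith
    · change |Real.log (ε 1) - (P * logRoot ρ 1 + Q * logRoot ρ 2)| ≤ _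
      rw [h1, hl1, abs_le]; constructor <;> nlinarith
    · change |Real.log (ε 2) - (P * logRoot ρ 2 + Q * logRoot ρ 0)| ≤ _
      rw [h2, abs_le]; constructor <;> nlinarith
  · rw [hlog]; ring

end ReducedUnits

section RootGaps

variable {n : ℤ} {ρ : ℝ}

theorem forall_ne_fin_three {P : Fin 3 → Fin 3 → Prop} (hs : ∀ i j, P i j → P j i)
    (h01 : P 0 1) (h02 : P 0 2) (h12 : P 1 2) (i j : Fin 3) (hij : i ≠ j) : P i j := by
  fin_cases i <;> fin_cases j <;> first | exact absurd rfl hij | assumption | (apply hs; assumption)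

theorem one_div_le_logRoot_two (hρ : 1 < ρ) :
    Real.exp (-Real.log (1 + ρ)) ≤ logRoot ρ 2 ∧ logRoot ρ 2 ≤ 1 / ρ := by
  have h : logRoot ρ 2 = Real.log ((1 + ρ) / ρ) := by
    rw [logRoot, cyclicRoots_two, neg_div, Real.log_neg_eq_log]
  have hpos : 0 < (1 + ρ) / ρ := by positivity
  rw [h]
  constructor
  · have h1 := Real.one_sub_inv_le_log_of_pos hpos
    rw [Real.exp_neg, Real.exp_log (by linarith)]
    refine le_trans (le_of_eq ?_) h1
    rw [inv_div]
    field_simp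
    ring
  · refine (Real.log_le_sub_one_of_pos hpos).trans (le_of_eq ?_)
    field_simp
    ring

theorem log_one_add_le (hρ : 1 < ρ) : Real.log (1 + ρ) ≤ logRoot ρ 0 + Real.log 2 := by
  rw [logRoot_zero, ← Real.log_mul (by linarith) two_ne_zero]
  exact Real.log_le_log (by linarith) (by linarith)

theorem sub_log_two_le_abs_logRoot_sub (hρ : 1 < ρ) (i j : Fin 3) (hij : i ≠ j) :
    logRoot ρ 0 - Real.log 2 ≤ |logRoot ρ i - logRoot ρ j| := by
  have h1 := log_one_add_le hρ
  have h2 := logRoot_zero_add_two hρ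
  have h3 := logRoot_one_eq hρ
  have h4 := logRoot_pos hρ
  have h5 := Real.log_pos one_lt_two
  refine forall_ne_fin_three (P := fun i j => logRoot ρ 0 - Real.log 2 ≤
    |logRoot ρ i - logRoot ρ j|) (fun i j h => ?_) ?_ ?_ ?_ i j hij
  · rwa [abs_sub_comm]
  · exact le_trans (by linarith) (le_abs_self _)
  · exact le_trans (by linarith) (le_abs_self _)
  · exact le_trans (by linarith) (neg_le_abs _)

theorem one_div_ten_le_abs_logRoot_sub (hn : 0 ≤ n) (hρ : 1 < ρ) (h : fn n ρ = 0) (i j : Fin 3)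
    (hij : i ≠ j) : 1 / 10 ≤ |logRoot ρ i - logRoot ρ j| := by
  have h2 := logRoot_zero_add_two hρ
  have h3 := logRoot_one_eq hρ
  have h4 := logRoot_pos hρ
  have h5 := log_two_lt_log_one_add hρ
  have hρ0 : 0 < ρ := by linarith
  have key : ∀ u v : ℝ, 0 < u → 0 < v → 6 / 5 * u ≤ v → 1 / 10 ≤ Real.log v - Real.log u := by
    intro u v hu hv huv
    rw [← Real.log_div hv.ne' hu.ne']
    refine le_trans ?_ (Real.one_sub_inv_le_log_of_pos (div_pos hv hu))
    rw [inv_div]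
    have : u / v ≤ 5 / 6 := by rw [div_le_iff₀ hv]; linarith
    linarith
  refine forall_ne_fin_three (P := fun i j => 1 / 10 ≤ |logRoot ρ i - logRoot ρ j|)
    (fun i j h => ?_) ?_ ?_ ?_ i j hij
  · rwa [abs_sub_comm]
  · exact le_trans (by linarith) (le_abs_self _)
  · have e : logRoot ρ 0 - logRoot ρ 2 = Real.log (ρ ^ 2) - Real.log (1 + ρ) := by
      rw [← h2, Real.log_pow, logRoot_zero]; push_cast; ring
    rw [e]
    unfold fn at h
    rcases hn.eq_or_lt with hn0 | hn1
    · rw [← hn0] at h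
      push_cast at h
      have hlt : ρ < 5 / 4 := by
        by_contra! hge
        nlinarith [mul_nonneg (sub_nonneg.2 hge) (sub_nonneg.2 hge), mul_nonneg (mul_nonneg
          (sub_nonneg.2 hge) (sub_nonneg.2 hge)) (sub_nonneg.2 hge)]
      refine le_trans ?_ (neg_le_abs _)
      rw [neg_sub]
      exact key _ _ (by positivity) (by linarith) (by nlinarith)
    · have hn2 : (1 : ℝ) ≤ n := by exact_mod_cast hn1
      have hlt : 9 / 5 ≤ ρ := by
        by_contra! hge
        have : 0 ≤ (n - 1) * (ρ ^ 2 + ρ) := mul_nonneg (by linarith) (by positivity)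
        nlinarith [mul_pos (mul_pos hρ0 (by linarith : 0 < 9 / 5 - ρ))
          (by linarith : 0 < ρ + 9 / 5)]
      refine le_trans ?_ (le_abs_self _)
      exact key _ _ (by linarith) (by positivity) (by nlinarith)
  · exact le_trans (by linarith) (neg_le_abs _)

theorem abs_log_one_sub_le {r : ℝ} (hr : |r| ≤ 10 / 11) : |Real.log (1 - r)| ≤ 11 * |r| := by
  have h1 := neg_abs_le r
  have h2 := le_abs_self r
  have hpos : 0 < 1 - r := by linarith
  rw [abs_le]
  constructor
  · have h3 := Real.one_sub_inv_le_log_of_pos hpos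
    have h4 : (1 - r)⁻¹ ≤ 1 + 11 * |r| := by
      rw [inv_le_iff_one_le_mul₀ hpos]
      nlinarith [abs_nonneg r]
    linarith
  · have h3 := Real.log_le_sub_one_of_pos hpos
    linarith [abs_nonneg r]

theorem log_pow_sub_pow {u v κ : ℝ} {a : ℕ} (hu : u ≠ 0) (hv : v ≠ 0)
    (h : κ ≤ |Real.log u - Real.log v|) (hκ : 1 / 10 ≤ κ) (ha : 1 ≤ a) : u ^ a - v ^ a ≠ 0 ∧
      |Real.log (u ^ a - v ^ a) - a * max (Real.log u) (Real.log v)| ≤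
        11 * Real.exp (-(a * κ)) := by
  wlog huv : Real.log v ≤ Real.log u generalizing u v
  · obtain ⟨h1, h2⟩ := this hv hu (by rwa [abs_sub_comm]) (le_of_not_ge huv)
    refine ⟨fun h0 => h1 (by linarith), ?_⟩
    rwa [max_comm, ← Real.log_neg_eq_log, neg_sub]
  rw [abs_of_nonneg (sub_nonneg.2 huv)] at h
  rw [max_eq_left huv]
  have ha' : (1 : ℝ) ≤ a := by exact_mod_cast ha
  have hrne : (v / u) ^ a ≠ 0 := pow_ne_zero _ (div_ne_zero hv hu)
  have hr1 : |(v / u) ^ a| ≤ Real.exp (-(a * κ)) := by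
    rw [← Real.log_le_iff_le_exp (abs_pos.2 hrne), Real.log_abs, Real.log_pow,
      Real.log_div hv hu]
    nlinarith
  have hr2 : Real.exp (-(a * κ)) ≤ 10 / 11 := by
    have h1 : Real.exp (-(a * κ)) ≤ Real.exp (-(1 / 10)) := Real.exp_le_exp.2 (by nlinarith)
    have h2 := Real.add_one_le_exp (1 / 10 : ℝ)
    have h3 : Real.exp (-(1 / 10)) * Real.exp (1 / 10) = 1 := by rw [← Real.exp_add]; simp
    nlinarith [Real.exp_pos (-(1 / 10))]
  have hfac : u ^ a - v ^ a = u ^ a * (1 - (v / u) ^ a) := by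
    rw [div_pow]; field_simp
  have hne : 1 - (v / u) ^ a ≠ 0 := by
    have := le_abs_self ((v / u) ^ a)
    intro h0
    linarith
  refine ⟨by rw [hfac]; exact mul_ne_zero (pow_ne_zero _ hu) hne, ?_⟩
  rw [hfac, Real.log_mul (pow_ne_zero _ hu) hne, Real.log_pow, add_sub_cancel_left]
  exact (abs_log_one_sub_le (hr1.trans hr2)).trans (by linarith)

/-- For large `ρ`, an element of the order with all conjugates at most `(1 + ρ) ^ (2 / 3)` is a
rational integer. -/
theorem eq_const_of_mem_conjRing (hρ : 1100 ≤ ρ) (hρ0 : 0 < ρ) (h : fn n ρ = 0)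
    {η : Fin 3 → ℝ} (hη : η ∈ conjRing hρ0 h)
    (hb : ∀ i, |Real.log (η i)| ≤ 2 / 3 * Real.log (1 + ρ)) : ∀ i, η i = η 0 := by
  have hE : ∀ i, |η i| ≤ ρ / 10 := fun i => by
    rcases eq_or_ne (η i) 0 with h0 | h0
    · rw [h0, abs_zero]; positivity
    · have h1 : |η i| ^ 3 ≤ (ρ / 10) ^ 3 := by
        have h2 : |η i| ^ 3 ≤ (1 + ρ) ^ 2 := by
          rw [← Real.log_le_log_iff (by positivity) (by positivity), Real.log_pow, Real.log_pow,
            Real.log_abs]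
          have := (le_abs_self _).trans (hb i)
          push_cast
          linarith
        refine h2.trans ?_
        have : (1 + ρ) ^ 2 ≤ 1.1 * ρ ^ 2 := by nlinarith
        nlinarith [sq_nonneg ρ]
      exact le_of_pow_le_pow_left₀ (by norm_num) (by positivity) h1
  obtain ⟨A, B, C, hv⟩ := (mem_conjRing hρ0 h).1 hη
  have e0 := hv 0
  have e1 := hv 1
  have e2 := hv 2
  have hl0 : cyclicRoots ρ 0 = ρ := cyclicRoots_zero ρ
  have hl1 : -(1 / 100) ≤ cyclicRoots ρ 1 ∧ cyclicRoots ρ 1 ≤ 0 := by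
    rw [cyclicRoots_one, le_div_iff₀ (by linarith), div_le_iff₀ (by linarith)]
    constructor <;> linarith
  have hl2 : cyclicRoots ρ 2 ≤ -1 := by
    rw [cyclicRoots_two, div_le_iff₀ hρ0]
    linarith
  rw [hl0] at e0
  generalize cyclicRoots ρ 1 = l1 at *
  generalize cyclicRoots ρ 2 = l2 at *
  have hE0 := hE 0
  have hE1 := hE 1
  have hE2 := hE 2
  rw [abs_le] at hE0 hE1 hE2
  have hdiv : ∀ z l : ℝ, l ≤ 0 → |(ρ - l) * z| ≤ ρ / 5 → |z| ≤ 1 / 5 := by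
    intro z l hl hz
    rw [abs_mul, abs_of_pos (by linarith)] at hz
    by_contra! hlt
    nlinarith
  have f1 : |(B : ℝ) + C * (ρ + l1)| ≤ 1 / 5 := by
    apply hdiv _ l1 hl1.2
    have : (ρ - l1) * ((B : ℝ) + C * (ρ + l1)) = η 0 - η 1 := by rw [e0, e1]; ring
    rw [this, abs_le]; constructor <;> linarith
  have f2 : |(B : ℝ) + C * (ρ + l2)| ≤ 1 / 5 := by
    apply hdiv _ l2 (by linarith)
    have : (ρ - l2) * ((B : ℝ) + C * (ρ + l2)) = η 0 - η 2 := by rw [e0, e2]; ring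
    rw [this, abs_le]; constructor <;> linarith
  have hC : C = 0 := by
    rw [← Int.abs_lt_one_iff]
    have h1 : |(C : ℝ) * (l1 - l2)| ≤ 2 / 5 := by
      rw [abs_le] at *; constructor <;> linarith
    rw [abs_mul, abs_of_pos (by linarith : 0 < l1 - l2)] at h1
    have : |(C : ℝ)| < 1 := by
      by_contra! hge
      nlinarith
    exact_mod_cast this
  rw [hC] at f1 e0 hv
  have hB : B = 0 := by
    rw [← Int.abs_lt_one_iff]
    have : |(B : ℝ)| < 1 := by
      push_cast at f1
      rw [zero_mul, add_zero] at f1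
      linarith
    exact_mod_cast this
  intro i
  rw [hv, e0, hB]
  push_cast; ring

end RootGaps

section Solutions

/-- The conjugates `x - λᵗ ^ a y` of the linear factor of the form. -/
def conjForm (ρ : ℝ) (a : ℕ) (x y : ℤ) (t : Fin 3) : ℝ := x - cyclicRoots ρ t ^ a * y

/-- A nontrivial solution of the Thue equation, normalised so that `n` and `a` are nonnegative. -/
structure IsSolution (n : ℤ) (ρ : ℝ) (a : ℕ) (x y : ℤ) : Prop where
  n_nonneg : 0 ≤ n
  one_lt : 1 < ρ
  root : fn n ρ = 0
  one_le : 1 ≤ a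
  x_ne_zero : x ≠ 0
  y_ne_zero : y ≠ 0
  two_le : 2 ≤ |x| ∨ 2 ≤ |y|
  norm_eq_one : |conjForm ρ a x y 0 * conjForm ρ a x y 1 * conjForm ρ a x y 2| = 1

/-- The logarithmic size of a solution. -/
def logSize (ρ : ℝ) (a : ℕ) (y : ℤ) : ℝ := Real.log y + a * Real.log (1 + ρ)

/-- `i` is an index for which the conjugate is minimal. -/
def IsMinIndex (ρ : ℝ) (a : ℕ) (x y : ℤ) (i : Fin 3) : Prop :=
  ∀ j, |conjForm ρ a x y i| ≤ |conjForm ρ a x y j|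

theorem exists_isMinIndex (ρ : ℝ) (a : ℕ) (x y : ℤ) : ∃ i, IsMinIndex ρ a x y i := by
  obtain ⟨i, -, hi⟩ := Finset.exists_min_image Finset.univ (fun i => |conjForm ρ a x y i|)
    Finset.univ_nonempty
  exact ⟨i, fun j => hi j (Finset.mem_univ j)⟩

theorem fin_three_add_one_add_one (i : Fin 3) : i + 1 + 1 = i + 2 := by
  rw [add_assoc]; rfl

theorem fin_three_add_two_add_one (i : Fin 3) : i + 2 + 1 = i := by
  rw [add_assoc]; exact add_zero i

theorem fin_three_ne (i : Fin 3) : i ≠ i + 1 ∧ i ≠ i + 2 ∧ i + 1 ≠ i + 2 := by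
  fin_cases i <;> decide

theorem fin_three_sum (f : Fin 3 → ℝ) (i : Fin 3) :
    f 0 + f 1 + f 2 = f i + f (i + 1) + f (i + 2) := by
  fin_cases i
  · rfl
  · change _ = f 1 + f 2 + f 0
    ring
  · change _ = f 2 + f 0 + f 1
    ring

namespace IsSolution

variable {n : ℤ} {ρ : ℝ} {a : ℕ} {x y : ℤ}

theorem pos (hs : IsSolution n ρ a x y) : 0 < ρ := by linarith [hs.one_lt]

theorem one_le_cast (hs : IsSolution n ρ a x y) : (1 : ℝ) ≤ a := by exact_mod_cast hs.one_le

theorem conjForm_ne_zero (hs : IsSolution n ρ a x y) (t : Fin 3) : conjForm ρ a x y t ≠ 0 := by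
  have h := hs.norm_eq_one
  intro h0
  have : conjForm ρ a x y 0 * conjForm ρ a x y 1 * conjForm ρ a x y 2 = 0 := by
    fin_cases t
    · change conjForm ρ a x y 0 = 0 at h0
      rw [h0]; ring
    · change conjForm ρ a x y 1 = 0 at h0
      rw [h0]; ring
    · change conjForm ρ a x y 2 = 0 at h0
      rw [h0]; ring
  rw [this, abs_zero] at h
  exact zero_ne_one h

theorem sum_log (hs : IsSolution n ρ a x y) : Real.log (conjForm ρ a x y 0) +
    Real.log (conjForm ρ a x y 1) + Real.log (conjForm ρ a x y 2) = 0 := by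
  have h := hs.conjForm_ne_zero
  rw [← Real.log_mul (h 0) (h 1), ← Real.log_mul (mul_ne_zero (h 0) (h 1)) (h 2),
    ← Real.log_abs, hs.norm_eq_one, Real.log_one]

theorem sum_log_rotate (hs : IsSolution n ρ a x y) (i : Fin 3) :
    Real.log (conjForm ρ a x y i) + Real.log (conjForm ρ a x y (i + 1)) +
      Real.log (conjForm ρ a x y (i + 2)) = 0 := by
  rw [← hs.sum_log]
  exact (fin_three_sum (fun t => Real.log (conjForm ρ a x y t)) i).symm

theorem pow_mem (hs : IsSolution n ρ a x y) :
    (fun t => cyclicRoots ρ t ^ a) ∈ conjRing hs.pos hs.root :=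
  Subring.pow_mem _ (cyclicRoots_mem hs.pos hs.root) a

theorem conjForm_mem (hs : IsSolution n ρ a x y) :
    conjForm ρ a x y ∈ conjRing hs.pos hs.root := by
  have h : conjForm ρ a x y =
      ((x : ℤ) : Fin 3 → ℝ) - (fun t => cyclicRoots ρ t ^ a) * ((y : ℤ) : Fin 3 → ℝ) := by
    funext t
    simp [conjForm]
  rw [h]
  exact sub_mem (intCast_mem _ _) (mul_mem hs.pow_mem (intCast_mem _ _))

theorem log_y_nonneg (hs : IsSolution n ρ a x y) : 0 ≤ Real.log (y : ℝ) := by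
  rw [← Real.log_abs]
  have : (1 : ℝ) ≤ |(y : ℝ)| := by exact_mod_cast Int.one_le_abs hs.y_ne_zero
  exact Real.log_nonneg this

theorem le_logSize (hs : IsSolution n ρ a x y) : a * Real.log (1 + ρ) ≤ logSize ρ a y := by
  have := hs.log_y_nonneg
  unfold logSize
  linarith

theorem log_le_mul (hs : IsSolution n ρ a x y) : Real.log (1 + ρ) ≤ a * Real.log (1 + ρ) := by
  have h := log_two_lt_log_one_add hs.one_lt
  nlinarith [hs.one_le_cast]

/-- Logarithms of the differences of the powers of the roots. -/
theorem log_sub (hs : IsSolution n ρ a x y) {κ : ℝ} (hκ : 1 / 10 ≤ κ)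
    (hgap : ∀ i j, i ≠ j → κ ≤ |logRoot ρ i - logRoot ρ j|) {i j : Fin 3} (hij : i ≠ j) :
    cyclicRoots ρ i ^ a - cyclicRoots ρ j ^ a ≠ 0 ∧
      |Real.log (cyclicRoots ρ i ^ a - cyclicRoots ρ j ^ a) -
        a * max (logRoot ρ i) (logRoot ρ j)| ≤ 11 * Real.exp (-(a * κ)) :=
  log_pow_sub_pow (cyclicRoots_ne_zero hs.pos i) (cyclicRoots_ne_zero hs.pos j) (hgap i j hij) hκ
    hs.one_le

theorem log_sub_le (hs : IsSolution n ρ a x y) {i j : Fin 3} (hij : i ≠ j) :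
    cyclicRoots ρ i ^ a - cyclicRoots ρ j ^ a ≠ 0 ∧
      |Real.log (cyclicRoots ρ i ^ a - cyclicRoots ρ j ^ a) -
        a * max (logRoot ρ i) (logRoot ρ j)| ≤ 11 := by
  obtain ⟨h1, h2⟩ := hs.log_sub le_rfl (one_div_ten_le_abs_logRoot_sub hs.n_nonneg hs.one_lt
    hs.root) hij
  refine ⟨h1, h2.trans ?_⟩
  have : Real.exp (-(a * (1 / 10 : ℝ))) ≤ 1 := Real.exp_le_one_iff.2 (by
    have := hs.one_le_cast
    linarith)
  linarith

theorem abs_pow_le (hs : IsSolution n ρ a x y) (t : Fin 3) :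
    |cyclicRoots ρ t ^ a| ≤ Real.exp (a * Real.log (1 + ρ)) := by
  rw [abs_pow, Real.exp_nat_mul]
  exact pow_le_pow_left₀ (abs_nonneg _) (abs_cyclicRoots_le hs.one_lt t) a

theorem log_le_zero (hs : IsSolution n ρ a x y) {i : Fin 3} (hi : IsMinIndex ρ a x y i) :
    Real.log (conjForm ρ a x y i) ≤ 0 := by
  have h := hs.sum_log_rotate i
  have h1 : ∀ j, Real.log (conjForm ρ a x y i) ≤ Real.log (conjForm ρ a x y j) := fun j => by
    rw [← Real.log_abs, ← Real.log_abs (conjForm ρ a x y j)]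
    exact Real.log_le_log (abs_pos.2 (hs.conjForm_ne_zero i)) (hi j)
  linarith [h1 (i + 1), h1 (i + 2)]

theorem abs_conjForm_le_one (hs : IsSolution n ρ a x y) {i : Fin 3} (hi : IsMinIndex ρ a x y i) :
    |conjForm ρ a x y i| ≤ 1 := by
  have h := hs.log_le_zero hi
  rw [← Real.log_abs] at h
  exact (Real.log_nonpos_iff (abs_nonneg _)).1 h

theorem le_log_conjForm (hs : IsSolution n ρ a x y) {i j : Fin 3} (hi : IsMinIndex ρ a x y i)
    (hij : i ≠ j) : Real.log (y : ℝ) +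
      Real.log (cyclicRoots ρ i ^ a - cyclicRoots ρ j ^ a) - Real.log 2 ≤
        Real.log (conjForm ρ a x y j) := by
  have h1 := (hs.log_sub_le hij).1
  have hy : (y : ℝ) ≠ 0 := by exact_mod_cast hs.y_ne_zero
  rw [← Real.log_mul hy h1, sub_le_iff_le_add,
    ← Real.log_mul (hs.conjForm_ne_zero j) two_ne_zero, ← Real.log_abs,
    ← Real.log_abs (conjForm ρ a x y j * 2)]
  refine Real.log_le_log (abs_pos.2 (mul_ne_zero hy h1)) ?_
  have e : (y : ℝ) * (cyclicRoots ρ i ^ a - cyclicRoots ρ j ^ a) =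
      conjForm ρ a x y j - conjForm ρ a x y i := by unfold conjForm; ring
  rw [e, abs_mul, abs_two]
  have := abs_sub (conjForm ρ a x y j) (conjForm ρ a x y i)
  linarith [hi j]

theorem abs_x_le (hs : IsSolution n ρ a x y) : |(x : ℝ)| ≤ 2 * Real.exp (logSize ρ a y) := by
  obtain ⟨i, hi⟩ := exists_isMinIndex ρ a x y
  have h1 := hs.abs_conjForm_le_one hi
  have h2 := hs.abs_pow_le i
  have hy : Real.exp (Real.log (y : ℝ)) = |(y : ℝ)| :=
    Real.exp_log_eq_abs (by exact_mod_cast hs.y_ne_zero)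
  have e : (x : ℝ) = conjForm ρ a x y i + cyclicRoots ρ i ^ a * y := by unfold conjForm; ring
  have h3 : |(x : ℝ)| ≤ 1 + Real.exp (logSize ρ a y) := by
    rw [e]
    refine (abs_add_le _ _).trans (add_le_add h1 ?_)
    rw [logSize, add_comm, Real.exp_add, hy, abs_mul]
    gcongr
  have h4 : 1 ≤ Real.exp (logSize ρ a y) := Real.one_le_exp (by
    have := log_two_lt_log_one_add hs.one_lt
    linarith [hs.le_logSize, hs.log_le_mul])
  linarith

theorem abs_log_le (hs : IsSolution n ρ a x y) (t : Fin 3) :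
    |Real.log (conjForm ρ a x y t)| ≤ 8 * logSize ρ a y := by
  have hS : 2 / 3 ≤ logSize ρ a y := by
    have := log_two_lt_log_one_add hs.one_lt
    linarith [hs.le_logSize, hs.log_le_mul]
  have hy : Real.exp (Real.log (y : ℝ)) = |(y : ℝ)| :=
    Real.exp_log_eq_abs (by exact_mod_cast hs.y_ne_zero)
  have hu : ∀ t, Real.log (conjForm ρ a x y t) ≤ 2 + logSize ρ a y := fun t => by
    rw [← Real.log_abs, Real.log_le_iff_le_exp (abs_pos.2 (hs.conjForm_ne_zero t)), Real.exp_add]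
    have h2 := hs.abs_pow_le t
    have h3 : |cyclicRoots ρ t ^ a * y| ≤ Real.exp (logSize ρ a y) := by
      rw [logSize, add_comm, Real.exp_add, hy, abs_mul]
      gcongr
    have h4 := abs_sub (x : ℝ) (cyclicRoots ρ t ^ a * y)
    have h5 := hs.abs_x_le
    have h6 : (3 : ℝ) ≤ Real.exp 2 := by linarith [Real.add_one_le_exp (2 : ℝ)]
    unfold conjForm
    nlinarith [Real.exp_pos (logSize ρ a y)]
  have h := hs.sum_log_rotate t
  have h0 := hu t
  have h1 := hu (t + 1)
  have h2 := hu (t + 2)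
  rw [abs_le]
  constructor <;> linarith

/-- The linear form in logarithms attached to the Siegel identity. -/
def _root_.siegelLog (ρ : ℝ) (a : ℕ) (x y : ℤ) (i : Fin 3) : ℝ :=
  Real.log (conjForm ρ a x y (i + 1)) +
    Real.log (cyclicRoots ρ i ^ a - cyclicRoots ρ (i + 2) ^ a) -
    Real.log (conjForm ρ a x y (i + 2)) -
    Real.log (cyclicRoots ρ i ^ a - cyclicRoots ρ (i + 1) ^ a)

theorem siegelLog_bound (hs : IsSolution n ρ a x y) {i : Fin 3} (hi : IsMinIndex ρ a x y i) {X : ℝ}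
    (hX : 58 - 3 * Real.log (y : ℝ) + a * (max (logRoot ρ (i + 1)) (logRoot ρ (i + 2)) -
      2 * max (logRoot ρ i) (logRoot ρ (i + 1)) - 2 * max (logRoot ρ i) (logRoot ρ (i + 2))) ≤ X)
    (hX1 : X ≤ -1) :
    siegelLog ρ a x y i ≠ 0 ∧ |siegelLog ρ a x y i| ≤ 11 * Real.exp X := by
  obtain ⟨n01, n02, n12⟩ := fin_three_ne i
  obtain ⟨d01, b01⟩ := hs.log_sub_le n01
  obtain ⟨d02, b02⟩ := hs.log_sub_le n02
  obtain ⟨d12, b12⟩ := hs.log_sub_le n12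
  have l1 := hs.le_log_conjForm hi n01
  have l2 := hs.le_log_conjForm hi n02
  have hsum := hs.sum_log_rotate i
  have e0 := hs.conjForm_ne_zero i
  have e1 := hs.conjForm_ne_zero (i + 1)
  have e2 := hs.conjForm_ne_zero (i + 2)
  have hid : conjForm ρ a x y (i + 1) * (cyclicRoots ρ i ^ a - cyclicRoots ρ (i + 2) ^ a) -
      conjForm ρ a x y (i + 2) * (cyclicRoots ρ i ^ a - cyclicRoots ρ (i + 1) ^ a) =
      conjForm ρ a x y i * (cyclicRoots ρ (i + 1) ^ a - cyclicRoots ρ (i + 2) ^ a) := by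
    unfold conjForm; ring
  unfold siegelLog
  generalize conjForm ρ a x y i = ε0 at *
  generalize conjForm ρ a x y (i + 1) = ε1 at *
  generalize conjForm ρ a x y (i + 2) = ε2 at *
  generalize cyclicRoots ρ i ^ a - cyclicRoots ρ (i + 1) ^ a = a01 at *
  generalize cyclicRoots ρ i ^ a - cyclicRoots ρ (i + 2) ^ a = a02 at *
  generalize cyclicRoots ρ (i + 1) ^ a - cyclicRoots ρ (i + 2) ^ a = a12 at *
  rw [abs_le] at b01 b02 b12
  obtain ⟨r, hr⟩ : ∃ r, r = -(ε0 * a12 / (ε2 * a01)) := ⟨_, rfl⟩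
  have hr0 : r ≠ 0 := by rw [hr]; exact neg_ne_zero.2 (by positivity)
  have hlog2 := Real.log_two_lt_d9
  have hlogr : Real.log r ≤ X := by
    rw [hr, Real.log_neg_eq_log, Real.log_div (by positivity) (by positivity),
      Real.log_mul e0 d12, Real.log_mul e2 d01]
    refine le_trans ?_ hX
    rw [mul_sub, mul_sub]
    linarith
  have hrX : |r| ≤ Real.exp X := by
    rwa [← Real.log_le_iff_le_exp (abs_pos.2 hr0), Real.log_abs]
  have hr1 : |r| ≤ 10 / 11 := by
    have h1 := Real.exp_le_exp.2 hX1
    have h2 := Real.exp_neg_one_lt_d9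
    linarith
  have hfac : ε1 * a02 = ε2 * a01 * (1 - r) := by
    rw [hr]
    field_simp
    linarith
  have h1r : 1 - r ≠ 0 := by
    have := le_abs_self r
    intro h0
    linarith
  have hΛ : Real.log ε1 + Real.log a02 - Real.log ε2 - Real.log a01 = Real.log (1 - r) := by
    have h1 := congrArg Real.log hfac
    rw [Real.log_mul e1 d02, Real.log_mul (by positivity) h1r, Real.log_mul e2 d01] at h1
    linarith
  rw [hΛ]
  refine ⟨?_, (abs_log_one_sub_le hr1).trans (by linarith)⟩
  have hpos : 0 < 1 - r := by linarith [le_abs_self r]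
  intro h0
  rcases Real.log_eq_zero.1 h0 with h | h | h <;> first | linarith | exact hr0 (by linarith)

theorem _root_.max_logRoot_le {ρ : ℝ} (hρ : 1 < ρ) (i : Fin 3) :
    max (logRoot ρ (i + 1)) (logRoot ρ (i + 2)) - 2 * max (logRoot ρ i) (logRoot ρ (i + 1)) -
      2 * max (logRoot ρ i) (logRoot ρ (i + 2)) ≤ -Real.log (1 + ρ) ∧
    Real.log (1 + ρ) ≤ max (logRoot ρ i) (logRoot ρ (i + 1)) +
      max (logRoot ρ i) (logRoot ρ (i + 2)) := by
  have h1 := logRoot_one_eq hρ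
  have h2 := logRoot_zero_add_two hρ
  obtain ⟨h3, h4⟩ := logRoot_pos hρ
  rw [← h2]
  fin_cases i
  · change max (logRoot ρ 1) (logRoot ρ 2) - 2 * max (logRoot ρ 0) (logRoot ρ 1) -
      2 * max (logRoot ρ 0) (logRoot ρ 2) ≤ _ ∧ _ ≤ max (logRoot ρ 0) (logRoot ρ 1) +
      max (logRoot ρ 0) (logRoot ρ 2)
    rw [max_eq_right (by linarith : logRoot ρ 1 ≤ logRoot ρ 2),
      max_eq_left (by linarith : logRoot ρ 1 ≤ logRoot ρ 0)]
    have h5 := le_max_left (logRoot ρ 0) (logRoot ρ 2)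
    have h6 := le_max_right (logRoot ρ 0) (logRoot ρ 2)
    constructor <;> linarith
  · change max (logRoot ρ 2) (logRoot ρ 0) - 2 * max (logRoot ρ 1) (logRoot ρ 2) -
      2 * max (logRoot ρ 1) (logRoot ρ 0) ≤ _ ∧ _ ≤ max (logRoot ρ 1) (logRoot ρ 2) +
      max (logRoot ρ 1) (logRoot ρ 0)
    rw [max_eq_right (by linarith : logRoot ρ 1 ≤ logRoot ρ 2),
      max_eq_right (by linarith : logRoot ρ 1 ≤ logRoot ρ 0)]
    have h5 : max (logRoot ρ 2) (logRoot ρ 0) ≤ logRoot ρ 2 + logRoot ρ 0 :=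
      max_le (by linarith) (by linarith)
    constructor <;> linarith
  · change max (logRoot ρ 0) (logRoot ρ 1) - 2 * max (logRoot ρ 2) (logRoot ρ 0) -
      2 * max (logRoot ρ 2) (logRoot ρ 1) ≤ _ ∧ _ ≤ max (logRoot ρ 2) (logRoot ρ 0) +
      max (logRoot ρ 2) (logRoot ρ 1)
    rw [max_eq_left (by linarith : logRoot ρ 1 ≤ logRoot ρ 2),
      max_eq_left (by linarith : logRoot ρ 1 ≤ logRoot ρ 0)]
    have h5 := le_max_left (logRoot ρ 2) (logRoot ρ 0)
    have h6 := le_max_right (logRoot ρ 2) (logRoot ρ 0)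
    constructor <;> linarith

theorem siegelLog_le (hs : IsSolution n ρ a x y) {i : Fin 3} (hi : IsMinIndex ρ a x y i)
    (hS : 59 ≤ logSize ρ a y) : siegelLog ρ a x y i ≠ 0 ∧
      |siegelLog ρ a x y i| ≤ Real.exp (68 - logSize ρ a y) := by
  have h1 := (max_logRoot_le hs.one_lt i).1
  have h2 := hs.log_y_nonneg
  have h3 := hs.one_le_cast
  obtain ⟨h4, h5⟩ := hs.siegelLog_bound hi (X := 58 - logSize ρ a y) (by
    unfold logSize
    nlinarith) (by linarith)
  refine ⟨h4, h5.trans ?_⟩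
  rw [show 68 - logSize ρ a y = 10 + (58 - logSize ρ a y) by ring, Real.exp_add 10]
  have := Real.add_one_le_exp (10 : ℝ)
  nlinarith [Real.exp_pos (58 - logSize ρ a y)]

end IsSolution

end Solutions

section ReducedLog

/-- The linear form in logarithms obtained from `siegelLog` by keeping the dominant term of each
difference of powers. -/
def dominantLog (ρ : ℝ) (a : ℕ) (x y : ℤ) (i : Fin 3) : ℝ :=
  Real.log (conjForm ρ a x y (i + 1)) - Real.log (conjForm ρ a x y (i + 2)) +
    a * (max (logRoot ρ i) (logRoot ρ (i + 2)) - max (logRoot ρ i) (logRoot ρ (i + 1)))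

theorem eq_zero_of_rotate_eq {f : Fin 3 → ℝ} (hf : ∀ t, f t = f (t + 1))
    (hsum : f 0 + f 1 + f 2 = 0) (t : Fin 3) : f t = 0 := by
  have h0 : f 0 = f 1 := hf 0
  have h1 : f 1 = f 2 := hf 1
  fin_cases t
  · change f 0 = 0
    linarith
  · change f 1 = 0
    linarith
  · change f 2 = 0
    linarith

theorem exists_ne_eq_of_sign {g : Fin 3 → ℝ} (hg : ∀ t, g t = 1 ∨ g t = -1) :
    ∃ s t, s ≠ t ∧ g s = g t := by
  rcases hg 0 with h0 | h0 <;> rcases hg 1 with h1 | h1 <;> rcases hg 2 with h2 | h2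
  · exact ⟨0, 1, by decide, h0.trans h1.symm⟩
  · exact ⟨0, 1, by decide, h0.trans h1.symm⟩
  · exact ⟨0, 2, by decide, h0.trans h2.symm⟩
  · exact ⟨1, 2, by decide, h1.trans h2.symm⟩
  · exact ⟨1, 2, by decide, h1.trans h2.symm⟩
  · exact ⟨0, 2, by decide, h0.trans h2.symm⟩
  · exact ⟨0, 1, by decide, h0.trans h1.symm⟩
  · exact ⟨0, 1, by decide, h0.trans h1.symm⟩

theorem exists_max_logRoot_comb {ρ : ℝ} (hρ : 1 < ρ) (i : Fin 3) : ∃ p q : ℤ, |(p : ℝ)| ≤ 2 ∧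
    |(q : ℝ)| ≤ 2 ∧ max (logRoot ρ i) (logRoot ρ (i + 2)) -
      max (logRoot ρ i) (logRoot ρ (i + 1)) = p * logRoot ρ i + q * logRoot ρ (i + 1) := by
  rw [logRoot_add_two hρ]
  rcases max_choice (logRoot ρ i) (-(logRoot ρ i + logRoot ρ (i + 1))) with h1 | h1 <;>
    rcases max_choice (logRoot ρ i) (logRoot ρ (i + 1)) with h2 | h2 <;> rw [h1, h2]
  · exact ⟨0, 0, by norm_num, by norm_num, by push_cast; ring⟩
  · exact ⟨1, -1, by norm_num, by norm_num, by push_cast; ring⟩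
  · exact ⟨-2, -1, by norm_num, by norm_num, by push_cast; ring⟩
  · exact ⟨-1, -2, by norm_num, by norm_num, by push_cast; ring⟩

namespace IsSolution

variable {n : ℤ} {ρ : ℝ} {a : ℕ} {x y : ℤ}

theorem two_thirds_le (hs : IsSolution n ρ a x y) : 2 / 3 * (a : ℝ) ≤ logSize ρ a y := by
  have := log_two_lt_log_one_add hs.one_lt
  have h1 := hs.le_logSize
  have h2 := hs.one_le_cast
  nlinarith

theorem rotate_mem (hs : IsSolution n ρ a x y) ⦃v : Fin 3 → ℝ⦄ (hv : v ∈ conjRing hs.pos hs.root)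
    (j : Fin 3) : (fun t => v (t + j)) ∈ conjRing hs.pos hs.root :=
  rotate_mem_conjRing' hs.pos hs.root hv j

/-- The decomposition of the quotient of two conjugates, with a reduced unit. -/
theorem exists_decomposition (hs : IsSolution n ρ a x y) (hS : 59 ≤ logSize ρ a y) (i : Fin 3) :
    ∃ p q : ℤ, ∃ η ∈ conjRing hs.pos hs.root, |(p : ℝ)| ≤ 99 * logSize ρ a y ∧
      |(q : ℝ)| ≤ 99 * logSize ρ a y ∧ (∀ t, η t ≠ 0) ∧
      (∀ t, |Real.log (η t)| ≤ 2 / 3 * Real.log (1 + ρ)) ∧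
      Real.log (conjForm ρ a x y (i + 1)) - Real.log (conjForm ρ a x y (i + 2)) =
        p * logRoot ρ i + q * logRoot ρ (i + 1) +
          (Real.log (η (i + 1)) - Real.log (η (i + 2))) := by
  obtain ⟨P, Q, η, hη, hP, hQ, hne, hlog, h⟩ := exists_reduced_unit hs.one_lt hs.pos hs.root
    hs.conjForm_mem hs.conjForm_ne_zero hs.sum_log hs.abs_log_le
  refine ⟨P - 2 * Q, 2 * P - Q, η, hη, ?_, ?_, hne, hlog, ?_⟩
  · rw [abs_le] at *
    push_cast
    constructor <;> linarith
  · rw [abs_le] at *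
    push_cast
    constructor <;> linarith
  · rw [h, h, fin_three_add_one_add_one, fin_three_add_two_add_one, logRoot_add_two hs.one_lt]
    push_cast
    ring

theorem exp_neg_lt_siegelLog (hs : IsSolution n ρ a x y) (hS : 59 ≤ logSize ρ a y) {i : Fin 3}
    (hi : IsMinIndex ρ a x y i) :
    Real.exp (-(21000 * (3 * (a * Real.log (1 + ρ)) + Real.log (212 * logSize ρ a y))) ^ 50) <
      |siegelLog ρ a x y i| := by
  obtain ⟨p, q, η, hη, hp, hq, hne, hlog, h⟩ := hs.exists_decomposition hS i
  obtain ⟨n01, n02, -⟩ := fin_three_ne i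
  have d01 := (hs.log_sub_le n01).1
  have d02 := (hs.log_sub_le n02).1
  have hH := log_two_lt_log_one_add hs.one_lt
  have haH := hs.log_le_mul
  have hsize : ∀ r s t, |η r * (cyclicRoots ρ s ^ a - cyclicRoots ρ t ^ a)| ≤
      Real.exp (3 * (a * Real.log (1 + ρ))) := fun r s t => by
    have h1 : |η r| ≤ Real.exp (2 / 3 * Real.log (1 + ρ)) := by
      rw [← Real.log_le_iff_le_exp (abs_pos.2 (hne r)), Real.log_abs]
      exact (le_abs_self _).trans (hlog r)
    have h2 : |cyclicRoots ρ s ^ a - cyclicRoots ρ t ^ a| ≤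
        Real.exp (Real.log 2 + a * Real.log (1 + ρ)) := by
      rw [Real.exp_add, Real.exp_log two_pos]
      refine (abs_sub _ _).trans ?_
      linarith [hs.abs_pow_le s, hs.abs_pow_le t]
    rw [abs_mul]
    refine (mul_le_mul h1 h2 (abs_nonneg _) (Real.exp_pos _).le).trans ?_
    rw [← Real.exp_add]
    apply Real.exp_le_exp.2
    linarith [Real.log_two_lt_d9]
  have hrot := hs.rotate_mem
  have key := eq_zero_or_exp_neg_pow_lt_rotate hs.one_lt hs.pos hs.root
    (U := fun t => η (t + 1) * (cyclicRoots ρ t ^ a - cyclicRoots ρ (t + 2) ^ a))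
    (V := fun t => η (t + 2) * (cyclicRoots ρ t ^ a - cyclicRoots ρ (t + 1) ^ a))
    (mul_mem (hrot hη 1) (sub_mem hs.pow_mem (hrot hs.pow_mem 2)))
    (mul_mem (hrot hη 2) (sub_mem hs.pow_mem (hrot hs.pow_mem 1)))
    (g := 3 * (a * Real.log (1 + ρ))) (B := 106 * logSize ρ a y) (by linarith)
    (fun t => hsize _ _ _) (fun t => hsize _ _ _) (i := i) (mul_ne_zero (hne _) d02)
    (mul_ne_zero (hne _) d01) (by linarith) (hp.trans (by linarith)) (hq.trans (by linarith))
    (Λ := siegelLog ρ a x y i) (by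
      rw [Real.log_mul (hne _) d02, Real.log_mul (hne _) d01]
      unfold siegelLog
      linarith)
  rw [show 2 * (106 * logSize ρ a y) = 212 * logSize ρ a y by ring] at key
  exact key.resolve_left (hs.siegelLog_le hi hS).1

theorem dominantLog_eq_zero_or (hs : IsSolution n ρ a x y) (hS : 59 ≤ logSize ρ a y) (i : Fin 3) :
    dominantLog ρ a x y i = 0 ∨
    Real.exp (-(21000 * (Real.log (1 + ρ) + Real.log (212 * logSize ρ a y))) ^ 50) <
      |dominantLog ρ a x y i| := by
  obtain ⟨p, q, η, hη, hp, hq, hne, hlog, h⟩ := hs.exists_decomposition hS i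
  obtain ⟨p', q', hp', hq', hmax⟩ := exists_max_logRoot_comb hs.one_lt i
  have hH := log_two_lt_log_one_add hs.one_lt
  have hsize : ∀ r, |η r| ≤ Real.exp (Real.log (1 + ρ)) := fun r => by
    rw [← Real.log_le_iff_le_exp (abs_pos.2 (hne r)), Real.log_abs]
    exact (le_abs_self _).trans ((hlog r).trans (by linarith))
  have hrot := hs.rotate_mem
  have ha := hs.two_thirds_le
  have ha1 := hs.one_le_cast
  have hcoef : ∀ r r' : ℤ, |(r : ℝ)| ≤ 99 * logSize ρ a y → |(r' : ℝ)| ≤ 2 →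
      |((r + a * r' : ℤ) : ℝ)| ≤ 106 * logSize ρ a y := fun r r' hr hr' => by
    push_cast
    refine (abs_add_le _ _).trans ?_
    rw [abs_mul, Nat.abs_cast]
    nlinarith
  have key := eq_zero_or_exp_neg_pow_lt_rotate hs.one_lt hs.pos hs.root
    (U := fun t => η (t + 1)) (V := fun t => η (t + 2)) (hrot hη 1) (hrot hη 2) le_rfl
    (B := 106 * logSize ρ a y) (fun t => hsize _) (fun t => hsize _) (i := i) (hne _) (hne _)
    (by linarith) (hcoef p p' hp hp') (hcoef q q' hq hq')
    (Λ := dominantLog ρ a x y i) (by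
      unfold dominantLog
      rw [h, hmax]
      push_cast
      ring)
  rwa [show 2 * (106 * logSize ρ a y) = 212 * logSize ρ a y by ring] at key

/-- Conjugating a multiplicative relation between the conjugates and the roots. -/
theorem log_add_eq_of_eq (hs : IsSolution n ρ a x y) {i σ τ : Fin 3}
    (h : Real.log (conjForm ρ a x y (i + 1)) + a * logRoot ρ (i + σ) =
      Real.log (conjForm ρ a x y (i + 2)) + a * logRoot ρ (i + τ)) (t : Fin 3) :
    Real.log (conjForm ρ a x y (t + 1)) + a * logRoot ρ (t + σ) =
      Real.log (conjForm ρ a x y (t + 2)) + a * logRoot ρ (t + τ) := by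
  have hrot := hs.rotate_mem
  have hne := hs.conjForm_ne_zero
  have hr : ∀ s, cyclicRoots ρ s ^ a ≠ 0 := fun s => pow_ne_zero _ (cyclicRoots_ne_zero hs.pos s)
  have hlog : ∀ r s, Real.log (conjForm ρ a x y r * cyclicRoots ρ s ^ a) =
      Real.log (conjForm ρ a x y r) + a * logRoot ρ s := fun r s => by
    rw [Real.log_mul (hne r) (hr s), Real.log_pow]
    rfl
  rw [← hlog, ← hlog] at h ⊢
  have hz : (fun t => conjForm ρ a x y (t + 1) * cyclicRoots ρ (t + σ) ^ a) *
      (fun t => conjForm ρ a x y (t + 1) * cyclicRoots ρ (t + σ) ^ a) -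
      (fun t => conjForm ρ a x y (t + 2) * cyclicRoots ρ (t + τ) ^ a) *
      (fun t => conjForm ρ a x y (t + 2) * cyclicRoots ρ (t + τ) ^ a) = 0 := by
    have m1 : (fun t => conjForm ρ a x y (t + 1) * cyclicRoots ρ (t + σ) ^ a) ∈
        conjRing hs.pos hs.root := mul_mem (hrot hs.conjForm_mem 1) (hrot hs.pow_mem σ)
    have m2 : (fun t => conjForm ρ a x y (t + 2) * cyclicRoots ρ (t + τ) ^ a) ∈
        conjRing hs.pos hs.root := mul_mem (hrot hs.conjForm_mem 2) (hrot hs.pow_mem τ)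
    refine eq_zero_of_apply_eq_zero hs.pos hs.root
      (sub_mem (mul_mem m1 m1) (mul_mem m2 m2)) (i := i) ?_
    rw [← Real.log_abs, ← Real.log_abs (_ * cyclicRoots ρ (i + τ) ^ a)] at h
    have h1 := Real.log_injOn_pos (Set.mem_Ioi.2 (abs_pos.2 (mul_ne_zero (hne _) (hr _))))
      (Set.mem_Ioi.2 (abs_pos.2 (mul_ne_zero (hne _) (hr _)))) h
    exact sub_eq_zero.2 (abs_eq_iff_mul_self_eq.1 h1)
  have h2 := abs_eq_iff_mul_self_eq.2 (sub_eq_zero.1 (congrFun hz t))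
  rw [← Real.log_abs, ← Real.log_abs (_ * cyclicRoots ρ (t + τ) ^ a)]
  exact congrArg Real.log h2

theorem not_forall_log_eq_zero (hs : IsSolution n ρ a x y) :
    ¬ ∀ t, Real.log (conjForm ρ a x y t) = 0 := by
  intro h
  have hsign : ∀ t, conjForm ρ a x y t = 1 ∨ conjForm ρ a x y t = -1 := fun t =>
    (Real.log_eq_zero.1 (h t)).resolve_left (hs.conjForm_ne_zero t)
  obtain ⟨s, t, hst, h1⟩ := exists_ne_eq_of_sign hsign
  have hd := (hs.log_sub_le hst).1
  unfold conjForm at h1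
  have h2 : (cyclicRoots ρ s ^ a - cyclicRoots ρ t ^ a) * y = 0 := by linarith
  exact hs.y_ne_zero (by exact_mod_cast (mul_eq_zero.1 h2).resolve_left hd)

theorem not_forall_log_eq_mul (hs : IsSolution n ρ a x y) :
    ¬ ∀ t, Real.log (conjForm ρ a x y t) = a * logRoot ρ t := by
  intro h
  have hr : ∀ s, cyclicRoots ρ s ^ a ≠ 0 := fun s => pow_ne_zero _ (cyclicRoots_ne_zero hs.pos s)
  have hsign : ∀ t, conjForm ρ a x y t / cyclicRoots ρ t ^ a = 1 ∨
      conjForm ρ a x y t / cyclicRoots ρ t ^ a = -1 := fun t => by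
    refine (Real.log_eq_zero.1 ?_).resolve_left (div_ne_zero (hs.conjForm_ne_zero t) (hr t))
    rw [Real.log_div (hs.conjForm_ne_zero t) (hr t), h, Real.log_pow]
    exact sub_self _
  obtain ⟨s, t, hst, h1⟩ := exists_ne_eq_of_sign hsign
  have hd := (hs.log_sub_le hst).1
  unfold conjForm at h1
  rw [div_eq_div_iff (hr s) (hr t)] at h1
  have h2 : (cyclicRoots ρ s ^ a - cyclicRoots ρ t ^ a) * x = 0 := by linarith
  exact hs.x_ne_zero (by exact_mod_cast (mul_eq_zero.1 h2).resolve_left hd)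

theorem dominantLog_ne_zero (hs : IsSolution n ρ a x y) {i : Fin 3}
    (hi : IsMinIndex ρ a x y i) : dominantLog ρ a x y i ≠ 0 := by
  intro h
  have hρ := hs.one_lt
  have hmin := hs.log_le_zero hi
  have hsum := hs.sum_log
  have ha := hs.one_le_cast
  have hl := logRoot_add_two hρ
  have hl012 : logRoot ρ 0 + logRoot ρ 1 + logRoot ρ 2 = 0 := by
    have := logRoot_one_eq hρ
    linarith
  obtain ⟨n01, n02, n12⟩ := fin_three_ne i
  have gap : ∀ s t, s ≠ t → logRoot ρ s ≠ logRoot ρ t := fun s t hst heq => by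
    have := one_div_ten_le_abs_logRoot_sub hs.n_nonneg hρ hs.root s t hst
    rw [heq, sub_self, abs_zero] at this
    linarith
  have g01 := gap _ _ n01
  have g02 := gap _ _ n02
  unfold dominantLog at h
  rcases le_total (logRoot ρ (i + 2)) (logRoot ρ i) with h1 | h1 <;>
    rcases le_total (logRoot ρ (i + 1)) (logRoot ρ i) with h2 | h2
  · rw [max_eq_left h1, max_eq_left h2] at h
    have hall := hs.log_add_eq_of_eq (i := i) (σ := 0) (τ := 0) (by linarith)
    refine hs.not_forall_log_eq_zero (eq_zero_of_rotate_eq (fun t => ?_) hsum)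
    have := hall (t + 2)
    rw [fin_three_add_two_add_one, add_assoc t 2 2] at this
    change _ + _ = Real.log (conjForm ρ a x y (t + 1)) + _ at this
    linarith
  · rw [max_eq_left h1, max_eq_right h2] at h
    have hall := hs.log_add_eq_of_eq (i := i) (σ := 0) (τ := 1) (by rw [add_zero]; linarith)
    have hf := eq_zero_of_rotate_eq
      (f := fun t => Real.log (conjForm ρ a x y (t + 1)) + a * logRoot ρ t) (fun t => by
        have := hall t
        rw [add_zero] at this
        rw [fin_three_add_one_add_one]
        exact this) (by
        change Real.log (conjForm ρ a x y 1) + a * logRoot ρ 0 +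
          (Real.log (conjForm ρ a x y 2) + a * logRoot ρ 1) +
          (Real.log (conjForm ρ a x y 0) + a * logRoot ρ 2) = 0
        linear_combination hsum + a * hl012) (i + 2)
    simp only [fin_three_add_two_add_one] at hf
    have h3 := lt_of_le_of_ne h2 g01
    have h4 := hl i
    have h5 : logRoot ρ (i + 2) < 0 := by linarith
    nlinarith
  · rw [max_eq_right h1, max_eq_left h2] at h
    have hall := hs.log_add_eq_of_eq (i := i) (σ := 2) (τ := 0) (by rw [add_zero]; linarith)
    have hf := eq_zero_of_rotate_eq
      (f := fun t => Real.log (conjForm ρ a x y (t + 1)) + a * logRoot ρ (t + 2)) (fun t => by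
        have := hall t
        rw [add_zero] at this
        rw [fin_three_add_one_add_one, add_assoc t 1 2]
        rw [this]
        congr 3
        exact (add_zero t).symm) (by
        change Real.log (conjForm ρ a x y 1) + a * logRoot ρ 2 +
          (Real.log (conjForm ρ a x y 2) + a * logRoot ρ 0) +
          (Real.log (conjForm ρ a x y 0) + a * logRoot ρ 1) = 0
        linear_combination hsum + a * hl012) (i + 2)
    simp only [fin_three_add_two_add_one] at hf
    rw [add_assoc i 2 2] at hf
    change Real.log (conjForm ρ a x y i) + a * logRoot ρ (i + 1) = 0 at hf
    have h3 := lt_of_le_of_ne h1 g02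
    have h4 := hl i
    have h5 : logRoot ρ (i + 1) < 0 := by linarith
    nlinarith
  · rw [max_eq_right h1, max_eq_right h2] at h
    have hall := hs.log_add_eq_of_eq (i := i) (σ := 2) (τ := 1) (by linarith)
    refine hs.not_forall_log_eq_mul fun t => sub_eq_zero.1 (eq_zero_of_rotate_eq
      (f := fun t => Real.log (conjForm ρ a x y t) - a * logRoot ρ t) (fun t => ?_) ?_ t)
    · have := hall (t + 2)
      rw [fin_three_add_two_add_one, add_assoc t 2 2] at this
      change _ + a * logRoot ρ (t + 1) = Real.log (conjForm ρ a x y (t + 1)) + _ at this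
      linarith
    · linear_combination hsum - a * hl012

theorem abs_dominantLog_le (hs : IsSolution n ρ a x y) {κ : ℝ} (hκ : 1 / 10 ≤ κ)
    (hgap : ∀ i j, i ≠ j → κ ≤ |logRoot ρ i - logRoot ρ j|) (i : Fin 3) :
    |dominantLog ρ a x y i| ≤ |siegelLog ρ a x y i| + 22 * Real.exp (-(a * κ)) := by
  obtain ⟨n01, n02, -⟩ := fin_three_ne i
  have h1 := (hs.log_sub hκ hgap n01).2
  have h2 := (hs.log_sub hκ hgap n02).2
  have h3 := neg_abs_le (siegelLog ρ a x y i)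
  have h4 := le_abs_self (siegelLog ρ a x y i)
  have h5 : dominantLog ρ a x y i = siegelLog ρ a x y i -
      (Real.log (cyclicRoots ρ i ^ a - cyclicRoots ρ (i + 2) ^ a) -
        a * max (logRoot ρ i) (logRoot ρ (i + 2))) +
      (Real.log (cyclicRoots ρ i ^ a - cyclicRoots ρ (i + 1) ^ a) -
        a * max (logRoot ρ i) (logRoot ρ (i + 1))) := by
    unfold dominantLog siegelLog
    ring
  rw [abs_le] at h1 h2 ⊢
  constructor <;> linarith

end IsSolution

end ReducedLog

section Bounds

/-- An inequality `X ≤ (c (A + log X)) ^ 50` bounds `X` polynomially in `A`. -/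
theorem exists_le_mul_pow (c : ℝ) (hc : 0 < c) : ∃ C : ℝ, 1 ≤ C ∧ ∀ A X : ℝ, 2 / 3 ≤ A → 1 ≤ X →
    X ≤ (c * (A + Real.log X)) ^ 50 → X ≤ C * A ^ 50 := by
  have hlo := (Real.isLittleO_pow_log_id_atTop (n := 50)).def
    (by positivity : 0 < (2 * (2 * c) ^ 50)⁻¹)
  obtain ⟨X0, hX0⟩ := Filter.eventually_atTop.1 hlo
  refine ⟨(2 * c) ^ 50 + (|X0| + 1) * (3 / 2) ^ 50, ?_, fun A X hA hX h => ?_⟩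
  · have h1 : (1 : ℝ) ≤ (3 / 2) ^ 50 := one_le_pow₀ (by norm_num)
    have h2 := abs_nonneg X0
    have h3 : 0 ≤ (2 * c) ^ 50 := by positivity
    nlinarith
  have hl := Real.log_nonneg hX
  have h32 : 1 ≤ (3 / 2) ^ 50 * A ^ 50 := by
    rw [← mul_pow]
    exact one_le_pow₀ (by linarith)
  have hn1 : 0 ≤ (2 * c) ^ 50 * A ^ 50 := by positivity
  have hn2 : 0 ≤ (|X0| + 1) * ((3 / 2) ^ 50 * A ^ 50) := by positivity
  rw [add_mul, mul_assoc (|X0| + 1)]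
  rcases le_total (Real.log X) A with hA' | hA'
  · have h1 : (c * (A + Real.log X)) ^ 50 ≤ (2 * c * A) ^ 50 :=
      pow_le_pow_left₀ (by positivity) (by nlinarith) _
    rw [mul_pow (2 * c)] at h1
    linarith
  · have h1 : (c * (A + Real.log X)) ^ 50 ≤ (2 * c * Real.log X) ^ 50 :=
      pow_le_pow_left₀ (by positivity) (by nlinarith) _
    rw [mul_pow (2 * c)] at h1
    have hlt : X < X0 := by
      by_contra! hge
      have h2 := hX0 X hge
      rw [Real.norm_eq_abs, Real.norm_eq_abs, id, abs_of_nonneg (pow_nonneg hl 50),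
        abs_of_pos (by linarith), ← div_eq_inv_mul,
        le_div_iff₀ (mul_pos two_pos (pow_pos (by linarith) 50))] at h2
      linarith
    have h3 := le_abs_self X0
    nlinarith [abs_nonneg X0]

theorem exists_pow_log_lt (C : ℝ) (hC : 0 < C) (m : ℕ) :
    ∃ R : ℝ, ∀ ρ ≥ R, C * Real.log (1 + ρ) ^ m < ρ := by
  have hlo := (Real.isLittleO_pow_log_id_atTop (n := m)).def (by positivity : 0 < (2 * C)⁻¹)
  obtain ⟨X0, hX0⟩ := Filter.eventually_atTop.1 hlo
  refine ⟨max X0 2, fun ρ hρ => ?_⟩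
  have h1 : X0 ≤ ρ := (le_max_left _ _).trans hρ
  have h2 : 2 ≤ ρ := (le_max_right _ _).trans hρ
  have h3 := hX0 (1 + ρ) (by linarith)
  have h4 : 0 ≤ Real.log (1 + ρ) ^ m := pow_nonneg (Real.log_nonneg (by linarith)) m
  rw [Real.norm_eq_abs, Real.norm_eq_abs, id, abs_of_nonneg h4,
    abs_of_pos (by linarith), ← div_eq_inv_mul, le_div_iff₀ (by positivity)] at h3
  linarith

theorem lt_add_of_exp_lt {u v w : ℝ} (h : Real.exp (-u) < w) (hw : w ≤ Real.exp v) : -u < v :=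
  Real.exp_lt_exp.1 (h.trans_le hw)

theorem le_add_mul_pow {A B X c d : ℝ} (hA : 0 ≤ A) (hB : 1 ≤ B) (hAB : A ≤ B) (hc : 0 ≤ c)
    (hd : 0 ≤ d) (hcd : 1 ≤ c + d) (m : ℕ) (hm : m ≠ 0) (hX : X ≤ c + d * A ^ m) :
    X ≤ ((c + d) * B) ^ m := by
  have h1 : A ^ m ≤ B ^ m := pow_le_pow_left₀ hA hAB m
  have h2 : 1 ≤ B ^ m := one_le_pow₀ hB
  have h3 : c + d ≤ (c + d) ^ m := le_self_pow₀ hcd hm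
  rw [mul_pow]
  have h4 := mul_le_mul_of_nonneg_right h3 (by linarith : 0 ≤ B ^ m)
  nlinarith

/-- The size of a solution is polynomially bounded in terms of `a * log (1 + ρ)`. -/
theorem exists_logSize_le : ∃ C : ℝ, 1 ≤ C ∧ ∀ {n : ℤ} {ρ : ℝ} {a : ℕ} {x y : ℤ},
    IsSolution n ρ a x y → logSize ρ a y ≤ C * (a * Real.log (1 + ρ)) ^ 50 := by
  obtain ⟨C, hC, h⟩ := exists_le_mul_pow (63000 * 14700) (by norm_num)
  have hK : (59 : ℝ) ≤ 59 * (3 / 2) ^ 50 := by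
    have h1 : (1 : ℝ) ≤ (3 / 2) ^ 50 := one_le_pow₀ (by norm_num)
    linarith
  refine ⟨C + 59 * (3 / 2) ^ 50, by linarith, fun {n ρ a x y} hs => ?_⟩
  have hH := log_two_lt_log_one_add hs.one_lt
  have haH := hs.log_le_mul
  have hp : 0 ≤ C * (a * Real.log (1 + ρ)) ^ 50 := by positivity
  have hq : (59 : ℝ) ≤ 59 * (3 / 2) ^ 50 * (a * Real.log (1 + ρ)) ^ 50 := by
    rw [mul_assoc, ← mul_pow]
    have h1 : (1 : ℝ) ≤ (3 / 2 * (a * Real.log (1 + ρ))) ^ 50 := one_le_pow₀ (by linarith)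
    linarith
  rw [add_mul]
  rcases le_total 59 (logSize ρ a y) with hS | hS
  · obtain ⟨i, hi⟩ := exists_isMinIndex ρ a x y
    have h1 := lt_add_of_exp_lt (hs.exp_neg_lt_siegelLog hS hi) (hs.siegelLog_le hi hS).2
    have hA : 2 / 3 ≤ a * Real.log (1 + ρ) := by linarith
    have hX : 1 ≤ 212 * logSize ρ a y := by linarith
    have hlX := Real.log_nonneg hX
    have h2 : 212 * logSize ρ a y ≤ C * (a * Real.log (1 + ρ)) ^ 50 := by
      refine h _ _ hA hX ?_
      clear hp hq h
      generalize (a : ℝ) * Real.log (1 + ρ) = A at *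
      generalize Real.log (212 * logSize ρ a y) = L at *
      have h3 : (21000 * (3 * A + L)) ^ 50 ≤ (63000 * (A + L)) ^ 50 :=
        pow_le_pow_left₀ (by positivity) (by linarith) _
      have h4 : 1 ≤ (63000 * (A + L)) ^ 50 := one_le_pow₀ (by linarith)
      have h5 : (63000 * 14700 * (A + L)) ^ 50 = 14700 ^ 50 * (63000 * (A + L)) ^ 50 := by
        rw [← mul_pow]; congr 1; ring
      have h6 : (14700 : ℝ) ≤ 14700 ^ 50 := le_self_pow₀ (by norm_num) (by norm_num)
      rw [h5]
      nlinarith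
    linarith
  · linarith

/-- The exponent of a solution is polynomially bounded in terms of `log (1 + ρ)`. -/
theorem exists_exponent_le : ∃ C : ℝ, 1 ≤ C ∧ ∀ {n : ℤ} {ρ : ℝ} {a : ℕ} {x y : ℤ},
    IsSolution n ρ a x y → (a : ℝ) ≤ C * Real.log (1 + ρ) ^ 50 := by
  obtain ⟨C, hC, hsize⟩ := exists_logSize_le
  obtain ⟨K, hK⟩ : ∃ K, K = Real.log (212 * C) := ⟨_, rfl⟩
  have hK0 : 0 ≤ K := hK ▸ Real.log_nonneg (by linarith)
  obtain ⟨C', hC', h⟩ := exists_le_mul_pow (21000 * (51 + 2 * K) * 710) (by positivity)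
  have hK' : (89 : ℝ) ≤ 89 * (3 / 2) ^ 50 := by
    have h1 : (1 : ℝ) ≤ (3 / 2) ^ 50 := one_le_pow₀ (by norm_num)
    linarith
  refine ⟨C' + 89 * (3 / 2) ^ 50, by linarith, fun {n ρ a x y} hs => ?_⟩
  have hH := log_two_lt_log_one_add hs.one_lt
  have ha := hs.one_le_cast
  have hp : 0 ≤ C' * Real.log (1 + ρ) ^ 50 := by positivity
  have hq : (89 : ℝ) ≤ 89 * (3 / 2) ^ 50 * Real.log (1 + ρ) ^ 50 := by
    rw [mul_assoc, ← mul_pow]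
    have h1 : (1 : ℝ) ≤ (3 / 2 * Real.log (1 + ρ)) ^ 50 := one_le_pow₀ (by linarith)
    linarith
  have haS := hs.two_thirds_le
  rw [add_mul]
  rcases le_total 59 (logSize ρ a y) with hS | hS
  · obtain ⟨i, hi⟩ := exists_isMinIndex ρ a x y
    have hup : |dominantLog ρ a x y i| ≤ Real.exp (70 - a * (1 / 10)) := by
      have h1 := hs.abs_dominantLog_le le_rfl
        (one_div_ten_le_abs_logRoot_sub hs.n_nonneg hs.one_lt hs.root) i
      have h2 := (hs.siegelLog_le hi hS).2
      have h3 : Real.exp (68 - logSize ρ a y) ≤ Real.exp 68 * Real.exp (-(a * (1 / 10))) := by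
        rw [← Real.exp_add]
        exact Real.exp_le_exp.2 (by linarith)
      have h4 : Real.exp (70 - a * (1 / 10)) =
          Real.exp 2 * Real.exp 68 * Real.exp (-(a * (1 / 10))) := by
        rw [← Real.exp_add, ← Real.exp_add]
        congr 1
        ring
      have h5 := Real.add_one_le_exp (2 : ℝ)
      have h6 := Real.add_one_le_exp (68 : ℝ)
      have h7 := Real.exp_pos (-(a * (1 / 10) : ℝ))
      have h8 : Real.exp 68 + 22 ≤ Real.exp 2 * Real.exp 68 := by nlinarith
      rw [h4]
      nlinarith
    have h1 := lt_add_of_exp_lt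
      ((hs.dominantLog_eq_zero_or hS i).resolve_left (hs.dominantLog_ne_zero hi)) hup
    have hla := Real.log_nonneg ha
    have hL : Real.log (212 * logSize ρ a y) ≤ K + 50 * Real.log a + 50 * Real.log (1 + ρ) := by
      have h2 : 212 * logSize ρ a y ≤ 212 * C * (a * Real.log (1 + ρ)) ^ 50 := by
        linarith [hsize hs]
      refine (Real.log_le_log (by linarith) h2).trans ?_
      have hH0 : Real.log (1 + ρ) ≠ 0 := by positivity
      have ha0 : (a : ℝ) ≠ 0 := by positivity
      rw [Real.log_mul (by positivity) (pow_ne_zero _ (mul_ne_zero ha0 hH0)), Real.log_pow,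
        Real.log_mul ha0 hH0, ← hK]
      have h3 := Real.log_le_sub_one_of_pos (by linarith : 0 < Real.log (1 + ρ))
      push_cast
      linarith
    have hLn : 0 ≤ Real.log (212 * logSize ρ a y) := Real.log_nonneg (by linarith)
    have h2 : (a : ℝ) ≤ C' * Real.log (1 + ρ) ^ 50 := by
      refine h _ _ hH.le ha ?_
      clear hp hq h hup
      generalize Real.log (1 + ρ) = H at *
      generalize Real.log (212 * logSize ρ a y) = L at *
      generalize Real.log (a : ℝ) = l at *
      have h3 := le_add_mul_pow (A := 21000 * (H + L)) (B := 21000 * (51 + 2 * K) * (H + l))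
        (X := a) (c := 700) (d := 10) (by linarith) (by nlinarith) (by nlinarith) (by norm_num)
        (by norm_num) (by norm_num) 50 (by norm_num) (by linarith)
      refine h3.trans_eq ?_
      congr 1
      ring
    linarith
  · linarith

/-- The size of a solution is polynomially bounded in terms of `log (1 + ρ)`. -/
theorem exists_logSize_le_log : ∃ C : ℝ, 1 ≤ C ∧ ∀ {n : ℤ} {ρ : ℝ} {a : ℕ} {x y : ℤ},
    IsSolution n ρ a x y → logSize ρ a y ≤ C * Real.log (1 + ρ) ^ 2550 := by
  obtain ⟨C, hC, h⟩ := exists_logSize_le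
  obtain ⟨C', hC', h'⟩ := exists_exponent_le
  refine ⟨C * C' ^ 50, one_le_mul_of_one_le_of_one_le hC (one_le_pow₀ hC'),
    fun {n ρ a x y} hs => (h hs).trans ?_⟩
  have hH : 0 < Real.log (1 + ρ) := by linarith [log_two_lt_log_one_add hs.one_lt]
  have h1 : (a * Real.log (1 + ρ)) ^ 50 ≤ (C' * Real.log (1 + ρ) ^ 50 * Real.log (1 + ρ)) ^ 50 :=
    pow_le_pow_left₀ (by positivity) (mul_le_mul_of_nonneg_right (h' hs) hH.le) _
  have h2 : (C' * Real.log (1 + ρ) ^ 50 * Real.log (1 + ρ)) ^ 50 =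
      C' ^ 50 * Real.log (1 + ρ) ^ 2550 := by
    generalize Real.log (1 + ρ) = H
    rw [mul_assoc, ← pow_succ, mul_pow, ← pow_mul]
  rw [h2] at h1
  rw [mul_assoc]
  exact mul_le_mul_of_nonneg_left h1 (by linarith)

end Bounds

/-! ### Solutions with a large positive root -/

section LargeRoot

variable {n : ℤ} {ρ : ℝ} {a : ℕ} {x y : ℤ}

theorem exp_neg_le_abs_comb (hρ : 1 < ρ) (hl : 1 ≤ logRoot ρ 0) {p q : ℤ}
    (h : p * logRoot ρ 0 + q * logRoot ρ 2 ≠ 0) (hq : |(q : ℝ)| * logRoot ρ 2 ≤ 1 / 2) :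
    Real.exp (-Real.log (1 + ρ)) ≤ |p * logRoot ρ 0 + q * logRoot ρ 2| := by
  have h2 := (logRoot_pos hρ).2
  rcases eq_or_ne p 0 with rfl | hp
  · rw [Int.cast_zero, zero_mul, zero_add] at h ⊢
    have hq0 : q ≠ 0 := by
      rintro rfl
      exact h (by simp)
    have hq1 : (1 : ℝ) ≤ |(q : ℝ)| := by exact_mod_cast Int.one_le_abs hq0
    rw [abs_mul, abs_of_pos h2]
    nlinarith [(one_div_le_logRoot_two hρ).1]
  · have hp1 : (1 : ℝ) ≤ |(p : ℝ)| := by exact_mod_cast Int.one_le_abs hp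
    have h3 : 1 ≤ |p * logRoot ρ 0| := by
      rw [abs_mul, abs_of_pos (logRoot_pos hρ).1]
      nlinarith
    have h4 : |q * logRoot ρ 2| ≤ 1 / 2 := by rwa [abs_mul, abs_of_pos h2]
    have h5 := abs_sub_abs_le_abs_sub (p * logRoot ρ 0) (-(q * logRoot ρ 2))
    rw [abs_neg, sub_neg_eq_add] at h5
    have h6 : Real.exp (-Real.log (1 + ρ)) ≤ 1 / 2 := by
      rw [Real.exp_neg, Real.exp_log (by linarith), ← one_div]
      exact one_div_le_one_div_of_le (by norm_num) (by linarith)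
    linarith

/-- For `a = 1` the logarithms of the differences of the roots are explicit. -/
theorem log_cyclicRoots_sub_sub (hρ : 0 < ρ) (i : Fin 3)
    (h01 : cyclicRoots ρ i - cyclicRoots ρ (i + 1) ≠ 0) :
    Real.log (cyclicRoots ρ i - cyclicRoots ρ (i + 2)) -
      Real.log (cyclicRoots ρ i - cyclicRoots ρ (i + 1)) = logRoot ρ (i + 2) := by
  have h : cyclicRoots ρ i - cyclicRoots ρ (i + 2) =
      -(cyclicRoots ρ (i + 2) * (cyclicRoots ρ i - cyclicRoots ρ (i + 1))) := by
    have h1 : 1 + ρ ≠ 0 := by positivity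
    fin_cases i
    · change ρ - -(1 + ρ) / ρ = -(-(1 + ρ) / ρ * (ρ - -1 / (1 + ρ)))
      field_simp
      ring
    · change -1 / (1 + ρ) - ρ = -(ρ * (-1 / (1 + ρ) - -(1 + ρ) / ρ))
      field_simp
      ring
    · change -(1 + ρ) / ρ - -1 / (1 + ρ) = -(-1 / (1 + ρ) * (-(1 + ρ) / ρ - ρ))
      field_simp
      ring
  rw [h, Real.log_neg_eq_log, Real.log_mul (cyclicRoots_ne_zero hρ _) h01, logRoot]
  ring

namespace IsSolution

theorem exists_comb (hs : IsSolution n ρ a x y) (hR : 1100 ≤ ρ) (hS : 59 ≤ logSize ρ a y)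
    (i : Fin 3) : ∃ p q : ℤ, |(p : ℝ)| ≤ 99 * logSize ρ a y ∧ |(q : ℝ)| ≤ 99 * logSize ρ a y ∧
      Real.log (conjForm ρ a x y (i + 1)) - Real.log (conjForm ρ a x y (i + 2)) =
        p * logRoot ρ i + q * logRoot ρ (i + 1) := by
  obtain ⟨p, q, η, hη, hp, hq, -, hlog, h⟩ := hs.exists_decomposition hS i
  have hc := eq_const_of_mem_conjRing hR hs.pos hs.root hη hlog
  refine ⟨p, q, hp, hq, ?_⟩
  rw [h, hc (i + 1), hc (i + 2)]
  ring

/-- For large `ρ`, a nonzero logarithmic form attached to a solution is at least `1 / (1 + ρ)`. -/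
theorem exp_neg_le_abs_add (hs : IsSolution n ρ a x y) (hR : 1100 ≤ ρ)
    (hS : 59 ≤ logSize ρ a y) (hl : 1 ≤ logRoot ρ 0) (hsmall : 500 * logSize ρ a y ≤ ρ)
    {i : Fin 3} {p' q' : ℤ} (hp' : |(p' : ℝ)| ≤ 2) (hq' : |(q' : ℝ)| ≤ 2) {Λ : ℝ}
    (hΛ : Λ = Real.log (conjForm ρ a x y (i + 1)) - Real.log (conjForm ρ a x y (i + 2)) +
      a * (p' * logRoot ρ i + q' * logRoot ρ (i + 1))) (hΛ0 : Λ ≠ 0) :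
    Real.exp (-Real.log (1 + ρ)) ≤ |Λ| := by
  obtain ⟨p, q, hp, hq, h⟩ := hs.exists_comb hR hS i
  have ha := hs.two_thirds_le
  have ha1 := hs.one_le_cast
  have hcoef : ∀ r r' : ℤ, |(r : ℝ)| ≤ 99 * logSize ρ a y → |(r' : ℝ)| ≤ 2 →
      |((r + a * r' : ℤ) : ℝ)| ≤ 106 * logSize ρ a y := fun r r' hr hr' => by
    push_cast
    refine (abs_add_le _ _).trans ?_
    rw [abs_mul, Nat.abs_cast]
    nlinarith
  obtain ⟨P, Q, -, hQ, hPQ⟩ := exists_logRoot_comb hs.one_lt i _ _ (hcoef p p' hp hp')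
    (hcoef q q' hq hq')
  have hΛ' : Λ = P * logRoot ρ 0 + Q * logRoot ρ 2 := by
    rw [hΛ, h, ← hPQ]
    push_cast
    ring
  rw [hΛ'] at hΛ0 ⊢
  refine exp_neg_le_abs_comb hs.one_lt hl hΛ0 ?_
  have h1 := (one_div_le_logRoot_two hs.one_lt).2
  have hρ := hs.pos
  calc |(Q : ℝ)| * logRoot ρ 2 ≤ (2 * (106 * logSize ρ a y)) * (1 / ρ) :=
        mul_le_mul hQ h1 (logRoot_pos hs.one_lt).2.le (by linarith)
    _ ≤ 1 / 2 := by
        rw [mul_one_div, div_le_iff₀ hρ]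
        linarith

theorem two_le_exponent_false (hs : IsSolution n ρ a x y) (ha : 2 ≤ a) (hR : 1100 ≤ ρ)
    (hl : 200 ≤ logRoot ρ 0) (hsmall : 500 * logSize ρ a y ≤ ρ) : False := by
  have hρ := hs.one_lt
  have hH := logRoot_zero_add_two hρ
  have h2 := (logRoot_pos hρ).2
  have hH' := log_one_add_le hρ
  have hlog2 := Real.log_two_lt_d9
  have ha' : (2 : ℝ) ≤ a := by exact_mod_cast ha
  have hS : 2 * logRoot ρ 0 ≤ logSize ρ a y := by nlinarith [hs.le_logSize]
  obtain ⟨i, hi⟩ := exists_isMinIndex ρ a x y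
  obtain ⟨p, q, hp, hq, hmax⟩ := exists_max_logRoot_comb hρ i
  have hlow := hs.exp_neg_le_abs_add hR (by linarith) (by linarith) hsmall hp hq
    (Λ := dominantLog ρ a x y i) (by rw [dominantLog, hmax]) (hs.dominantLog_ne_zero hi)
  have hup := hs.abs_dominantLog_le (κ := logRoot ρ 0 - Real.log 2) (by linarith)
    (sub_log_two_le_abs_logRoot_sub hρ) i
  have h3 := (hs.siegelLog_le hi (by linarith)).2
  have h4 : Real.exp (68 - logSize ρ a y) ≤ Real.exp 68 * Real.exp (2 - 2 * logRoot ρ 0) := by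
    rw [← Real.exp_add]
    exact Real.exp_le_exp.2 (by linarith)
  have h5 : Real.exp (-(a * (logRoot ρ 0 - Real.log 2))) ≤ Real.exp (2 - 2 * logRoot ρ 0) :=
    Real.exp_le_exp.2 (by nlinarith)
  have h6 : Real.exp 68 + 22 ≤ Real.exp 70 := by
    have h7 : Real.exp 70 = Real.exp 2 * Real.exp 68 := by rw [← Real.exp_add]; norm_num
    have h8 := Real.add_one_le_exp (2 : ℝ)
    have h9 := Real.add_one_le_exp (68 : ℝ)
    nlinarith
  have h7 : Real.exp (-Real.log (1 + ρ)) ≤ Real.exp (70 + (2 - 2 * logRoot ρ 0)) := by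
    rw [Real.exp_add]
    nlinarith [Real.exp_pos (2 - 2 * logRoot ρ 0)]
  have := Real.exp_le_exp.1 h7
  linarith

/-- For `a = 1`, if the minimal conjugate is not the first one, then `y` is large. -/
theorem le_log_y (hs : IsSolution n ρ 1 x y) (hl : 200 ≤ logRoot ρ 0) {i : Fin 3}
    (hi : IsMinIndex ρ 1 x y i) (hi0 : i ≠ 0) : logRoot ρ 0 - 1 ≤ Real.log (y : ℝ) := by
  have hρ := hs.one_lt
  have hρ0 := hs.pos
  have hlog2 := Real.log_two_lt_d9
  have hY := hs.log_y_nonneg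
  have hH := logRoot_zero_add_two hρ
  have h2 := (logRoot_pos hρ).2
  have hhalf : |conjForm ρ 1 x y i| ≤ 1 / 2 := by
    obtain ⟨n01, n02, -⟩ := fin_three_ne i
    have h3 := hs.le_log_conjForm hi n01
    have h4 := hs.le_log_conjForm hi n02
    have h5 := (abs_le.1 (hs.log_sub_le n01).2).1
    have h6 := (abs_le.1 (hs.log_sub_le n02).2).1
    have h7 := (max_logRoot_le hρ i).2
    have h8 := hs.sum_log_rotate i
    rw [Nat.cast_one, one_mul] at h5 h6
    have h9 : Real.log (conjForm ρ 1 x y i) ≤ -1 := by linarith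
    rw [← Real.log_abs] at h9
    have h10 := (Real.log_le_iff_le_exp (abs_pos.2 (hs.conjForm_ne_zero i))).1 h9
    have h11 := Real.exp_one_gt_d9
    rw [Real.exp_neg] at h10
    refine h10.trans ?_
    rw [inv_le_comm₀ (by positivity) (by norm_num)]
    linarith
  have hkey : ∀ (z : ℤ) (w : ℝ), z ≠ 0 → |(z : ℝ) + w * y| ≤ 1 / 2 → |w| ≤ 1 / ρ →
      logRoot ρ 0 - 1 ≤ Real.log (y : ℝ) := fun z w hz hzw hw => by
    have h3 : (1 : ℝ) ≤ |(z : ℝ)| := by exact_mod_cast Int.one_le_abs hz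
    have h4 := abs_sub_abs_le_abs_sub (z : ℝ) (-(w * y))
    rw [abs_neg, sub_neg_eq_add, abs_mul] at h4
    have h5 : |w| * |(y : ℝ)| ≤ 1 / ρ * |(y : ℝ)| := mul_le_mul_of_nonneg_right hw (abs_nonneg _)
    have h6 : 1 / 2 ≤ |(y : ℝ)| / ρ := by
      rw [one_div_mul_eq_div] at h5
      linarith
    rw [le_div_iff₀ hρ0] at h6
    have h7 : Real.log (ρ / 2) ≤ Real.log |(y : ℝ)| :=
      Real.log_le_log (by linarith) (by linarith)
    rw [Real.log_div hρ0.ne' two_ne_zero, Real.log_abs] at h7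
    rw [logRoot_zero]
    linarith
  have h12 : i = 1 ∨ i = 2 := by
    clear hhalf hi
    revert hi0 i
    decide
  rcases h12 with rfl | rfl
  · refine hkey x (1 / (1 + ρ)) hs.x_ne_zero ?_ ?_
    · convert hhalf using 2
      rw [conjForm, cyclicRoots_one]
      ring
    · rw [abs_of_pos (by positivity)]
      exact one_div_le_one_div_of_le hρ0 (by linarith)
  · refine hkey (x + y) (1 / ρ) ?_ ?_ (abs_of_pos (by positivity)).le
    · intro hxy
      have hx : (x : ℝ) = -y := by
        have : x = -y := by linarith
        exact_mod_cast this
      have h3 := hs.norm_eq_one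
      have h4 : conjForm ρ 1 x y 0 * conjForm ρ 1 x y 1 * conjForm ρ 1 x y 2 = (y : ℝ) ^ 3 := by
        simp only [conjForm, cyclicRoots_zero, cyclicRoots_one, cyclicRoots_two, hx, pow_one]
        field_simp
        ring
      rw [h4, abs_pow] at h3
      have h5 : |y| = 1 := by
        have h6 : |(y : ℝ)| = 1 := (pow_eq_one_iff_of_nonneg (abs_nonneg _) three_ne_zero).1 h3
        exact_mod_cast h6
      have h7 : x = -y := by linarith
      rcases hs.two_le with h8 | h8
      · rw [h7, abs_neg] at h8
        omega
      · omega
    · convert hhalf using 2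
      rw [conjForm, cyclicRoots_two]
      push_cast
      field_simp
      ring

theorem exponent_one_false (hs : IsSolution n ρ 1 x y) (hR : 1100 ≤ ρ)
    (hl : 200 ≤ logRoot ρ 0) (hsmall : 500 * logSize ρ 1 y ≤ ρ) : False := by
  have hρ := hs.one_lt
  have hH := logRoot_zero_add_two hρ
  have h1 := logRoot_one_eq hρ
  have h2 := (logRoot_pos hρ).2
  have h2' : logRoot ρ 2 ≤ 1 := (one_div_le_logRoot_two hρ).2.trans (by
    rw [div_le_one hs.pos]; exact hρ.le)
  have hlog2 := Real.log_two_lt_d9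
  have hY := hs.log_y_nonneg
  have hS := hs.le_logSize
  rw [Nat.cast_one, one_mul] at hS
  obtain ⟨i, hi⟩ := exists_isMinIndex ρ 1 x y
  obtain ⟨h0, hup⟩ := hs.siegelLog_bound hi (X := 70 - 4 * logRoot ρ 0) (by
    rw [Nat.cast_one, one_mul]
    have m01 : max (logRoot ρ 0) (logRoot ρ 1) = logRoot ρ 0 := max_eq_left (by linarith)
    have m02 : max (logRoot ρ 0) (logRoot ρ 2) = logRoot ρ 0 := max_eq_left (by linarith)
    have m12 : max (logRoot ρ 1) (logRoot ρ 2) = logRoot ρ 2 := max_eq_right (by linarith)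
    have hy := hs.le_log_y hl hi
    fin_cases i
    · change 58 - 3 * Real.log (y : ℝ) + (max (logRoot ρ 1) (logRoot ρ 2) -
        2 * max (logRoot ρ 0) (logRoot ρ 1) - 2 * max (logRoot ρ 0) (logRoot ρ 2)) ≤ _
      rw [m01, m02, m12]
      linarith
    · have hy := hy (by decide)
      change 58 - 3 * Real.log (y : ℝ) + (max (logRoot ρ 2) (logRoot ρ 0) -
        2 * max (logRoot ρ 1) (logRoot ρ 2) - 2 * max (logRoot ρ 1) (logRoot ρ 0)) ≤ _
      rw [max_comm _ (logRoot ρ 0), max_comm _ (logRoot ρ 0), m01, m02, m12]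
      linarith
    · have hy := hy (by decide)
      change 58 - 3 * Real.log (y : ℝ) + (max (logRoot ρ 0) (logRoot ρ 1) -
        2 * max (logRoot ρ 2) (logRoot ρ 0) - 2 * max (logRoot ρ 2) (logRoot ρ 1)) ≤ _
      rw [max_comm _ (logRoot ρ 0), max_comm (logRoot ρ 2), m01, m02, m12]
      linarith) (by linarith)
  have hsub := log_cyclicRoots_sub_sub hs.pos i (by
    simpa only [pow_one] using (hs.log_sub_le (fin_three_ne i).1).1)
  have hlow := hs.exp_neg_le_abs_add hR (by linarith) (by linarith) hsmall (i := i)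
    (p' := -1) (q' := -1) (by norm_num) (by norm_num) (Λ := siegelLog ρ 1 x y i) (by
      rw [siegelLog]
      simp only [pow_one]
      rw [logRoot_add_two hρ] at hsub
      push_cast
      linarith) h0
  have h3 : (11 : ℝ) ≤ Real.exp 10 := by linarith [Real.add_one_le_exp (10 : ℝ)]
  have h4 : Real.exp (-Real.log (1 + ρ)) ≤ Real.exp (10 + (70 - 4 * logRoot ρ 0)) := by
    rw [Real.exp_add]
    nlinarith [Real.exp_pos (70 - 4 * logRoot ρ 0)]
  have := Real.exp_le_exp.1 h4
  linarith

end IsSolution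

theorem exists_root_le : ∃ R : ℝ, ∀ {n : ℤ} {ρ : ℝ} {a : ℕ} {x y : ℤ},
    IsSolution n ρ a x y → ρ ≤ R := by
  obtain ⟨C, hC, hsize⟩ := exists_logSize_le_log
  obtain ⟨R, hR⟩ := exists_pow_log_lt (500 * C) (by linarith) 2550
  refine ⟨max R (max 1100 (Real.exp 200)), fun {n ρ a x y} hs => ?_⟩
  by_contra! h
  obtain ⟨h1, h2⟩ := max_lt_iff.1 h
  obtain ⟨h2, h3⟩ := max_lt_iff.1 h2
  have hl : 200 ≤ logRoot ρ 0 := by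
    rw [logRoot_zero, Real.le_log_iff_exp_le hs.pos]
    exact h3.le
  have hsmall : 500 * logSize ρ a y ≤ ρ := by
    have h4 := hsize hs
    have h5 := hR ρ h1.le
    linarith
  rcases hs.one_le.eq_or_lt with rfl | ha
  · exact hs.exponent_one_false h2.le hl hsmall
  · exact hs.two_le_exponent_false ha h2.le hl hsmall

end LargeRoot

/-! ### Reduction to nonnegative parameters -/

section Reduction

variable {n : ℤ} {l0 l1 l2 : ℝ}

theorem exists_pos_root (n : ℤ) : ∃ ρ : ℝ, 0 < ρ ∧ fn n ρ = 0 := by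
  have hM : (0 : ℝ) ≤ |(n : ℝ)| + 3 := by positivity
  have hc : ContinuousOn (fn n) (Set.Icc 0 (|(n : ℝ)| + 3)) := by
    unfold fn
    fun_prop
  have h0 : fn n 0 ≤ 0 := by simp [fn]
  have h1 : 0 ≤ fn n (|(n : ℝ)| + 3) := by
    rw [fn]
    have h2 := le_abs_self (n : ℝ)
    have h3 := abs_nonneg (n : ℝ)
    generalize |(n : ℝ)| = m at *
    have h4 : (n : ℝ) * (m + 3) ≤ m * (m + 3) := mul_le_mul_of_nonneg_right h2 (by linarith)
    have h5 : (n : ℝ) * (m + 3) ^ 2 ≤ m * (m + 3) ^ 2 :=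
      mul_le_mul_of_nonneg_right h2 (by positivity)
    nlinarith [mul_nonneg h3 h3]
  obtain ⟨ρ, ⟨hρ, -⟩, h⟩ := intermediate_value_Icc hM hc ⟨h0, h1⟩
  refine ⟨ρ, lt_of_le_of_ne hρ ?_, h⟩
  rintro rfl
  simp [fn] at h

theorem eq_cyclicRoots_of_fn_eq_zero {ρ l : ℝ} (hρ : 0 < ρ) (h : fn n ρ = 0) (hl : fn n l = 0) :
    l = cyclicRoots ρ 0 ∨ l = cyclicRoots ρ 1 ∨ l = cyclicRoots ρ 2 := by
  have h1 : fn n l = (l - cyclicRoots ρ 0) * ((l - cyclicRoots ρ 1) * (l - cyclicRoots ρ 2)) := by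
    rw [fn, intCast_eq_of_fn_eq_zero hρ h, cyclicRoots_zero, cyclicRoots_one, cyclicRoots_two]
    field_simp
    ring
  rwa [h1, mul_eq_zero, mul_eq_zero, sub_eq_zero, sub_eq_zero, sub_eq_zero] at hl

theorem IsRoots.Fna_eq {ρ : ℝ} (hl : IsRoots n l0 l1 l2) (hρ : 0 < ρ) (h : fn n ρ = 0) (a : ℤ)
    (x y : ℝ) :
    Fna a l0 l1 l2 x y = Fna a (cyclicRoots ρ 0) (cyclicRoots ρ 1) (cyclicRoots ρ 2) x y := by
  obtain ⟨h0, h1, h2, n01, n02, n12⟩ := hl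
  rcases eq_cyclicRoots_of_fn_eq_zero hρ h h0 with e0 | e0 | e0 <;>
    rcases eq_cyclicRoots_of_fn_eq_zero hρ h h1 with e1 | e1 | e1 <;>
    rcases eq_cyclicRoots_of_fn_eq_zero hρ h h2 with e2 | e2 | e2 <;>
    first
    | exact absurd (e0.trans e1.symm) n01
    | exact absurd (e0.trans e2.symm) n02
    | exact absurd (e1.trans e2.symm) n12
    | (rw [e0, e1, e2]; done)
    | (rw [e0, e1, e2]; simp only [Fna]; ring)

theorem one_lt_of_fn_eq_zero {ρ : ℝ} (hn : 0 ≤ n) (hρ : 0 < ρ) (h : fn n ρ = 0) : 1 < ρ := by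
  have hn' : (0 : ℝ) ≤ n := by exact_mod_cast hn
  rw [fn] at h
  by_contra! h1
  have h2 : (0 : ℝ) ≤ n * (ρ ^ 2 + ρ) := by positivity
  nlinarith [mul_nonneg hρ.le (sub_nonneg.2 h1), mul_nonneg (sq_nonneg ρ) (sub_nonneg.2 h1)]

/-- Replacing `n` by `-n - 1` inverts the roots. -/
theorem fn_inv {l : ℝ} (h : fn n l = 0) : fn (-n - 1) l⁻¹ = 0 := by
  have hl : l ≠ 0 := by
    rintro rfl
    simp [fn] at h
  have h1 : fn (-n - 1) l⁻¹ = -fn n l / l ^ 3 := by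
    simp only [fn]
    push_cast
    field_simp
    ring
  rw [h1, h, neg_zero, zero_div]

theorem IsRoots.inv (hl : IsRoots n l0 l1 l2) : IsRoots (-n - 1) l0⁻¹ l1⁻¹ l2⁻¹ := by
  obtain ⟨h0, h1, h2, n01, n02, n12⟩ := hl
  exact ⟨fn_inv h0, fn_inv h1, fn_inv h2, fun h => n01 (inv_injective h),
    fun h => n02 (inv_injective h), fun h => n12 (inv_injective h)⟩

theorem Fna_neg_inv (a : ℤ) (l0 l1 l2 x y : ℝ) :
    Fna (-a) l0⁻¹ l1⁻¹ l2⁻¹ x y = Fna a l0 l1 l2 x y := by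
  simp only [Fna, inv_zpow', neg_neg]

theorem abs_Fna_neg (hprod : l0 * l1 * l2 = 1) (a : ℤ) (x y : ℝ) :
    |Fna (-a) l0 l1 l2 x y| = |Fna a l0 l1 l2 y x| := by
  have h0 : l0 ≠ 0 := by rintro rfl; simp at hprod
  have h1 : l1 ≠ 0 := by rintro rfl; simp at hprod
  have h2 : l2 ≠ 0 := by rintro rfl; simp at hprod
  have h3 : l0 ^ a * l1 ^ a * l2 ^ a = 1 := by rw [← mul_zpow, ← mul_zpow, hprod, one_zpow]
  have z0 := zpow_ne_zero a h0
  have z1 := zpow_ne_zero a h1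
  have z2 := zpow_ne_zero a h2
  have h4 : Fna (-a) l0 l1 l2 x y = -(l0 ^ a * l1 ^ a * l2 ^ a)⁻¹ * Fna a l0 l1 l2 y x := by
    simp only [Fna, zpow_neg]
    field_simp
    ring
  rw [h4, h3, inv_one, neg_one_mul, abs_neg]

theorem abs_eq_one_of_abs_pow_eq_one {z : ℤ} (h : |(z : ℝ) ^ 3| = 1) : |z| = 1 := by
  rw [abs_pow] at h
  have h1 : |(z : ℝ)| = 1 := (pow_eq_one_iff_of_nonneg (abs_nonneg _) three_ne_zero).1 h
  exact_mod_cast h1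

theorem isSolution_of_abs_Fna {ρ : ℝ} {a : ℕ} {x y : ℤ} (hn : 0 ≤ n) (hρ : 0 < ρ) (h : fn n ρ = 0)
    (ha : 1 ≤ a) (hxy : 2 ≤ max |x| |y|) (hF : |Fna a (cyclicRoots ρ 0) (cyclicRoots ρ 1)
      (cyclicRoots ρ 2) (x : ℝ) (y : ℝ)| = 1) : IsSolution n ρ a x y := by
  have hprod : cyclicRoots ρ 0 ^ a * cyclicRoots ρ 1 ^ a * cyclicRoots ρ 2 ^ a = 1 := by
    rw [← mul_pow, ← mul_pow, cyclicRoots_prod hρ, one_pow]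
  simp only [Fna, zpow_natCast] at hF
  refine ⟨hn, one_lt_of_fn_eq_zero hn hρ h, h, ha, ?_, ?_, le_max_iff.1 hxy, hF⟩
  · rintro rfl
    have h1 : |(y : ℝ) ^ 3| = 1 := by
      rw [← hF, ← abs_neg, ← mul_one (-(y : ℝ) ^ 3), ← hprod]
      congr 1
      push_cast
      ring
    rw [abs_eq_one_of_abs_pow_eq_one h1, abs_zero] at hxy
    norm_num at hxy
  · rintro rfl
    have h1 : |(x : ℝ) ^ 3| = 1 := by
      rw [← hF]
      congr 1
      push_cast
      ring
    rw [abs_eq_one_of_abs_pow_eq_one h1, abs_zero] at hxy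
    norm_num at hxy

/-- Up to exchanging `x` and `y`, a solution with `n ≥ 0` is a normalised one. -/
theorem IsRoots.exists_isSolution (hl : IsRoots n l0 l1 l2) (hn : 0 ≤ n) {a x y : ℤ} (ha : a ≠ 0)
    (hxy : 2 ≤ max |x| |y|) (hF : |Fna a l0 l1 l2 (x : ℝ) (y : ℝ)| = 1) :
    ∃ ρ, IsSolution n ρ a.natAbs x y ∨ IsSolution n ρ a.natAbs y x := by
  obtain ⟨ρ, hρ, h⟩ := exists_pos_root n
  refine ⟨ρ, ?_⟩
  rw [hl.Fna_eq hρ h] at hF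
  have ha1 : 1 ≤ a.natAbs := Int.natAbs_pos.2 ha
  rcases Int.natAbs_eq a with e | e
  · rw [e] at hF
    exact Or.inl (isSolution_of_abs_Fna hn hρ h ha1 hxy hF)
  · rw [e, abs_Fna_neg (cyclicRoots_prod hρ)] at hF
    exact Or.inr (isSolution_of_abs_Fna hn hρ h ha1 (by rwa [max_comm]) hF)

/-- The parameters of all normalised solutions are bounded. -/
theorem exists_forall_isSolution_le : ∃ B : ℝ, ∀ {n : ℤ} {ρ : ℝ} {a : ℕ} {x y : ℤ},
    IsSolution n ρ a x y → (n : ℝ) ≤ B ∧ (a : ℝ) ≤ B ∧ |(x : ℝ)| ≤ B ∧ |(y : ℝ)| ≤ B := by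
  obtain ⟨R, hR⟩ := exists_root_le
  obtain ⟨C, hC, hsize⟩ := exists_logSize_le_log
  obtain ⟨S, hS⟩ : ∃ S, S = C * Real.log (1 + R) ^ 2550 := ⟨_, rfl⟩
  refine ⟨max R (max (3 / 2 * S) (2 * Real.exp S)), fun {n ρ a x y} hs => ?_⟩
  have hρR := hR hs
  have hρ := hs.one_lt
  have hsz : logSize ρ a y ≤ S := by
    refine (hsize hs).trans ?_
    rw [hS]
    refine mul_le_mul_of_nonneg_left (pow_le_pow_left₀ (Real.log_nonneg (by linarith)) ?_ _)
      (by linarith)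
    exact Real.log_le_log (by linarith) (by linarith)
  have hexp := Real.exp_le_exp.2 hsz
  have hB1 : R ≤ max R (max (3 / 2 * S) (2 * Real.exp S)) := le_max_left _ _
  have hB2 : 3 / 2 * S ≤ max R (max (3 / 2 * S) (2 * Real.exp S)) :=
    (le_max_left _ _).trans (le_max_right _ _)
  have hB3 : 2 * Real.exp S ≤ max R (max (3 / 2 * S) (2 * Real.exp S)) :=
    (le_max_right _ _).trans (le_max_right _ _)
  generalize max R (max (3 / 2 * S) (2 * Real.exp S)) = B at *
  refine ⟨?_, ?_, ?_, ?_⟩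
  · have h1 : (n : ℝ) ≤ ρ := by
      rw [intCast_eq_of_fn_eq_zero hs.pos hs.root, div_le_iff₀ (by nlinarith)]
      nlinarith
    linarith
  · linarith [hs.two_thirds_le]
  · linarith [hs.abs_x_le]
  · have h1 : Real.log (y : ℝ) ≤ logSize ρ a y := by
      have h2 := Real.log_nonneg (by linarith : 1 ≤ 1 + ρ)
      rw [logSize]
      nlinarith [hs.one_le_cast]
    have hy : (y : ℝ) ≠ 0 := by exact_mod_cast hs.y_ne_zero
    rw [← Real.log_abs, Real.log_le_iff_le_exp (abs_pos.2 hy)] at h1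
    linarith [Real.exp_pos S]

end Reduction

theorem stmt0 :
    ∃ C : ℤ, ∀ (n a x y : ℤ) (l0 l1 l2 : ℝ), IsRoots n l0 l1 l2 →
      a ≠ 0 → 2 ≤ max |x| |y| →
      |Fna a l0 l1 l2 (x : ℝ) (y : ℝ)| = 1 →
      max (max |n| |a|) (max |x| |y|) ≤ C := by
  obtain ⟨B, hB⟩ := exists_forall_isSolution_le
  have hle : ∀ {z : ℤ}, (z : ℝ) ≤ B → z ≤ ⌈B⌉ := fun h => Int.cast_le.1 (h.trans (Int.le_ceil B))
  have hpos : ∀ (n a x y : ℤ) (l0 l1 l2 : ℝ), 0 ≤ n → IsRoots n l0 l1 l2 → a ≠ 0 →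
      2 ≤ max |x| |y| → |Fna a l0 l1 l2 (x : ℝ) (y : ℝ)| = 1 →
      n ≤ ⌈B⌉ ∧ |a| ≤ ⌈B⌉ ∧ |x| ≤ ⌈B⌉ ∧ |y| ≤ ⌈B⌉ := fun n a x y l0 l1 l2 hn hl ha hxy hF => by
    obtain ⟨ρ, hs | hs⟩ := hl.exists_isSolution hn ha hxy hF
    · obtain ⟨h1, h2, h3, h4⟩ := hB hs
      rw [Nat.cast_natAbs] at h2
      exact ⟨hle h1, hle h2, hle (by exact_mod_cast h3), hle (by exact_mod_cast h4)⟩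
    · obtain ⟨h1, h2, h3, h4⟩ := hB hs
      rw [Nat.cast_natAbs] at h2
      exact ⟨hle h1, hle h2, hle (by exact_mod_cast h4), hle (by exact_mod_cast h3)⟩
  refine ⟨⌈B⌉ + 1, fun n a x y l0 l1 l2 hl ha hxy hF => ?_⟩
  rcases le_or_gt 0 n with hn | hn
  · obtain ⟨h1, h2, h3, h4⟩ := hpos n a x y l0 l1 l2 hn hl ha hxy hF
    rw [max_le_iff, max_le_iff, max_le_iff, abs_of_nonneg hn]
    omega
  · obtain ⟨h1, h2, h3, h4⟩ := hpos (-n - 1) (-a) x y l0⁻¹ l1⁻¹ l2⁻¹ (by omega) hl.inv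
      (neg_ne_zero.2 ha) hxy (by rwa [Fna_neg_inv])
    rw [abs_neg] at h2
    rw [max_le_iff, max_le_iff, max_le_iff, abs_of_neg hn]
    omega
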